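/- Let f be a rational map of degree at least 2 with Julia set J. For 0 < α ≤ β ≤ α⁺ we have dim_H 𝓛(α,β) ≤ max{0, max_{α ≤ q ≤ β} F(q)}. In particular, for α ∈ [α⁻, α⁺]\{0}, dim_H 𝓛(α) ≤ F(α). -/

import Mathlib

open Filter Set Metric MeasureTheory Topology
open scoped ENNReal NNReal

noncomputable section

/-! ### The Riemann sphere with the chordal (spherical) metric -/

/-- The Riemann sphere `ℂ ∪ {∞}`. -/
structure RSphere : Type where
  val : Option ℂ

namespace RSphere

/-- The inclusion of `ℂ` into the Riemann sphere. -/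
def ofC (z : ℂ) : RSphere := ⟨some z⟩

/-- The point at infinity. -/
def infty : RSphere := ⟨none⟩

/-- Case elimination on a point of the Riemann sphere. -/
def elim {α : Sort*} (x : RSphere) (i : α) (h : ℂ → α) : α := Option.elim x.val i h

/-- Stereographic embedding of the Riemann sphere onto the round unit sphere in
`ℝ³ = ℂ ×₂ ℝ`.  It induces the chordal (spherical) metric on `RSphere`. -/
def embed (x : RSphere) : WithLp 2 (ℂ × ℝ) :=
  elim x ((WithLp.equiv 2 (ℂ × ℝ)).symm (0, 1))
    fun z => (WithLp.equiv 2 (ℂ × ℝ)).symm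
      (((2 / (‖z‖ ^ 2 + 1)) : ℝ) • z, (‖z‖ ^ 2 - 1) / (‖z‖ ^ 2 + 1))

/-- Inverse of the stereographic embedding. -/
def unembed (v : WithLp 2 (ℂ × ℝ)) : RSphere :=
  if (WithLp.equiv 2 (ℂ × ℝ) v).2 = 1 then infty
  else ofC ((1 - (WithLp.equiv 2 (ℂ × ℝ) v).2)⁻¹ • (WithLp.equiv 2 (ℂ × ℝ) v).1)

lemma leftInverse_unembed : Function.LeftInverse unembed embed := by
  rintro ⟨x⟩
  cases x with
  | none =>
      simp [embed, unembed, elim, infty]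
  | some z =>
      have h1 : (0 : ℝ) < ‖z‖ ^ 2 + 1 := by positivity
      have ht : (‖z‖ ^ 2 - 1) / (‖z‖ ^ 2 + 1) ≠ 1 := by
        intro h
        rw [div_eq_one_iff_eq h1.ne'] at h
        linarith
      simp only [embed, unembed, elim, Option.elim, Equiv.apply_symm_apply, ht, if_false, ofC]
      congr 2
      rw [smul_smul]
      have h2 : 1 - (‖z‖ ^ 2 - 1) / (‖z‖ ^ 2 + 1) = 2 / (‖z‖ ^ 2 + 1) := by
        field_simp
        ring
      rw [h2]
      rw [inv_mul_cancel₀ (by positivity), one_smul]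

lemma embed_injective : Function.Injective embed := leftInverse_unembed.injective

/-- The chordal metric on the Riemann sphere, induced by the stereographic embedding
onto the round unit sphere in Euclidean 3-space. -/
instance : MetricSpace RSphere := MetricSpace.induced embed embed_injective inferInstance

instance : MeasurableSpace RSphere := borel RSphere

instance : BorelSpace RSphere := ⟨rfl⟩

/-- Reading off a finite point (junk value `0` at `∞`). -/
def toC (x : RSphere) : ℂ := elim x 0 id

/-- The involution `z ↦ 1/z` of the Riemann sphere. -/
def inv (x : RSphere) : RSphere :=
  elim x (ofC 0) fun z => if z = 0 then infty else ofC z⁻¹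

end RSphere

/-! ### Basic dynamical notions -/

/-- The norm of the derivative of `g` at `x`, measured in the spherical metric
(for a rational map this is the usual norm of the spherical derivative). -/
def sphDeriv (g : RSphere → RSphere) (x : RSphere) : ℝ :=
  limsup (fun y => dist (g y) (g x) / dist y x) (𝓝[≠] x)

/-- The set of critical points. -/
def critSet (g : RSphere → RSphere) : Set RSphere := {x | sphDeriv g x = 0}

/-- The Fatou set: points having a neighbourhood on which the family of iterates is
equicontinuous (i.e. normal). -/
def fatouSet (f : RSphere → RSphere) : Set RSphere :=
  {x | ∃ U : Set RSphere, IsOpen U ∧ x ∈ U ∧ EquicontinuousOn (fun n : ℕ => f^[n]) U}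

/-- The Julia set. -/
def juliaSet (f : RSphere → RSphere) : Set RSphere := (fatouSet f)ᶜ

/-- `f` is the rational map on the Riemann sphere given by the coprime pair of
polynomials `p`, `q`. -/
structure IsRationalMap (f : RSphere → RSphere) (p q : Polynomial ℂ) : Prop where
  coprime : IsCoprime p q
  continuous : Continuous f
  eval : ∀ z : ℂ, q.eval z ≠ 0 → f (RSphere.ofC z) = RSphere.ofC (p.eval z / q.eval z)

/-- The degree of the rational map `p/q`. -/
def ratDeg (p q : Polynomial ℂ) : ℕ := max p.natDegree q.natDegree

/-- The lower Lyapunov exponent `χ̲(x) = liminf (1/n) log |(fⁿ)'(x)|`, as an extended real. -/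
def lyapLower (f : RSphere → RSphere) (x : RSphere) : EReal :=
  liminf (fun n : ℕ => ((Real.log (sphDeriv (f^[n]) x) / n : ℝ) : EReal)) atTop

/-- The upper Lyapunov exponent `χ̄(x) = limsup (1/n) log |(fⁿ)'(x)|`, as an extended real. -/
def lyapUpper (f : RSphere → RSphere) (x : RSphere) : EReal :=
  limsup (fun n : ℕ => ((Real.log (sphDeriv (f^[n]) x) / n : ℝ) : EReal)) atTop

/-- The level set `𝓛(a,b)` of points of the Julia set with lower exponent `a` and
upper exponent `b`. -/
def levelSet (f : RSphere → RSphere) (a b : EReal) : Set RSphere :=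
  {x | x ∈ juliaSet f ∧ lyapLower f x = a ∧ lyapUpper f x = b}

/-- The set `𝓛̂(α,β)` of points of the Julia set with `χ̲ ≤ β`, `χ̄ ≥ α` and `χ̄ > 0`. -/
def levelHat (f : RSphere → RSphere) (α β : ℝ) : Set RSphere :=
  {x | x ∈ juliaSet f ∧ lyapLower f x ≤ (β : EReal) ∧ (α : EReal) ≤ lyapUpper f x ∧
    0 < lyapUpper f x}

/-- Birkhoff sum `S_m φ = φ + φ∘g + ⋯ + φ∘g^{m-1}`. -/
def birkhoff (g : RSphere → RSphere) (φ : RSphere → ℝ) (m : ℕ) (x : RSphere) : ℝ :=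
  ∑ k ∈ Finset.range m, φ (g^[k] x)

/-- An `(m,ε)`-separated finite subset of `Λ` for the map `g`. -/
def IsSepSet (g : RSphere → RSphere) (Λ : Set RSphere) (m : ℕ) (ε : ℝ)
    (E : Finset RSphere) : Prop :=
  ↑E ⊆ Λ ∧ ∀ x ∈ E, ∀ y ∈ E, x ≠ y → ∃ k < m, ε ≤ dist (g^[k] x) (g^[k] y)

/-- Topological pressure of the potential `φ` for `g` restricted to `Λ`,
defined à la Bowen via `(m,ε)`-separated sets. -/
def pressureOn (g : RSphere → RSphere) (Λ : Set RSphere) (φ : RSphere → ℝ) : ℝ :=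
  ⨆ ε : {ε : ℝ // 0 < ε}, limsup (fun m : ℕ =>
    Real.log (⨆ E : {E : Finset RSphere // IsSepSet g Λ m ε.1 E},
      ∑ x ∈ E.1, Real.exp (birkhoff g φ m x)) / m) atTop

/-- `g` is uniformly expanding on `Λ`: `|(gᵐ)'(x)| ≥ c λᵐ` for some `c > 0`, `λ > 1`. -/
def ExpandingOn (g : RSphere → RSphere) (Λ : Set RSphere) : Prop :=
  ∃ c > (0 : ℝ), ∃ l : ℝ, 1 < l ∧ ∀ x ∈ Λ, ∀ m : ℕ, 1 ≤ m → c * l ^ m ≤ sphDeriv (g^[m]) x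

/-- `Λ` is a repeller for `g`: a compact invariant isolated set. -/
def IsRepeller (g : RSphere → RSphere) (Λ : Set RSphere) : Prop :=
  IsCompact Λ ∧ g '' Λ = Λ ∧
    ∃ U : Set RSphere, IsOpen U ∧ Λ ⊆ U ∧ ∀ x, (∀ m : ℕ, g^[m] x ∈ U) → x ∈ Λ

/-- Topological transitivity of `g` on `Λ`. -/
def TopTransOn (g : RSphere → RSphere) (Λ : Set RSphere) : Prop :=
  ∀ U V : Set RSphere, IsOpen U → IsOpen V → (U ∩ Λ).Nonempty → (V ∩ Λ).Nonempty →
    ∃ m : ℕ, (g^[m] '' (U ∩ Λ) ∩ V).Nonempty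

/-- The topological pressure of `φ` with respect to `f` on its Julia set, given by
the supremum of the pressures on compact invariant uniformly expanding subsets of `J`. -/
def pressureTop (f : RSphere → RSphere) (φ : RSphere → ℝ) : ℝ :=
  ⨆ L : {L : Set RSphere //
      L.Nonempty ∧ L ⊆ juliaSet f ∧ IsCompact L ∧ f '' L = L ∧ ExpandingOn f L},
    pressureOn f L.1 φ

/-- The pressure function `d ↦ P(φ_d)` where `φ_d = -d log|f'|`. -/
def pressFamily (f : RSphere → RSphere) (d : ℝ) : ℝ :=
  pressureTop f fun x => -d * Real.log (sphDeriv f x)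

/-- `F(α) = α⁻¹ inf_d (Q(d) + dα)` associated with a pressure function `Q` (for `α ≠ 0`). -/
def specF (Q : ℝ → ℝ) (α : ℝ) : EReal :=
  ((α⁻¹ : ℝ) : EReal) * ⨅ d : ℝ, ((Q d + d * α : ℝ) : EReal)

/-- `F(0) = lim_{α → 0⁺} F(α)`. -/
def specF0 (Q : ℝ → ℝ) : EReal := limsup (fun α : ℝ => specF Q α) (𝓝[>] (0 : ℝ))

/-- The full spectrum function `F` associated with a pressure function `Q`. -/
def specFext (Q : ℝ → ℝ) (α : ℝ) : EReal := if α = 0 then specF0 Q else specF Q α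

/-- The Lyapunov spectrum function `F` of `f`. -/
def Ffun (f : RSphere → RSphere) (α : ℝ) : EReal := specFext (pressFamily f) α

/-- `α⁻ = lim_{d → +∞} -Q(d)/d` for a pressure function `Q`. -/
def alphaMinusOf (Q : ℝ → ℝ) : ℝ := limsup (fun d : ℝ => -Q d / d) atTop

/-- `α⁺ = lim_{d → -∞} -Q(d)/d` for a pressure function `Q`. -/
def alphaPlusOf (Q : ℝ → ℝ) : ℝ := limsup (fun d : ℝ => -Q d / d) atBot

/-- `α⁻` for the map `f`. -/
def alphaMinus (f : RSphere → RSphere) : ℝ := alphaMinusOf (pressFamily f)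

/-- `α⁺` for the map `f`. -/
def alphaPlus (f : RSphere → RSphere) : ℝ := alphaPlusOf (pressFamily f)

/-- The Lyapunov exponent `χ(μ) = ∫ log|g'| dμ` of a measure. -/
def lyapMeas (g : RSphere → RSphere) (μ : Measure RSphere) : ℝ :=
  ∫ x, Real.log (sphDeriv g x) ∂μ

/-- `α⁻` as the infimum of Lyapunov exponents of invariant probability measures on `J`. -/
def alphaMinusMeas (f : RSphere → RSphere) : ℝ :=
  sInf {r : ℝ | ∃ μ : Measure RSphere, IsProbabilityMeasure μ ∧ MeasurePreserving f μ μ ∧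
    μ (juliaSet f)ᶜ = 0 ∧ r = lyapMeas f μ}

/-- `α⁺` as the supremum of Lyapunov exponents of invariant probability measures on `J`. -/
def alphaPlusMeas (f : RSphere → RSphere) : ℝ :=
  sSup {r : ℝ | ∃ μ : Measure RSphere, IsProbabilityMeasure μ ∧ MeasurePreserving f μ μ ∧
    μ (juliaSet f)ᶜ = 0 ∧ r = lyapMeas f μ}

/-- The maximal distortion `sup_{x,y ∈ Z} |g'(x)|/|g'(y)|` of `g` on `Z`. -/
def distortionOn (g : RSphere → RSphere) (Z : Set RSphere) : ℝ :=
  sSup {r : ℝ | ∃ x ∈ Z, ∃ y ∈ Z, r = sphDeriv g x / sphDeriv g y}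

/-- Conical points. -/
def IsConical (f : RSphere → RSphere) (x : RSphere) : Prop :=
  ∃ r : ℝ, 0 < r ∧ ∃ K : ℝ, ∃ n : ℕ → ℕ, StrictMono n ∧ ∃ U : ℕ → Set RSphere,
    ∀ i, U i ∈ 𝓝 x ∧ ball (f^[n i] x) r ⊆ f^[n i] '' U i ∧ distortionOn (f^[n i]) (U i) ≤ K

/-- A non-immediately postcritical point: there is a backward orbit through it that is
dense in the Julia set and avoids the critical points. -/
def NonImmPostCrit (f : RSphere → RSphere) (x : RSphere) : Prop :=
  ∃ b : ℕ → RSphere, b 0 = x ∧ (∀ n, f (b (n + 1)) = b n) ∧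
    juliaSet f ⊆ closure (Set.range b) ∧ ∀ n, b n ∉ critSet f

/-- `f` is exceptional: there is a finite nonempty set `Σ_f` with `f⁻¹(Σ_f) \ Crit = Σ_f`. -/
def IsExceptional (f : RSphere → RSphere) : Prop :=
  ∃ S : Set RSphere, S.Finite ∧ S.Nonempty ∧ f ⁻¹' S \ critSet f = S

/-- The largest exceptional set `Σ` of `f`. -/
def maxExceptional (f : RSphere → RSphere) : Set RSphere :=
  ⋃₀ {S : Set RSphere | S.Finite ∧ S.Nonempty ∧ f ⁻¹' S \ critSet f = S}

/-- `0` not being exceptional, or having exceptional set away from the Julia set. -/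
def GoodExc (f : RSphere → RSphere) : Prop :=
  ¬ IsExceptional f ∨ maxExceptional f ∩ juliaSet f = ∅

/-- A parabolic periodic point at a finite point `z`: a periodic point whose multiplier
is a root of unity. -/
def IsParabolicFix (g : RSphere → RSphere) (z : ℂ) : Prop :=
  ∃ m : ℕ, 0 < m ∧ g^[m] (RSphere.ofC z) = RSphere.ofC z ∧
    ∃ lam : ℂ, (∃ k : ℕ, 0 < k ∧ lam ^ k = 1) ∧
      HasDerivAt (fun w => RSphere.toC (g^[m] (RSphere.ofC w))) lam z

/-- A parabolic periodic point of `f` (at a finite point, or at `∞` read in the chart `1/z`). -/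
def IsParabolic (f : RSphere → RSphere) (x : RSphere) : Prop :=
  (∃ z : ℂ, x = RSphere.ofC z ∧ IsParabolicFix f z) ∨
  (x = RSphere.infty ∧ IsParabolicFix (fun y => RSphere.inv (f (RSphere.inv y))) 0)

/-- A recurrent point. -/
def IsRecurrentPt (f : RSphere → RSphere) (x : RSphere) : Prop :=
  ∃ n : ℕ → ℕ, StrictMono n ∧ Tendsto (fun i => f^[n i] x) atTop (𝓝 x)

/-! ### Graph directed systems and expanding Cantor repellers -/

/-- A graph directed system (GDS) satisfying the strong separation condition with
respect to the map `g`. -/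
structure GDS (g : RSphere → RSphere) where
  /-- number of vertices -/
  n : ℕ
  npos : 0 < n
  /-- the open domains -/
  U : Fin n → Set RSphere
  /-- the admissible edges -/
  edge : Fin n → Fin n → Prop
  /-- the inverse branches -/
  br : Fin n → Fin n → RSphere → RSphere
  isOpen : ∀ k, IsOpen (U k)
  isConnected : ∀ k, IsConnected (U k)
  disjClosure : ∀ k l, k ≠ l → closure (U k) ∩ closure (U l) = ∅
  mapsTo : ∀ k l, edge k l → Set.MapsTo (br k l) (closure (U l)) (U k)
  isBranch : ∀ k l, edge k l → ∀ x ∈ closure (U l), g (br k l x) = x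
  bddDistortion : ∃ C : ℝ, ∀ k l, edge k l → distortionOn (br k l) (closure (U l)) ≤ C

/-- The cylinder sets of depth `m` of a GDS. -/
def gdsCyl {g : RSphere → RSphere} (G : GDS g) : ℕ → Set RSphere
  | 0 => ⋃ k, G.U k
  | m + 1 => ⋃ (k : Fin G.n) (l : Fin G.n) (_ : G.edge k l),
      G.br k l '' (gdsCyl G m ∩ G.U l)

/-- The limit set of a GDS. -/
def gdsLimit {g : RSphere → RSphere} (G : GDS g) : Set RSphere := ⋂ m, gdsCyl G m

/-- An expanding Cantor repeller (ECR) for `g`: a uniformly expanding repeller which is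
the limit set of a GDS satisfying the strong separation condition, with `g(Λ) = Λ`. -/
def IsECR (g : RSphere → RSphere) (Λ : Set RSphere) : Prop :=
  ExpandingOn g Λ ∧ IsRepeller g Λ ∧ ∃ G : GDS g, gdsLimit G = Λ

/-- A Cantor set: compact, perfect and totally disconnected. -/
def IsCantorSet (s : Set RSphere) : Prop :=
  IsCompact s ∧ Perfect s ∧ IsTotallyDisconnected s

/-! ### Entropy, equilibrium states and dimensions -/

/-- The entropy of a countable partition (given by the fibers of `p`). -/
def partEntropy {ι : Type} [Countable ι] (μ : Measure RSphere) (p : RSphere → ι) : ℝ :=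
  ∑' i : ι, Real.negMulLog (μ (p ⁻¹' {i})).toReal

/-- Measure-theoretic (Kolmogorov–Sinai) entropy of `T` with respect to `μ`:
supremum over finite measurable partitions of the exponential growth rate of the
entropies of the dynamical refinements. -/
def entropyOf (T : RSphere → RSphere) (μ : Measure RSphere) : ℝ :=
  ⨆ p : {p : RSphere → ℕ // Measurable p ∧ (Set.range p).Finite},
    ⨅ n : {n : ℕ // 0 < n},
      partEntropy μ (fun x => fun k : Fin n.1 => p.1 (T^[(k : ℕ)] x)) / (n.1 : ℝ)

/-- An equilibrium state for the potential `φ` with respect to `g` restricted to `Λ`. -/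
def IsEquilibrium (g : RSphere → RSphere) (Λ : Set RSphere) (φ : RSphere → ℝ)
    (μ : Measure RSphere) : Prop :=
  IsProbabilityMeasure μ ∧ μ Λᶜ = 0 ∧ MeasurePreserving g μ μ ∧
    entropyOf g μ + ∫ x, φ x ∂μ = pressureOn g Λ φ

/-- The Hausdorff dimension of a measure: the infimum of the Hausdorff dimensions of
sets of full measure. -/
def dimHMeasure (μ : Measure RSphere) : ℝ≥0∞ :=
  ⨅ (s : Set RSphere) (_ : μ sᶜ = 0), dimH s

/-- The minimal number of `ε`-balls needed to cover `s`. -/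
def coverNum (s : Set RSphere) (ε : ℝ) : ℕ :=
  sInf {n : ℕ | ∃ t : Finset RSphere, t.card = n ∧ s ⊆ ⋃ x ∈ t, ball x ε}

/-- The upper box-counting dimension. -/
def upperBoxDim (s : Set RSphere) : ℝ :=
  limsup (fun n : ℕ => Real.log (coverNum s (1 / n)) / Real.log n) atTop

/-- The packing dimension, via countable covers and upper box dimensions. -/
def dimP (s : Set RSphere) : ℝ≥0∞ :=
  ⨅ c : {c : ℕ → Set RSphere // s ⊆ ⋃ n, c n},
    ⨆ n : ℕ, ENNReal.ofReal (upperBoxDim (c.1 n))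

/-- The connected component of `y` in `g⁻¹(B)`: the pull-back of `B` along the inverse
branch of `g` sending (the image of) `y` to `y`. -/
def invBranchSet (g : RSphere → RSphere) (B : Set RSphere) (y : RSphere) : Set RSphere :=
  connectedComponentIn (g ⁻¹' B) y

end

/-- A self-map of a metric space that is conformal up to controlled errors. `D` is the norm of
the derivative and `t` is comparable to the distance to the critical points. -/
structure TameMap {X : Type*} [MetricSpace X] (f : X → X) (D t : X → ℝ) (L : ℝ) : Prop where
  one_le : 1 ≤ L
  D_nonneg : ∀ x, 0 ≤ D x
  t_nonneg : ∀ x, 0 ≤ t x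
  t_le_one : ∀ x, t x ≤ 1
  D_le : ∀ x, D x ≤ L * t x
  lip : ∀ u v, dist (f u) (f v) ≤ L * dist u v
  approx : ∀ x u v ρ, dist u x ≤ ρ → dist v x ≤ ρ →
    |dist (f u) (f v) - D x * dist u v| ≤ L * ρ * dist u v
  distort : ∀ x u v τ, 0 ≤ τ → L * τ ≤ 1 → dist u x ≤ τ * t x → dist v x ≤ τ * t x →
    |dist (f u) (f v) - D x * dist u v| ≤ L * τ * D x * dist u v
  D_distort : ∀ x u τ, 0 ≤ τ → L * τ ≤ 1 → dist u x ≤ τ * t x → |D u - D x| ≤ L * τ * D x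
  onto : ∀ x y, 0 < D x → L * dist y (f x) ≤ D x * t x →
    ∃ u, f u = y ∧ D x * dist u x ≤ 2 * dist y (f x)
  count : ∀ (R ρ : ℝ) (E : Finset X), 0 < ρ → ρ ≤ R → (∀ x ∈ E, t x ≤ R) →
    (∀ x ∈ E, ∀ y ∈ E, x ≠ y → ρ < dist x y) → (E.card : ℝ) ≤ L * (R / ρ) ^ 3
  perfect : ∀ (o : X) (s : ℝ), 0 < s → s ≤ 1 → ∃ z, dist z o = s

/-- The product of `D` along the first `n` points of an orbit. -/
noncomputable def orbitProd {X : Type*} (f : X → X) (D : X → ℝ) (n : ℕ) (x : X) : ℝ :=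
  ∏ l ∈ Finset.range n, D (f^[l] x)

section orbitProd
variable {X : Type*} (f : X → X) (D : X → ℝ)

@[simp] lemma orbitProd_zero (x : X) : orbitProd f D 0 x = 1 := by simp [orbitProd]

lemma orbitProd_succ (n : ℕ) (x : X) :
    orbitProd f D (n + 1) x = orbitProd f D n x * D (f^[n] x) := by
  simp [orbitProd, Finset.prod_range_succ]

lemma orbitProd_add (m n : ℕ) (x : X) :
    orbitProd f D (m + n) x = orbitProd f D m x * orbitProd f D n (f^[m] x) := by
  simp only [orbitProd, Finset.prod_range_add, ← Function.iterate_add_apply, add_comm]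

lemma orbitProd_succ' (n : ℕ) (x : X) :
    orbitProd f D (n + 1) x = D x * orbitProd f D n (f x) := by
  rw [add_comm, orbitProd_add]; simp [orbitProd]

end orbitProd

/-- If the ratios `a (l+1) / a l` are close to `d l` with summable errors then `a n` is comparable
to `(∏ d) * a 0`. -/
lemma prod_comparison (a d e : ℕ → ℝ) (n : ℕ) (ha : 0 ≤ a 0) (hd : ∀ l < n, 0 ≤ d l)
    (he : ∀ l < n, 0 ≤ e l) (hs : ∑ l ∈ Finset.range n, e l ≤ 1 / 2)
    (h : ∀ l < n, |a (l + 1) - d l * a l| ≤ e l * d l * a l) :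
    (∏ l ∈ Finset.range n, d l) * a 0 / 2 ≤ a n ∧ a n ≤ 2 * ((∏ l ∈ Finset.range n, d l) * a 0) := by
  have key : ∀ m ≤ n, (1 - ∑ l ∈ Finset.range m, e l) * ((∏ l ∈ Finset.range m, d l) * a 0) ≤ a m ∧
      a m ≤ (1 + 2 * ∑ l ∈ Finset.range m, e l) * ((∏ l ∈ Finset.range m, d l) * a 0) := by
    intro m
    induction m with
    | zero => intro _; simp
    | succ m ih =>
      intro hm
      obtain ⟨h1, h2⟩ := ih (by omega)
      have hS : ∑ l ∈ Finset.range (m + 1), e l ≤ 1 / 2 := by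
        refine le_trans (Finset.sum_le_sum_of_subset_of_nonneg ?_ ?_) hs
        · intro x; simp; omega
        · intro i hi _; exact he i (by simpa using hi)
      have hS0 : 0 ≤ ∑ l ∈ Finset.range m, e l :=
        Finset.sum_nonneg fun i hi => he i (by simp at hi; omega)
      have hP0 : 0 ≤ (∏ l ∈ Finset.range m, d l) * a 0 :=
        mul_nonneg (Finset.prod_nonneg fun i hi => hd i (by simp at hi; omega)) ha
      have hdm := hd m (by omega)
      have hem := he m (by omega)
      have h3 := abs_le.mp (h m (by omega))
      rw [Finset.sum_range_succ] at hS ⊢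
      rw [Finset.prod_range_succ]
      set S := ∑ l ∈ Finset.range m, e l
      set P := (∏ l ∈ Finset.range m, d l) * a 0 with hP
      have hPe : (∏ l ∈ Finset.range m, d l) * d m * a 0 = d m * P := by rw [hP]; ring
      rw [hPe]
      have hdP : 0 ≤ d m * P := mul_nonneg hdm hP0
      constructor
      · have h4 : (1 - e m) * (d m * ((1 - S) * P)) ≤ (1 - e m) * (d m * a m) :=
          mul_le_mul_of_nonneg_left (mul_le_mul_of_nonneg_left h1 hdm) (by linarith)
        nlinarith [mul_nonneg (mul_nonneg hS0 hem) hdP]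
      · have h4 : (1 + e m) * (d m * a m) ≤ (1 + e m) * (d m * ((1 + 2 * S) * P)) :=
          mul_le_mul_of_nonneg_left (mul_le_mul_of_nonneg_left h2 hdm) (by linarith)
        have h5 : 2 * S * e m ≤ e m := by nlinarith
        nlinarith [mul_le_mul_of_nonneg_right h5 hdP]
  obtain ⟨h1, h2⟩ := key n le_rfl
  have hP0 : 0 ≤ (∏ l ∈ Finset.range n, d l) * a 0 :=
    mul_nonneg (Finset.prod_nonneg fun i hi => hd i (by simpa using hi)) ha
  constructor <;> nlinarith

lemma sum_exp_neg_le {κ : ℝ} (hκ : 0 < κ) (n : ℕ) :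
    ∑ l ∈ Finset.range n, Real.exp (-κ * ((n : ℝ) - l)) ≤ 1 / κ := by
  induction n with
  | zero => simp; positivity
  | succ n ih =>
    have h1 : ∑ l ∈ Finset.range n, Real.exp (-κ * (((n + 1 : ℕ) : ℝ) - l)) =
        Real.exp (-κ) * ∑ l ∈ Finset.range n, Real.exp (-κ * ((n : ℝ) - l)) := by
      rw [Finset.mul_sum]
      refine Finset.sum_congr rfl fun l _ => ?_
      rw [← Real.exp_add]; congr 1; push_cast; ring
    rw [Finset.sum_range_succ, h1]
    have h2 : Real.exp (-κ * (((n + 1 : ℕ) : ℝ) - n)) = Real.exp (-κ) := by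
      congr 1; push_cast; ring
    rw [h2]
    have h3 : Real.exp (-κ) * (1 + κ) ≤ 1 := by
      rw [Real.exp_neg, inv_mul_le_iff₀ (Real.exp_pos _)]
      have := Real.add_one_le_exp κ
      linarith
    have h4 : Real.exp (-κ) * ∑ l ∈ Finset.range n, Real.exp (-κ * ((n : ℝ) - l)) ≤
        Real.exp (-κ) * (1 / κ) := mul_le_mul_of_nonneg_left ih (Real.exp_pos _).le
    calc _ ≤ Real.exp (-κ) * (1 / κ) + Real.exp (-κ) := by linarith
      _ = Real.exp (-κ) * (1 + κ) / κ := by field_simp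
      _ ≤ 1 / κ := by gcongr

namespace TameMap

variable {X : Type*} [MetricSpace X] {f : X → X} {D t : X → ℝ} {L : ℝ}

lemma L_pos (h : TameMap f D t L) : 0 < L := lt_of_lt_of_le one_pos h.one_le

lemma continuous (h : TameMap f D t L) : Continuous f := by
  have : LipschitzWith L.toNNReal f := LipschitzWith.of_dist_le_mul fun x y => by
    rw [Real.coe_toNNReal _ h.L_pos.le]; exact h.lip x y
  exact this.continuous

lemma D_le_L (h : TameMap f D t L) (x : X) : D x ≤ L :=
  (h.D_le x).trans (mul_le_of_le_one_right h.L_pos.le (h.t_le_one x))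

lemma orbitProd_nonneg (h : TameMap f D t L) (n : ℕ) (x : X) : 0 ≤ orbitProd f D n x :=
  Finset.prod_nonneg fun _ _ => h.D_nonneg _

/-- Bounded distortion along a shadowed orbit. -/
lemma shadow_dist (h : TameMap f D t L) (n : ℕ) (x u v : X) (τ : ℕ → ℝ) (hτ : ∀ l < n, 0 ≤ τ l)
    (hs : ∑ l ∈ Finset.range n, L * τ l ≤ 1 / 2)
    (hu : ∀ l < n, dist (f^[l] u) (f^[l] x) ≤ τ l * t (f^[l] x))
    (hv : ∀ l < n, dist (f^[l] v) (f^[l] x) ≤ τ l * t (f^[l] x)) :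
    orbitProd f D n x * dist u v / 2 ≤ dist (f^[n] u) (f^[n] v) ∧
      dist (f^[n] u) (f^[n] v) ≤ 2 * (orbitProd f D n x * dist u v) := by
  have hL := h.L_pos
  have hτ1 : ∀ l < n, L * τ l ≤ 1 := fun l hl => by
    have := Finset.single_le_sum (f := fun l => L * τ l) (s := Finset.range n)
      (fun i hi => mul_nonneg hL.le (hτ i (by simpa using hi))) (Finset.mem_range.mpr hl)
    linarith
  exact prod_comparison (fun l => dist (f^[l] u) (f^[l] v)) (fun l => D (f^[l] x))
    (fun l => L * τ l) n dist_nonneg (fun l _ => h.D_nonneg _)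
    (fun l hl => mul_nonneg hL.le (hτ l hl)) hs fun l hl => by
      simp only [Function.iterate_succ_apply']
      exact h.distort _ _ _ _ (hτ l hl) (hτ1 l hl) (hu l hl) (hv l hl)

lemma shadow_prod (h : TameMap f D t L) (n : ℕ) (x u : X) (τ : ℕ → ℝ) (hτ : ∀ l < n, 0 ≤ τ l)
    (hs : ∑ l ∈ Finset.range n, L * τ l ≤ 1 / 2)
    (hu : ∀ l < n, dist (f^[l] u) (f^[l] x) ≤ τ l * t (f^[l] x)) :
    orbitProd f D n x / 2 ≤ orbitProd f D n u ∧
      orbitProd f D n u ≤ 2 * orbitProd f D n x := by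
  have hL := h.L_pos
  have hτ1 : ∀ l < n, L * τ l ≤ 1 := fun l hl => by
    have := Finset.single_le_sum (f := fun l => L * τ l) (s := Finset.range n)
      (fun i hi => mul_nonneg hL.le (hτ i (by simpa using hi))) (Finset.mem_range.mpr hl)
    linarith
  have := prod_comparison (fun l => orbitProd f D l u) (fun l => D (f^[l] x))
    (fun l => L * τ l) n (by simp) (fun l _ => h.D_nonneg _)
    (fun l hl => mul_nonneg hL.le (hτ l hl)) hs fun l hl => by
      simp only [orbitProd_succ]
      have h1 := h.D_distort _ _ _ (hτ l hl) (hτ1 l hl) (hu l hl)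
      have h2 := h.orbitProd_nonneg l u
      rw [mul_comm (D (f^[l] x)), ← mul_sub, abs_mul, abs_of_nonneg h2, mul_comm]
      exact mul_le_mul_of_nonneg_right h1 h2
  simpa [orbitProd] using this

end TameMap

/-- The time `n` is good for `x` when the inverse branch of `f^[n]` on the ball of radius `r`
about `f^[n] x` mapping `f^[n] x` to `x` exists for a robust reason. -/
def GoodTime {X : Type*} (f : X → X) (D t : X → ℝ) (κ K r : ℝ) (n : ℕ) (x : X) : Prop :=
  ∀ l < n, K * r * orbitProd f D l x * Real.exp (-κ * l) ≤
    orbitProd f D n x * Real.exp (-κ * n) * t (f^[l] x)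

/-- The points following the orbit of `x` as the inverse branch does. -/
def OrbitTube {X : Type*} [MetricSpace X] (f : X → X) (D : X → ℝ) (r : ℝ) (n : ℕ) (x : X) : Set X :=
  {u | ∀ l < n, orbitProd f D n x * dist (f^[l] u) (f^[l] x) ≤ 2 * r * orbitProd f D l x}

lemma GoodTime.shift {X : Type*} {f : X → X} {D t : X → ℝ} {κ K r : ℝ} {m n : ℕ} {x : X}
    (hg : GoodTime f D t κ K r (m + n) x) (hD : 0 < orbitProd f D m x) :
    GoodTime f D t κ K r n (f^[m] x) := by
  intro l hl
  have := hg (m + l) (by omega)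
  rw [orbitProd_add, orbitProd_add, add_comm m l, Function.iterate_add_apply] at this
  have e1 : Real.exp (-κ * ((l + m : ℕ) : ℝ)) = Real.exp (-κ * m) * Real.exp (-κ * l) := by
    rw [← Real.exp_add]; congr 1; push_cast; ring
  have e2 : Real.exp (-κ * ((m + n : ℕ) : ℝ)) = Real.exp (-κ * m) * Real.exp (-κ * n) := by
    rw [← Real.exp_add]; congr 1; push_cast; ring
  rw [e1, e2] at this
  have h0 : 0 < orbitProd f D m x * Real.exp (-κ * m) := mul_pos hD (Real.exp_pos _)
  refine le_of_mul_le_mul_left ?_ h0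
  linarith

lemma TameMap.tau_of_goodTime {X : Type*} {f : X → X} {D t : X → ℝ} {κ K r c d : ℝ} {n l : ℕ} {x : X} (hK : 0 < K) (hc : 0 ≤ c)
    (hE : 0 < orbitProd f D n x) (hg : GoodTime f D t κ K r n x) (hl : l < n)
    (hd : orbitProd f D n x * d ≤ c * r * orbitProd f D l x) :
    d ≤ c / K * Real.exp (-κ * ((n : ℝ) - l)) * t (f^[l] x) := by
  have h1 := hg l hl
  have e : Real.exp (-κ * n) = Real.exp (-κ * ((n : ℝ) - l)) * Real.exp (-κ * l) := by
    rw [← Real.exp_add]; congr 1; ring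
  rw [e] at h1
  have h2 : K * r * orbitProd f D l x ≤
      orbitProd f D n x * Real.exp (-κ * ((n : ℝ) - l)) * t (f^[l] x) := by
    refine le_of_mul_le_mul_right ?_ (Real.exp_pos (-κ * l))
    linarith
  refine le_of_mul_le_mul_left ?_ (mul_pos hK hE)
  calc K * orbitProd f D n x * d = K * (orbitProd f D n x * d) := by ring
    _ ≤ K * (c * r * orbitProd f D l x) := by gcongr
    _ = c * (K * r * orbitProd f D l x) := by ring
    _ ≤ c * (orbitProd f D n x * Real.exp (-κ * ((n : ℝ) - l)) * t (f^[l] x)) := by gcongr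
    _ = _ := by field_simp

namespace TameMap

variable {X : Type*} [MetricSpace X] {f : X → X} {D t : X → ℝ} {L : ℝ}

lemma sum_tau_le {κ K : ℝ} (hκ : 0 < κ) (hK : 0 < K) (hL : 0 < L) (hKL : 8 * L ≤ κ * K) (n : ℕ) :
    ∑ l ∈ Finset.range n, L * (4 / K * Real.exp (-κ * ((n : ℝ) - l))) ≤ 1 / 2 := by
  have h1 := sum_exp_neg_le hκ n
  have : ∑ l ∈ Finset.range n, L * (4 / K * Real.exp (-κ * ((n : ℝ) - l))) =
      L * (4 / K) * ∑ l ∈ Finset.range n, Real.exp (-κ * ((n : ℝ) - l)) := by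
    rw [Finset.mul_sum]; exact Finset.sum_congr rfl fun _ _ => by ring
  rw [this]
  calc _ ≤ L * (4 / K) * (1 / κ) := by gcongr
    _ = (4 * L) / (κ * K) := by field_simp
    _ ≤ 1 / 2 := by rw [div_le_div_iff₀ (by positivity) (by norm_num)]; linarith

lemma tube_dist (h : TameMap f D t L) {κ K r : ℝ} {n : ℕ} {x u v : X} (hκ : 0 < κ) (hK : 0 < K)
    (hKL : 8 * L ≤ κ * K)
    (hE : 0 < orbitProd f D n x) (hg : GoodTime f D t κ K r n x)
    (hu : u ∈ OrbitTube f D r n x) (hv : v ∈ OrbitTube f D r n x) :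
    orbitProd f D n x * dist u v / 2 ≤ dist (f^[n] u) (f^[n] v) ∧
      dist (f^[n] u) (f^[n] v) ≤ 2 * (orbitProd f D n x * dist u v) := by
  have ht := h.t_nonneg
  refine h.shadow_dist n x u v (fun l => 4 / K * Real.exp (-κ * ((n : ℝ) - l)))
    (fun l _ => by positivity) (sum_tau_le hκ hK h.L_pos hKL n) (fun l hl => ?_) (fun l hl => ?_)
  · refine (tau_of_goodTime hK zero_le_two hE hg hl (hu l hl)).trans ?_
    have := ht (f^[l] x)
    gcongr; norm_num
  · refine (tau_of_goodTime hK zero_le_two hE hg hl (hv l hl)).trans ?_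
    have := ht (f^[l] x)
    gcongr; norm_num

lemma tube_prod (h : TameMap f D t L) {κ K r : ℝ} {n : ℕ} {x u : X} (hκ : 0 < κ) (hK : 0 < K)
    (hKL : 8 * L ≤ κ * K)
    (hE : 0 < orbitProd f D n x) (hg : GoodTime f D t κ K r n x)
    (hu : u ∈ OrbitTube f D r n x) :
    orbitProd f D n x / 2 ≤ orbitProd f D n u ∧ orbitProd f D n u ≤ 2 * orbitProd f D n x := by
  have ht := h.t_nonneg
  refine h.shadow_prod n x u (fun l => 4 / K * Real.exp (-κ * ((n : ℝ) - l)))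
    (fun l _ => by positivity) (sum_tau_le hκ hK h.L_pos hKL n) (fun l hl => ?_)
  refine (tau_of_goodTime hK zero_le_two hE hg hl (hu l hl)).trans ?_
  have := ht (f^[l] x)
  gcongr; norm_num

/-- Existence of the inverse branch at a good time. -/
lemma exists_preimage (h : TameMap f D t L) {κ K r : ℝ} (hκ : 0 < κ) (hK : 0 < K) (hr : 0 < r)
    (hKL : 8 * L ≤ κ * K) (hKL' : 2 * L ≤ K) (n : ℕ) :
    ∀ x : X, 0 < orbitProd f D n x → GoodTime f D t κ K r n x → ∀ z, dist z (f^[n] x) ≤ r →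
      ∃ u ∈ OrbitTube f D r n x, f^[n] u = z := by
  induction n with
  | zero =>
    intro x _ _ z hz
    exact ⟨z, fun l hl => absurd hl (by omega), rfl⟩
  | succ n ih =>
    intro x hE hg z hz
    have hL := h.L_pos
    have hE' := hE
    rw [orbitProd_succ'] at hE'
    have hD : 0 < D x := by
      rcases (h.D_nonneg x).lt_or_eq with h1 | h1
      · exact h1
      · rw [← h1] at hE'; simp at hE'
    have hEn : 0 < orbitProd f D n (f x) := pos_of_mul_pos_right hE' hD.le
    have hg1 : GoodTime f D t κ K r n (f x) := by
      rw [add_comm] at hg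
      exact GoodTime.shift hg (by simpa [orbitProd] using hD)
    obtain ⟨w, hw, hwz⟩ := ih (f x) hEn hg1 z (by simpa using hz)
    have hwd : orbitProd f D n (f x) * dist w (f x) ≤ 2 * r := by
      rcases Nat.eq_zero_or_pos n with rfl | hn
      · simp at hwz hz ⊢; subst hwz; linarith
      · simpa using hw 0 hn
    have hg0 := hg 0 (by omega)
    simp only [orbitProd_zero, Nat.cast_zero, mul_zero, Real.exp_zero, mul_one,
      Function.iterate_zero, id, orbitProd_succ'] at hg0
    have hexp : Real.exp (-κ * ((n + 1 : ℕ) : ℝ)) ≤ 1 := by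
      rw [Real.exp_le_one_iff]; push_cast; nlinarith [(Nat.cast_nonneg n : (0 : ℝ) ≤ n)]
    have hg0' : K * r ≤ D x * orbitProd f D n (f x) * t x := by
      refine hg0.trans ?_
      have := h.t_nonneg x
      calc _ ≤ D x * orbitProd f D n (f x) * 1 * t x := by gcongr
        _ = _ := by ring
    obtain ⟨u, hu, hux⟩ := h.onto x w hD (by
      refine le_of_mul_le_mul_left ?_ hEn
      nlinarith)
    have hu0 : orbitProd f D (n + 1) x * dist u x ≤ 4 * r := by
      rw [orbitProd_succ']
      nlinarith
    have hτ : ∀ l < n + 1, dist (f^[l] u) (f^[l] x) ≤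
        4 / K * Real.exp (-κ * (((n + 1 : ℕ) : ℝ) - l)) * t (f^[l] x) := by
      intro l hl
      refine tau_of_goodTime hK (by norm_num) hE hg hl ?_
      rcases l with _ | l
      · simpa using hu0
      · have := hw l (by omega)
        rw [orbitProd_succ', orbitProd_succ', Function.iterate_succ_apply,
          Function.iterate_succ_apply, hu]
        have h3 := h.orbitProd_nonneg l (f x)
        have : D x * (orbitProd f D n (f x) * dist (f^[l] w) (f^[l] (f x))) ≤
          D x * (2 * r * orbitProd f D l (f x)) := by gcongr
        nlinarith [mul_nonneg (mul_nonneg hr.le hD.le) h3]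
    refine ⟨u, ?_, by rw [Function.iterate_succ_apply, hu, hwz]⟩
    intro l hl
    rcases l with _ | l
    · have := (h.shadow_dist (n + 1) x u x
        (fun l => 4 / K * Real.exp (-κ * (((n + 1 : ℕ) : ℝ) - l))) (fun l _ => by positivity)
        (sum_tau_le hκ hK h.L_pos hKL (n + 1)) hτ (fun l hl => by
          simp only [dist_self]; exact mul_nonneg (by positivity) (h.t_nonneg _))).1
      rw [Function.iterate_succ_apply, hu, hwz] at this
      simp only [Function.iterate_zero, id, orbitProd_zero]
      linarith
    · have := hw l (by omega)
      rw [orbitProd_succ', orbitProd_succ', Function.iterate_succ_apply,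
        Function.iterate_succ_apply, hu]
      have : D x * (orbitProd f D n (f x) * dist (f^[l] w) (f^[l] (f x))) ≤
        D x * (2 * r * orbitProd f D l (f x)) := by gcongr
      linarith

end TameMap

section Horseshoe

variable {X ι : Type*} {T : X → X} {B : Set X} {W : ι → Set X}

/-- Pulling back a point of `B` along a finite word of branches. -/
lemma exists_finite_itinerary (hsub : ∀ i, W i ⊆ B) (honto : ∀ i, ∀ z ∈ B, ∃ u ∈ W i, T u = z)
    (m : ℕ) : ∀ (ω : ℕ → ι) (z : X), z ∈ B →
      ∃ u ∈ B, (∀ k < m, T^[k] u ∈ W (ω k)) ∧ T^[m] u = z := by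
  induction m with
  | zero => exact fun ω z hz => ⟨z, hz, fun k hk => absurd hk (by omega), rfl⟩
  | succ m ih =>
    intro ω z hz
    obtain ⟨u, huB, hu, huz⟩ := ih (fun k => ω (k + 1)) z hz
    obtain ⟨v, hv, hvu⟩ := honto (ω 0) u huB
    refine ⟨v, hsub _ hv, fun k hk => ?_, by rw [Function.iterate_succ_apply, hvu, huz]⟩
    rcases k with _ | k
    · exact hv
    · rw [Function.iterate_succ_apply, hvu]; exact hu k (by omega)

lemma exists_itinerary [TopologicalSpace X] [CompactSpace X] (hT : Continuous T)
    (hW : ∀ i, IsClosed (W i)) (hB : B.Nonempty)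
    (hsub : ∀ i, W i ⊆ B) (honto : ∀ i, ∀ z ∈ B, ∃ u ∈ W i, T u = z) (ω : ℕ → ι) :
    ∃ u, ∀ k, T^[k] u ∈ W (ω k) := by
  have hcl : ∀ k, IsClosed {u | T^[k] u ∈ W (ω k)} := fun k => (hW _).preimage (hT.iterate k)
  have := IsCompact.nonempty_iInter_of_sequence_nonempty_isCompact_isClosed
    (fun m => ⋂ k ∈ Finset.range m, {u | T^[k] u ∈ W (ω k)})
    (fun m => biInter_subset_biInter_left (by intro k; simp; omega))
    (fun m => by
      obtain ⟨z, hz⟩ := hB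
      obtain ⟨u, -, hu, -⟩ := exists_finite_itinerary hsub honto m ω z hz
      exact ⟨u, by simpa using hu⟩)
    (by simpa using isCompact_univ) (fun m => isClosed_biInter fun k _ => hcl k)
  obtain ⟨u, hu⟩ := this
  refine ⟨u, fun k => ?_⟩
  have := mem_iInter.mp hu (k + 1)
  simp only [mem_iInter, Finset.mem_range] at this
  exact this k (by omega)

/-- The maximal invariant set of the union of the branch domains. -/
def branchLimit (T : X → X) (W : ι → Set X) : Set X := {u | ∀ k, T^[k] u ∈ ⋃ i, W i}

lemma image_branchLimit (hsub : ∀ i, W i ⊆ B) (honto : ∀ i, ∀ z ∈ B, ∃ u ∈ W i, T u = z) :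
    T '' branchLimit T W = branchLimit T W := by
  apply Subset.antisymm
  · rintro _ ⟨u, hu, rfl⟩ k
    rw [← Function.iterate_succ_apply]; exact hu _
  · intro u hu
    obtain ⟨i, hi⟩ := mem_iUnion.mp (hu 0)
    obtain ⟨v, hv, rfl⟩ := honto i u (hsub i hi)
    refine ⟨v, fun k => ?_, rfl⟩
    rcases k with _ | k
    · exact mem_iUnion.mpr ⟨i, hv⟩
    · exact hu k

/-- The union of the first iterates of a set invariant under `f^[n]` is invariant under `f`. -/
lemma image_biUnion_iterate {f : X → X} {n : ℕ} (hn : 0 < n) {S : Set X} (hS : f^[n] '' S = S) :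
    f '' (⋃ k ∈ Finset.range n, f^[k] '' S) = ⋃ k ∈ Finset.range n, f^[k] '' S := by
  apply Subset.antisymm
  · rintro _ ⟨z, hz, rfl⟩
    simp only [mem_iUnion, Finset.mem_range] at hz ⊢
    obtain ⟨k, hk, u, hu, rfl⟩ := hz
    rw [← Function.iterate_succ_apply' f]
    rcases (Nat.succ_le_of_lt hk).lt_or_eq with h | h
    · exact ⟨k + 1, h, u, hu, rfl⟩
    · refine ⟨0, hn, f^[k + 1] u, ?_, rfl⟩
      rw [← hS]; exact ⟨u, hu, by rw [← h]⟩
  · intro z hz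
    simp only [mem_iUnion, Finset.mem_range] at hz
    obtain ⟨k, hk, u, hu, rfl⟩ := hz
    rcases k with _ | k
    · rw [← hS] at hu
      obtain ⟨v, hv, rfl⟩ := hu
      refine ⟨f^[n - 1] v, ?_, ?_⟩
      · simp only [mem_iUnion, Finset.mem_range]; exact ⟨n - 1, by omega, v, hv, rfl⟩
      · rw [← Function.iterate_succ_apply' f]
        simp [Nat.sub_add_cancel hn]
    · refine ⟨f^[k] u, ?_, (Function.iterate_succ_apply' f k u).symm⟩
      simp only [mem_iUnion, Finset.mem_range]; exact ⟨k, by omega, u, hu, rfl⟩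

end Horseshoe

namespace TameMap

variable {X : Type*} [MetricSpace X] {f : X → X} {D t : X → ℝ} {L : ℝ}

lemma orbitProd_le_pow (h : TameMap f D t L) (n : ℕ) (x : X) : orbitProd f D n x ≤ L ^ n := by
  calc _ ≤ ∏ _l ∈ Finset.range n, L :=
        Finset.prod_le_prod (fun _ _ => h.D_nonneg _) fun _ _ => h.D_le_L _
    _ = L ^ n := by simp

lemma dist_iterate_le (h : TameMap f D t L) (n : ℕ) (u v : X) :
    dist (f^[n] u) (f^[n] v) ≤ L ^ n * dist u v := by
  induction n with
  | zero => simp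
  | succ n ih =>
    rw [Function.iterate_succ_apply', Function.iterate_succ_apply', pow_succ']
    calc _ ≤ L * dist (f^[n] u) (f^[n] v) := h.lip _ _
      _ ≤ L * (L ^ n * dist u v) := by have := h.L_pos; gcongr
      _ = _ := by ring

/-- If `E_n` grows along the return times `n * m` then orbit products grow exponentially. -/
lemma orbitProd_expanding (h : TameMap f D t L) {n : ℕ} (hn : 0 < n) {S : Set X}
    (hS : ∀ u ∈ S, ∀ m, (4 : ℝ) ^ m ≤ orbitProd f D (n * m) u) :
    ∃ c > (0 : ℝ), ∃ l : ℝ, 1 < l ∧ ∀ z ∈ ⋃ k ∈ Finset.range n, f^[k] '' S, ∀ m : ℕ,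
      c * l ^ m ≤ orbitProd f D m z := by
  have hL := h.L_pos
  refine ⟨(L ^ n * L ^ n)⁻¹, by positivity, (4 : ℝ) ^ (1 / n : ℝ),
    Real.one_lt_rpow (by norm_num) (by positivity), fun z hz m => ?_⟩
  simp only [mem_iUnion, Finset.mem_range] at hz
  obtain ⟨j, hj, u, hu, rfl⟩ := hz
  set q := (j + m) / n with hq
  have hlt : j + m < n * (q + 1) := by
    rw [hq]; exact Nat.lt_mul_div_succ _ hn
  obtain ⟨s, hs⟩ := Nat.exists_eq_add_of_lt hlt
  have hsn : s + 1 ≤ n := by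
    have : n * q ≤ j + m := Nat.mul_div_le _ _
    rw [mul_add] at hs; omega
  have h1 := hS u hu (q + 1)
  rw [hs, add_assoc, orbitProd_add, orbitProd_add] at h1
  have h2 : orbitProd f D j u ≤ L ^ n :=
    (h.orbitProd_le_pow j u).trans (pow_le_pow_right₀ h.one_le hj.le)
  have h3 : orbitProd f D (s + 1) (f^[j + m] u) ≤ L ^ n :=
    (h.orbitProd_le_pow _ _).trans (pow_le_pow_right₀ h.one_le hsn)
  have h4 := h.orbitProd_nonneg m (f^[j] u)
  have h5 : ((4 : ℝ) ^ (1 / n : ℝ)) ^ m ≤ 4 ^ (q + 1) := by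
    rw [← Real.rpow_natCast, ← Real.rpow_mul (by norm_num), ← Real.rpow_natCast 4 (q + 1)]
    refine Real.rpow_le_rpow_of_exponent_le (by norm_num) ?_
    rw [one_div, inv_mul_le_iff₀ (by positivity)]
    norm_cast; omega
  rw [inv_mul_le_iff₀ (by positivity)]
  refine h5.trans (h1.trans ?_)
  calc _ ≤ L ^ n * orbitProd f D m (f^[j] u) * L ^ n := by
        have := h.orbitProd_nonneg (s + 1) (f^[j + m] u)
        gcongr
    _ = _ := by ring

lemma isClosed_orbitTube (h : TameMap f D t L) (r : ℝ) (n : ℕ) (x : X) :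
    IsClosed (OrbitTube f D r n x) := by
  have : OrbitTube f D r n x = ⋂ l ∈ Finset.range n,
      {u | orbitProd f D n x * dist (f^[l] u) (f^[l] x) ≤ 2 * r * orbitProd f D l x} := by
    ext u; simp [OrbitTube]
  rw [this]
  refine isClosed_biInter fun l _ => isClosed_le ?_ continuous_const
  exact continuous_const.mul ((h.continuous.iterate l).dist continuous_const)

/-- Good times returning to a small ball produce an expanding invariant set. -/
theorem horseshoe (h : TameMap f D t L) [CompactSpace X] {κ K r : ℝ} (hκ : 0 < κ) (hK : 0 < K)
    (hr : 0 < r) (hr1 : r ≤ 1) (hKL : 8 * L ≤ κ * K) (hKL' : 2 * L ≤ K) {n : ℕ} (hn : 0 < n)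
    {o : X} {A B : ℝ} (hA : 8 ≤ A) (Y : Finset X) (hYne : Y.Nonempty)
    (hYo : ∀ y ∈ Y, dist y o < r / 8) (hYn : ∀ y ∈ Y, dist (f^[n] y) o < r / 8)
    (hYg : ∀ y ∈ Y, GoodTime f D t κ K r n y)
    (hYA : ∀ y ∈ Y, A ≤ orbitProd f D n y) (hYB : ∀ y ∈ Y, orbitProd f D n y ≤ B)
    (hYsep : ∀ y ∈ Y, ∀ y' ∈ Y, y ≠ y' → 12 * r / A < dist y y') :
    ∃ Λ : Set X, Λ.Nonempty ∧ IsCompact Λ ∧ f '' Λ = Λ ∧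
      (∃ c > (0 : ℝ), ∃ l : ℝ, 1 < l ∧ ∀ z ∈ Λ, ∀ m : ℕ, c * l ^ m ≤ orbitProd f D m z) ∧
      (∃ η > (0 : ℝ), ∀ z ∈ Λ, ∀ δ > (0 : ℝ), ∃ N v, dist v z < δ ∧
        η ≤ dist (f^[N] v) (f^[N] z)) ∧
      ∃ ε > (0 : ℝ), ∀ m : ℕ, ∃ E : Finset X, ↑E ⊆ Λ ∧ E.card = Y.card ^ m ∧
        (∀ x ∈ E, ∀ y ∈ E, x ≠ y → ∃ k < n * m, ε ≤ dist (f^[k] x) (f^[k] y)) ∧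
        ∀ x ∈ E, (A / 2) ^ m ≤ orbitProd f D (n * m) x ∧
          orbitProd f D (n * m) x ≤ (2 * B) ^ m := by
  classical
  have hApos : 0 < A := by linarith
  have hL := h.L_pos
  set W : Y → Set X := fun y => OrbitTube f D r n y ∩ f^[n] ⁻¹' (closedBall o (r / 2)) with hW
  have hEpos : ∀ y : Y, 0 < orbitProd f D n (y : X) := fun y => hApos.trans_le (hYA y y.2)
  have hWcl : ∀ y, IsClosed (W y) := fun y =>
    (h.isClosed_orbitTube r n y).inter (isClosed_closedBall.preimage (h.continuous.iterate n))
  have hWd : ∀ y : Y, ∀ u ∈ W y, dist u y ≤ 2 * r / A := fun y u hu => by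
    have := hu.1 0 hn
    simp only [Function.iterate_zero, id, orbitProd_zero, mul_one] at this
    rw [le_div_iff₀ hApos]
    nlinarith [hYA y y.2, dist_nonneg (x := u) (y := (y : X))]
  have hrA : 2 * r / A ≤ r / 4 := by
    rw [div_le_div_iff₀ hApos (by norm_num)]; nlinarith
  have hWo : ∀ y : Y, ∀ u ∈ W y, dist u o < 3 * r / 8 := fun y u hu => by
    have h1 := hWd y u hu
    have h2 := hYo y y.2
    have := dist_triangle u y o
    linarith
  have hsub : ∀ y, W y ⊆ closedBall o (r / 2) := fun y u hu => by
    have := hWo y u hu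
    rw [mem_closedBall]; linarith
  have honto : ∀ y, ∀ z ∈ closedBall o (r / 2), ∃ u ∈ W y, f^[n] u = z := fun y z hz => by
    obtain ⟨u, hu, huz⟩ := h.exists_preimage hκ hK hr hKL hKL' n y (hEpos y) (hYg y y.2) z (by
      have h2 := hYn y y.2
      have := dist_triangle_right z (f^[n] (y : X)) o
      rw [mem_closedBall] at hz
      linarith)
    exact ⟨u, ⟨hu, by rw [mem_preimage, huz]; exact hz⟩, huz⟩
  have hTc : Continuous f^[n] := h.continuous.iterate n
  have hB : (closedBall o (r / 2)).Nonempty := ⟨o, mem_closedBall_self (by linarith)⟩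
  have hWE : ∀ y : Y, ∀ u ∈ W y, A / 2 ≤ orbitProd f D n u ∧ orbitProd f D n u ≤ 2 * B :=
    fun y u hu => by
      obtain ⟨h1, h2⟩ := h.tube_prod hκ hK hKL (hEpos y) (hYg y y.2) hu.1
      have := hYA y y.2
      have := hYB y y.2
      constructor <;> linarith
  set S := branchLimit f^[n] W with hS
  have hTS : f^[n] '' S = S := image_branchLimit hsub honto
  have hWSne : ∀ y y' : Y, y ≠ y' → ∀ u ∈ W y, ∀ v ∈ W y', 8 * r / A ≤ dist u v :=
    fun y y' hne u hu v hv => by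
      have h1 := hYsep y y.2 y' y'.2 (fun h => hne (Subtype.ext h))
      have h2 := hWd y u hu
      have h3 := hWd y' v hv
      have e1 : 12 * r / A = 12 * (r / A) := by ring
      have e2 : 2 * r / A = 2 * (r / A) := by ring
      have e3 : 8 * r / A = 8 * (r / A) := by ring
      rw [e1] at h1; rw [e2] at h2 h3; rw [e3]
      have := dist_triangle (y : X) u y'
      have := dist_triangle u v y'
      linarith [dist_comm (y : X) u]
  have hSE : ∀ u ∈ S, ∀ m, (A / 2) ^ m ≤ orbitProd f D (n * m) u ∧
      orbitProd f D (n * m) u ≤ (2 * B) ^ m := by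
    intro u hu m
    induction m with
    | zero => simp
    | succ m ih =>
      obtain ⟨y, hy⟩ := mem_iUnion.mp (hu m)
      rw [← Function.iterate_mul] at hy
      obtain ⟨h1, h2⟩ := hWE y _ hy
      rw [mul_add, mul_one, orbitProd_add, pow_succ, pow_succ]
      have h3 := h.orbitProd_nonneg n (f^[n * m] u)
      have h4 := h.orbitProd_nonneg (n * m) u
      constructor
      · exact mul_le_mul ih.1 h1 (by positivity) h4
      · exact mul_le_mul ih.2 h2 h3 (h4.trans ih.2)
  have hexp := h.orbitProd_expanding hn (S := S) fun u hu m =>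
    (pow_le_pow_left₀ (by norm_num) (by linarith) m).trans (hSE u hu m).1
  have hScomp : IsCompact S := by
    refine IsClosed.isCompact ?_
    have : S = ⋂ k, (f^[n])^[k] ⁻¹' (⋃ i, W i) := by ext; simp [S, branchLimit]
    rw [this]
    exact isClosed_iInter fun k => (isClosed_iUnion_of_finite hWcl).preimage (hTc.iterate k)
  have hSmem : ∀ (ω : ℕ → Y) u, (∀ k, (f^[n])^[k] u ∈ W (ω k)) → u ∈ S :=
    fun ω u hu k => mem_iUnion.mpr ⟨_, hu k⟩
  have hex := exists_itinerary hTc hWcl hB hsub honto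
  obtain ⟨y0, hy0⟩ := hYne
  have hSne : S.Nonempty := by
    obtain ⟨u, hu⟩ := hex fun _ => ⟨y0, hy0⟩
    exact ⟨u, hSmem _ u hu⟩
  have hSΛ : S ⊆ ⋃ k ∈ Finset.range n, f^[k] '' S := fun u hu => by
    simp only [mem_iUnion, Finset.mem_range]; exact ⟨0, hn, u, hu, rfl⟩
  refine ⟨⋃ k ∈ Finset.range n, f^[k] '' S, hSne.mono hSΛ,
    (Finset.range n).isCompact_biUnion fun k _ => hScomp.image (h.continuous.iterate k),
    image_biUnion_iterate hn hTS, hexp, ⟨r / 8, by positivity, ?_⟩, 8 * r / A, by positivity, ?_⟩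
  · intro z hz δ hδ
    simp only [mem_iUnion, Finset.mem_range] at hz
    obtain ⟨j, hj, u, hu, rfl⟩ := hz
    choose ω hω using fun k => mem_iUnion.mp (hu k)
    obtain ⟨z', hz'⟩ := h.perfect o (r / 2) (by positivity) (by linarith)
    have hcontr : ∀ m, ∀ u v : X, (∀ k < m, (f^[n])^[k] u ∈ W (ω k)) →
        (∀ k < m, (f^[n])^[k] v ∈ W (ω k)) →
        dist u v ≤ (1 / 4) ^ m * dist ((f^[n])^[m] u) ((f^[n])^[m] v) := by
      intro m u v hu hv
      induction m with
      | zero => simp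
      | succ m ih =>
        refine (ih (fun k hk => hu k (by omega)) (fun k hk => hv k (by omega))).trans ?_
        have h1 := (h.tube_dist hκ hK hKL (hEpos (ω m)) (hYg _ (ω m).2)
          (hu m (by omega)).1 (hv m (by omega)).1).1
        rw [← Function.iterate_succ_apply' f^[n], ← Function.iterate_succ_apply' f^[n]] at h1
        have h2 := hYA _ (ω m).2
        rw [pow_succ, mul_assoc]
        refine mul_le_mul_of_nonneg_left ?_ (by positivity)
        nlinarith [dist_nonneg (x := (f^[n])^[m] u) (y := (f^[n])^[m] v)]
    have hlim : Tendsto (fun m : ℕ => L ^ j * ((1 / 4 : ℝ) ^ m * (2 * r))) atTop (𝓝 0) := by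
      have := (tendsto_pow_atTop_nhds_zero_of_lt_one (r := (1 / 4 : ℝ)) (by norm_num)
        (by norm_num)).mul_const (2 * r)
      simpa using this.const_mul (L ^ j)
    obtain ⟨m, hm, hm1⟩ := ((hlim.eventually (gt_mem_nhds hδ)).and (eventually_ge_atTop 1)).exists
    obtain ⟨v, -, hv, hvz⟩ := exists_finite_itinerary hsub honto m ω z' (by
      rw [mem_closedBall, hz'])
    have hum : dist ((f^[n])^[m] u) o < 3 * r / 8 := hWo _ _ (hω m)
    have hjn : j ≤ n * m := hj.le.trans (Nat.le_mul_of_pos_right n hm1)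
    refine ⟨n * m - j, f^[j] v, ?_, ?_⟩
    · refine lt_of_le_of_lt (h.dist_iterate_le j v u) (lt_of_le_of_lt ?_ hm)
      have := hcontr m v u hv fun k _ => hω k
      have h2 : dist ((f^[n])^[m] v) ((f^[n])^[m] u) ≤ 2 * r := by
        rw [hvz]
        have := dist_triangle_right z' ((f^[n])^[m] u) o
        linarith
      gcongr
      exact this.trans (by gcongr)
    · rw [← Function.iterate_add_apply, ← Function.iterate_add_apply, Nat.sub_add_cancel hjn,
        Function.iterate_mul, hvz]
      have := dist_triangle z' ((f^[n])^[m] u) o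
      linarith
  · intro m
    choose g hg using hex
    let w : (Fin m → Y) → ℕ → Y := fun ω k => if hk : k < m then ω ⟨k, hk⟩ else ⟨y0, hy0⟩
    have hsep : ∀ ω ω' : Fin m → Y, ω ≠ ω' →
        ∃ k < n * m, 8 * r / A ≤ dist (f^[k] (g (w ω))) (f^[k] (g (w ω'))) := by
      intro ω ω' hne
      obtain ⟨⟨k, hk⟩, hkne⟩ := Function.ne_iff.mp hne
      refine ⟨n * k, Nat.mul_lt_mul_of_pos_left hk hn, ?_⟩
      rw [Function.iterate_mul]
      refine hWSne (w ω k) (w ω' k) ?_ _ (hg _ k) _ (hg _ k)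
      simpa [w, hk] using hkne
    have hinj : Function.Injective fun ω => g (w ω) := by
      intro ω ω' heq
      by_contra hne
      obtain ⟨k, _, hk⟩ := hsep ω ω' hne
      simp only at heq
      rw [heq, dist_self] at hk
      have : 0 < 8 * r / A := by positivity
      linarith
    refine ⟨Finset.univ.image fun ω => g (w ω), ?_, ?_, ?_, ?_⟩
    · intro x hx
      simp only [Finset.coe_image, Finset.coe_univ, image_univ, mem_range] at hx
      obtain ⟨ω, rfl⟩ := hx
      exact hSΛ (hSmem _ _ (hg _))
    · rw [Finset.card_image_of_injective _ hinj]; simp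
    · intro x hx y hy hxy
      simp only [Finset.mem_image, Finset.mem_univ, true_and] at hx hy
      obtain ⟨ω, rfl⟩ := hx
      obtain ⟨ω', rfl⟩ := hy
      exact hsep ω ω' fun h => hxy (by rw [h])
    · intro x hx
      simp only [Finset.mem_image, Finset.mem_univ, true_and] at hx
      obtain ⟨ω, rfl⟩ := hx
      exact hSE _ (hSmem _ _ (hg _)) m

end TameMap

section Dimension
variable {X : Type*} [MetricSpace X]

/-- A set with countable covers of small mesh and bounded `s`-sums has dimension at most `s`. -/
lemma dimH_le_of_covers {S : Set X} {s : ℝ} (hs : 0 < s) {C : ℝ≥0∞} (hC : C ≠ ∞)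
    {r : ℕ → ℝ≥0∞} (hr : Tendsto r atTop (𝓝 0)) {ι : ℕ → Type*} [∀ n, Countable (ι n)]
    (U : ∀ n, ι n → Set X) (hU : ∀ᶠ n in atTop, ∀ i, ediam (U n i) ≤ r n)
    (hS : ∀ᶠ n in atTop, S ⊆ ⋃ i, U n i) (hsum : ∀ᶠ n in atTop, ∑' i, ediam (U n i) ^ s ≤ C) :
    dimH S ≤ ENNReal.ofReal s := by
  borelize X
  have h1 := Measure.hausdorffMeasure_le_liminf_tsum s S r hr U hU hS
  have h2 : liminf (fun n => ∑' i, ediam (U n i) ^ s) atTop ≤ C :=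
    liminf_le_of_frequently_le' hsum.frequently
  have h3 : μH[(s.toNNReal : ℝ)] S ≠ ∞ := by
    rw [Real.coe_toNNReal _ hs.le]
    exact ((h1.trans h2).trans_lt hC.lt_top).ne
  exact dimH_le_of_hausdorffMeasure_ne_top h3

lemma dimH_frequently_le {s a c C θ : ℝ} (hs : 0 < s) (ha : 0 < a) (hc : 0 < c) (hC : 0 ≤ C)
    (hθ : θ < s * a) (A : ℕ → Set X) (Y : ℕ → Finset X)
    (hA : ∀ᶠ n : ℕ in atTop, A n ⊆ ⋃ y ∈ Y n, closedBall y (c * Real.exp (-a * n)))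
    (hY : ∀ᶠ n : ℕ in atTop, ((Y n).card : ℝ) ≤ C * Real.exp (θ * n)) :
    dimH {x | ∃ᶠ n in atTop, x ∈ A n} ≤ ENNReal.ofReal s := by
  have hdiam : ∀ n y, ediam (closedBall y (c * Real.exp (-a * n)) : Set X) ≤
      ENNReal.ofReal (2 * c * Real.exp (-a * n)) := fun n y => by
    refine Metric.ediam_le_of_forall_dist_le fun u hu v hv => ?_
    have := dist_triangle_right u v y
    rw [mem_closedBall] at hu hv
    linarith
  have hanti : ∀ m n : ℕ, m ≤ n → Real.exp (-a * n) ≤ Real.exp (-a * m) := fun m n h => by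
    have : (m : ℝ) ≤ n := by exact_mod_cast h
    rw [Real.exp_le_exp]; nlinarith
  have hq : ∀ n : ℕ, Real.exp (θ * n) * Real.exp (-a * n) ^ s = Real.exp (θ - s * a) ^ n := fun n => by
    rw [← Real.exp_mul, ← Real.exp_add, ← Real.exp_nat_mul]; congr 1; ring
  have hq1 : Real.exp (θ - s * a) < 1 := by rw [Real.exp_lt_one_iff]; linarith
  have hsumm : Summable fun n : ℕ => C * (2 * c) ^ s * Real.exp (θ - s * a) ^ n :=
    (summable_geometric_of_lt_one (Real.exp_pos _).le hq1).mul_left _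
  refine dimH_le_of_covers hs (C := ENNReal.ofReal (∑' n : ℕ, C * (2 * c) ^ s *
    Real.exp (θ - s * a) ^ n)) ENNReal.ofReal_ne_top
    (r := fun N => ENNReal.ofReal (2 * c * Real.exp (-a * N))) ?_
    (ι := fun N => Σ n : ℕ, (Y (N + n) : Finset X))
    (fun N i => closedBall (i.2 : X) (c * Real.exp (-a * ((N + i.1 : ℕ) : ℝ)))) ?_ ?_ ?_
  · rw [← ENNReal.ofReal_zero]
    refine ENNReal.tendsto_ofReal ?_
    rw [← mul_zero (2 * c)]
    refine tendsto_const_nhds.mul (Real.tendsto_exp_atBot.comp ?_)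
    exact (tendsto_natCast_atTop_atTop).const_mul_atTop_of_neg (by linarith)
  · refine Eventually.of_forall fun N i => (hdiam _ _).trans ?_
    refine ENNReal.ofReal_le_ofReal ?_
    have := hanti N (N + i.1) (by omega)
    gcongr
  · obtain ⟨N0, hN0⟩ := eventually_atTop.mp hA
    filter_upwards [eventually_ge_atTop N0] with N hN x hx
    obtain ⟨n, hn, hxn⟩ := frequently_atTop.mp hx N
    have := hN0 n (by omega) hxn
    simp only [mem_iUnion, exists_prop] at this ⊢
    obtain ⟨y, hy, hxy⟩ := this
    obtain ⟨k, rfl⟩ := Nat.exists_eq_add_of_le hn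
    exact ⟨⟨k, y, hy⟩, hxy⟩
  · obtain ⟨N0, hN0⟩ := eventually_atTop.mp hY
    filter_upwards [eventually_ge_atTop N0] with N hN
    rw [ENNReal.tsum_sigma', ENNReal.ofReal_tsum_of_nonneg (fun n => by positivity) hsumm]
    refine ENNReal.tsum_le_tsum fun n => ?_
    have h1 : ∀ y : Y (N + n), ediam (closedBall (y : X) (c * Real.exp (-a * ((N + n : ℕ) : ℝ)))) ^ s ≤
        ENNReal.ofReal ((2 * c * Real.exp (-a * ((N + n : ℕ) : ℝ))) ^ s) := fun y => by
      rw [← ENNReal.ofReal_rpow_of_pos (by positivity)]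
      exact ENNReal.rpow_le_rpow (hdiam _ _) hs.le
    rw [tsum_fintype]
    refine (Finset.sum_le_sum fun y _ => h1 y).trans ?_
    rw [Finset.sum_const, nsmul_eq_mul, Finset.card_univ, Fintype.card_coe,
      ← ENNReal.ofReal_natCast, ← ENNReal.ofReal_mul (by positivity)]
    refine ENNReal.ofReal_le_ofReal ?_
    calc _ ≤ C * Real.exp (θ * ((N + n : ℕ) : ℝ)) * (2 * c * Real.exp (-a * ((N + n : ℕ) : ℝ))) ^ s := by
          gcongr; exact hN0 _ (by omega)
      _ = C * (2 * c) ^ s * Real.exp (θ - s * a) ^ (N + n) := by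
          rw [Real.mul_rpow (by positivity) (Real.exp_pos _).le, ← hq]; ring
      _ ≤ _ := by
          gcongr _ * ?_
          exact pow_le_pow_of_le_one (Real.exp_pos _).le hq1.le (by omega)

lemma dimH_le_of_antilipschitzOn {Y : Type*} [MetricSpace Y] {g : X → Y} {S : Set X} {Z : Set Y}
    {c : ℝ} (hc : 0 < c)
    (hg : ∀ u ∈ S, ∀ v ∈ S, c * dist u v ≤ dist (g u) (g v)) (hS : MapsTo g S Z) :
    dimH S ≤ dimH Z := by
  have h1 : AntilipschitzWith (Real.toNNReal c⁻¹) (S.domRestrict g) :=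
    AntilipschitzWith.of_le_mul_dist fun u v => by
      rw [Real.coe_toNNReal _ (by positivity), le_inv_mul_iff₀ hc]
      exact hg u u.2 v v.2
  have h2 := h1.le_dimH_image univ
  have h3 : dimH (univ : Set S) = dimH S := by
    rw [← (isometry_subtype_coe (s := S)).dimH_image univ]; simp
  rw [h3] at h2
  refine h2.trans (dimH_mono ?_)
  rintro _ ⟨u, _, rfl⟩
  exact hS u.2

end Dimension

namespace TameMap

variable {X : Type*} [MetricSpace X] {f : X → X} {D t : X → ℝ} {L : ℝ}

lemma dimH_preimage_one_le [SecondCountableTopology X] (h : TameMap f D t L) (Z : Set X) :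
    dimH {x | 0 < D x ∧ f x ∈ Z} ≤ dimH Z := by
  by_contra! hlt
  obtain ⟨x, hx, hxt⟩ := exists_mem_nhdsWithin_lt_dimH_of_lt_dimH hlt
  have hL := h.L_pos
  set ρ := D x / (2 * L) with hρ
  have hρ0 : 0 < ρ := div_pos hx.1 (by positivity)
  refine absurd (hxt _ (inter_mem_nhdsWithin _ (ball_mem_nhds x hρ0))) (not_lt.mpr ?_)
  refine dimH_le_of_antilipschitzOn (g := f) (c := D x / 2) (half_pos hx.1) ?_ fun u hu => hu.1.2
  intro u hu v hv
  have h1 := abs_le.mp (h.approx x u v ρ (mem_ball.mp hu.2).le (mem_ball.mp hv.2).le)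
  have h2 : L * ρ = D x / 2 := by rw [hρ]; field_simp
  rw [h2] at h1
  linarith [h1.1]

lemma dimH_preimage_le [SecondCountableTopology X] (h : TameMap f D t L) (Z : Set X) (m : ℕ) :
    dimH {x | 0 < orbitProd f D m x ∧ f^[m] x ∈ Z} ≤ dimH Z := by
  induction m with
  | zero => simp
  | succ m ih =>
    refine le_trans (dimH_mono ?_) ((h.dimH_preimage_one_le _).trans ih)
    rintro x ⟨hx1, hx2⟩
    rw [orbitProd_succ'] at hx1
    have hD : 0 < D x := by
      rcases (h.D_nonneg x).lt_or_eq with h1 | h1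
      · exact h1
      · rw [← h1] at hx1; simp at hx1
    exact ⟨hD, pos_of_mul_pos_right hx1 hD.le, hx2⟩

lemma exists_maximal_separated (h : TameMap f D t L) (S : Set X) {R ρ : ℝ} (hρ : 0 < ρ)
    (hR : ρ ≤ R) (hS : ∀ x ∈ S, t x ≤ R) :
    ∃ E : Finset X, ↑E ⊆ S ∧ (∀ x ∈ E, ∀ y ∈ E, x ≠ y → ρ < dist x y) ∧
      (E.card : ℝ) ≤ L * (R / ρ) ^ 3 ∧ S ⊆ ⋃ y ∈ E, closedBall y ρ := by
  classical
  let P : ℕ → Prop := fun k => ∃ E : Finset X, ↑E ⊆ S ∧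
    (∀ x ∈ E, ∀ y ∈ E, x ≠ y → ρ < dist x y) ∧ E.card = k
  have hbd : ∀ E : Finset X, ↑E ⊆ S → (∀ x ∈ E, ∀ y ∈ E, x ≠ y → ρ < dist x y) →
      (E.card : ℝ) ≤ L * (R / ρ) ^ 3 := fun E hES hE =>
    h.count R ρ E hρ hR (fun x hx => hS x (hES hx)) hE
  have hle : ∀ k, P k → k ≤ ⌊L * (R / ρ) ^ 3⌋₊ := by
    rintro k ⟨E, hES, hE, rfl⟩
    exact Nat.le_floor (hbd E hES hE)
  have hP0 : P 0 := ⟨∅, by simp, by simp, rfl⟩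
  obtain ⟨E, hES, hE, hcard⟩ := Nat.findGreatest_spec (P := P) (Nat.zero_le ⌊L * (R / ρ) ^ 3⌋₊) hP0
  refine ⟨E, hES, hE, hbd E hES hE, fun x hx => ?_⟩
  by_contra hcon
  simp only [mem_iUnion, mem_closedBall, not_exists, not_le] at hcon
  have hxE : x ∉ E := fun hxE => by
    have := hcon x hxE; rw [dist_self] at this; linarith
  have hP : P (E.card + 1) := by
    refine ⟨insert x E, ?_, ?_, Finset.card_insert_of_notMem hxE⟩
    · rw [Finset.coe_insert]; exact insert_subset hx hES
    · intro u hu v hv huv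
      rcases Finset.mem_insert.mp hu with rfl | hu' <;> rcases Finset.mem_insert.mp hv with rfl | hv'
      · exact absurd rfl huv
      · exact hcon v hv'
      · rw [dist_comm]; exact hcon u hu'
      · exact hE u hu' v hv' huv
  have := Nat.le_findGreatest (hle _ hP) hP
  omega

end TameMap

/-- The orbit products along `x` are positive, with exponential growth rates eventually in every
neighbourhood of `[α, β]`. -/
def HasExponents {X : Type*} (f : X → X) (D : X → ℝ) (α β : ℝ) (x : X) : Prop :=
  (∀ n, 0 < orbitProd f D n x) ∧ ∀ ε > 0, ∀ᶠ n : ℕ in atTop,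
    Real.exp ((α - ε) * n) ≤ orbitProd f D n x ∧ orbitProd f D n x ≤ Real.exp ((β + ε) * n)

lemma HasExponents.iterate {X : Type*} {f : X → X} {D : X → ℝ} {α β : ℝ} {x : X}
    (hx : HasExponents f D α β x) (m : ℕ) : HasExponents f D α β (f^[m] x) := by
  have hpos := hx.1
  have hE : ∀ n, orbitProd f D n (f^[m] x) = orbitProd f D (m + n) x / orbitProd f D m x := fun n => by
    rw [orbitProd_add, mul_div_cancel_left₀ _ (hpos m).ne']
  refine ⟨fun n => by rw [hE]; exact div_pos (hpos _) (hpos _), fun ε hε => ?_⟩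
  have h1 := hx.2 (ε / 2) (half_pos hε)
  have h2 := (tendsto_add_atTop_nat m).eventually h1
  have hlim : Tendsto (fun n : ℕ => ε / 2 * (n : ℝ)) atTop atTop :=
    tendsto_natCast_atTop_atTop.const_mul_atTop (by positivity)
  filter_upwards [h2, hlim.eventually_ge_atTop (Real.log (orbitProd f D m x) - (α - ε / 2) * m),
    hlim.eventually_ge_atTop ((β + ε / 2) * m - Real.log (orbitProd f D m x))] with n hn hn1 hn2
  rw [hE, add_comm m n, le_div_iff₀ (hpos m), div_le_iff₀ (hpos m)]
  rw [Nat.cast_add] at hn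
  have hlog := Real.exp_log (hpos m)
  constructor
  · refine le_trans ?_ hn.1
    rw [← hlog, ← Real.exp_add, Real.exp_le_exp]
    linarith
  · refine hn.2.trans ?_
    rw [← hlog, ← Real.exp_add, Real.exp_le_exp]
    linarith

namespace TameMap

variable {X : Type*} [MetricSpace X] {f : X → X} {D t : X → ℝ} {L : ℝ}

/-- The combinatorial conditions on the base points of a horseshoe. -/
structure IsHorseshoeBase (f : X → X) (D t : X → ℝ) (κ K r : ℝ) (n : ℕ) (o : X) (A B : ℝ)
    (Y : Finset X) : Prop where
  near : ∀ y ∈ Y, dist y o < r / 8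
  return_near : ∀ y ∈ Y, dist (f^[n] y) o < r / 8
  good : ∀ y ∈ Y, GoodTime f D t κ K r n y
  lower : ∀ y ∈ Y, A ≤ orbitProd f D n y
  upper : ∀ y ∈ Y, orbitProd f D n y ≤ B
  sep : ∀ y ∈ Y, ∀ y' ∈ Y, y ≠ y' → 12 * r / A < dist y y'

lemma dimH_good_return_le [CompactSpace X] (h : TameMap f D t L) {κ K r s α β : ℝ}
    (hr : 0 < r) (hs : 0 < s) (hαβ : α ≤ β) (o : X)
    (HP : ∀ q ∈ Icc α β, ∃ a b θ C : ℝ, a < q ∧ q < b ∧ 0 < a ∧ θ < s * a ∧ 0 ≤ C ∧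
      ∀ n : ℕ, 0 < n → 8 ≤ Real.exp (a * n) → ∀ Y : Finset X,
        IsHorseshoeBase f D t κ K r n o (Real.exp (a * n)) (Real.exp (b * n)) Y →
        (Y.card : ℝ) ≤ C * Real.exp (θ * n)) :
    dimH {y | dist y o < r / 8 ∧ HasExponents f D α β y ∧
      ∃ᶠ n in atTop, GoodTime f D t κ K r n y ∧ dist (f^[n] y) o < r / 8} ≤ ENNReal.ofReal s := by
  choose! a b θ C haq hqb ha hθ hC hcount using HP
  obtain ⟨J, hJ, hcov⟩ := (isCompact_Icc (a := α) (b := β)).elim_nhds_subcover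
    (fun q => Ioo (a q) (b q)) (fun q hq => Ioo_mem_nhds (haq q hq) (hqb q hq))
  have hopen : IsOpen (⋃ q ∈ J, Ioo (a q) (b q)) := isOpen_biUnion fun _ _ => isOpen_Ioo
  obtain ⟨ε, hε, hthick⟩ := (isCompact_Icc (a := α) (b := β)).exists_thickening_subset_open hopen hcov
  let A : ℝ → ℕ → Set X := fun q n => {y | dist y o < r / 8 ∧ GoodTime f D t κ K r n y ∧
    dist (f^[n] y) o < r / 8 ∧ Real.exp (a q * n) ≤ orbitProd f D n y ∧
    orbitProd f D n y ≤ Real.exp (b q * n)}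
  have hsub : {y | dist y o < r / 8 ∧ HasExponents f D α β y ∧
      ∃ᶠ n in atTop, GoodTime f D t κ K r n y ∧ dist (f^[n] y) o < r / 8} ⊆
      ⋃ q ∈ J, {y | ∃ᶠ n in atTop, y ∈ A q n} := by
    rintro y ⟨hyo, hyE, hyf⟩
    have : ∃ᶠ n in atTop, ∃ q ∈ J, y ∈ A q n := by
      refine (hyf.and_eventually ((hyE.2 (ε / 2) (half_pos hε)).and (eventually_gt_atTop 0))).mono ?_
      rintro n ⟨⟨hg, hno⟩, ⟨h1, h2⟩, hn⟩
      have hn' : (0 : ℝ) < n := by exact_mod_cast hn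
      have hpos := hyE.1 n
      set Q := Real.log (orbitProd f D n y) / n with hQ
      have hQE : orbitProd f D n y = Real.exp (Q * n) := by
        rw [hQ, div_mul_cancel₀ _ hn'.ne', Real.exp_log hpos]
      rw [hQE, Real.exp_le_exp] at h1 h2
      have h1' := le_of_mul_le_mul_right h1 hn'
      have h2' := le_of_mul_le_mul_right h2 hn'
      have hQmem : Q ∈ ⋃ q ∈ J, Ioo (a q) (b q) := by
        apply hthick
        rw [mem_thickening_iff]
        rcases lt_or_ge Q α with hc | hc
        · exact ⟨α, left_mem_Icc.mpr hαβ, by rw [Real.dist_eq, abs_lt]; constructor <;> linarith⟩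
        rcases lt_or_ge β Q with hc' | hc'
        · exact ⟨β, right_mem_Icc.mpr hαβ, by rw [Real.dist_eq, abs_lt]; constructor <;> linarith⟩
        · exact ⟨Q, ⟨hc, hc'⟩, by simpa using hε⟩
      simp only [mem_iUnion, exists_prop] at hQmem
      obtain ⟨q, hq, hq1, hq2⟩ := hQmem
      refine ⟨q, hq, hyo, hg, hno, ?_, ?_⟩
      · rw [hQE, Real.exp_le_exp]; gcongr
      · rw [hQE, Real.exp_le_exp]; gcongr
    rw [frequently_exists_finset] at this
    obtain ⟨q, hq, hfr⟩ := this
    exact mem_biUnion hq hfr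
  refine (dimH_mono hsub).trans ?_
  rw [← Finset.set_biUnion_coe, dimH_bUnion J.countable_toSet]
  refine iSup₂_le fun q hq => ?_
  have hqI := hJ q hq
  have hρlim : Tendsto (fun n : ℕ => Real.exp (a q * n)) atTop atTop :=
    Real.tendsto_exp_atTop.comp (tendsto_natCast_atTop_atTop.const_mul_atTop (ha q hqI))
  have hex : ∀ n : ℕ, ∃ Y : Finset X, (12 * r ≤ Real.exp (a q * n)) → ↑Y ⊆ A q n ∧
      (∀ x ∈ Y, ∀ y ∈ Y, x ≠ y → 12 * r / Real.exp (a q * n) < dist x y) ∧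
      A q n ⊆ ⋃ y ∈ Y, closedBall y (12 * r / Real.exp (a q * n)) := fun n => by
    by_cases hn : 12 * r ≤ Real.exp (a q * n)
    · obtain ⟨E, h1, h2, -, h3⟩ := h.exists_maximal_separated (A q n) (R := 1)
        (ρ := 12 * r / Real.exp (a q * n)) (by positivity)
        ((div_le_one (Real.exp_pos _)).mpr hn) (fun x _ => h.t_le_one x)
      exact ⟨E, fun _ => ⟨h1, h2, h3⟩⟩
    · exact ⟨∅, fun h => absurd h hn⟩
  choose Y hY using hex
  refine dimH_frequently_le hs (ha q hqI) (c := 12 * r) (by positivity) (hC q hqI) (hθ q hqI)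
    (A q) Y ?_ ?_
  · filter_upwards [hρlim.eventually_ge_atTop (12 * r)] with n hn
    have := (hY n hn).2.2
    rwa [div_eq_mul_inv, ← Real.exp_neg, ← neg_mul] at this
  · filter_upwards [hρlim.eventually_ge_atTop (12 * r), hρlim.eventually_ge_atTop 8,
      eventually_gt_atTop 0] with n hn hn8 hn0
    obtain ⟨h1, h2, -⟩ := hY n hn
    exact hcount q hqI n hn0 hn8 (Y n) ⟨fun y hy => (h1 hy).1, fun y hy => (h1 hy).2.2.1,
      fun y hy => (h1 hy).2.1, fun y hy => (h1 hy).2.2.2.1, fun y hy => (h1 hy).2.2.2.2, h2⟩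

/-- The dimension of the set of points with infinitely many good times. -/
theorem dimH_good_le [CompactSpace X] (h : TameMap f D t L) {κ K r s α β : ℝ}
    (hr : 0 < r) (hs : 0 < s) (hαβ : α ≤ β)
    (HP : ∀ q ∈ Icc α β, ∃ a b θ C : ℝ, a < q ∧ q < b ∧ 0 < a ∧ θ < s * a ∧ 0 ≤ C ∧
      ∀ n : ℕ, 0 < n → 8 ≤ Real.exp (a * n) → ∀ (o : X) (Y : Finset X),
        IsHorseshoeBase f D t κ K r n o (Real.exp (a * n)) (Real.exp (b * n)) Y →
        (Y.card : ℝ) ≤ C * Real.exp (θ * n)) :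
    dimH {x | HasExponents f D α β x ∧ ∃ᶠ n in atTop, GoodTime f D t κ K r n x} ≤
      ENNReal.ofReal s := by
  obtain ⟨O, -, hOfin, hO⟩ := finite_cover_balls_of_compact (isCompact_univ (X := X))
    (show (0 : ℝ) < r / 8 by positivity)
  set G : X → Set X := fun o => {y | dist y o < r / 8 ∧ HasExponents f D α β y ∧
      ∃ᶠ n in atTop, GoodTime f D t κ K r n y ∧ dist (f^[n] y) o < r / 8} with hG
  have hsub : {x | HasExponents f D α β x ∧ ∃ᶠ n in atTop, GoodTime f D t κ K r n x} ⊆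
      ⋃ o ∈ O, ⋃ m : ℕ, {x | 0 < orbitProd f D m x ∧ f^[m] x ∈ G o} := by
    rintro x ⟨hx, hfr⟩
    have : ∃ᶠ n in atTop, ∃ o ∈ O, GoodTime f D t κ K r n x ∧ dist (f^[n] x) o < r / 8 := by
      refine hfr.mono fun n hn => ?_
      have := hO (mem_univ (f^[n] x))
      simp only [mem_iUnion, exists_prop, mem_ball] at this
      obtain ⟨o, ho, hd⟩ := this
      exact ⟨o, ho, hn, hd⟩
    rw [frequently_exists_finite hOfin] at this
    obtain ⟨o, ho, hfo⟩ := this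
    obtain ⟨m, -, hmd⟩ := hfo.exists
    refine mem_biUnion ho (mem_iUnion.mpr ⟨m, hx.1 m, hmd, hx.iterate m, ?_⟩)
    refine frequently_atTop.mpr fun N => ?_
    obtain ⟨n, hn, hg, hd⟩ := frequently_atTop.mp hfo (m + N)
    obtain ⟨k, rfl⟩ := Nat.exists_eq_add_of_le (show m ≤ n by omega)
    refine ⟨k, by omega, hg.shift (hx.1 m), ?_⟩
    rwa [← Function.iterate_add_apply, add_comm k m]
  refine (dimH_mono hsub).trans ?_
  rw [dimH_bUnion hOfin.countable]
  refine iSup₂_le fun o _ => ?_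
  rw [dimH_iUnion]
  refine iSup_le fun m => (h.dimH_preimage_le _ m).trans ?_
  refine h.dimH_good_return_le hr hs hαβ o fun q hq => ?_
  obtain ⟨a, b, θ, C, h1, h2, h3, h4, h5, h6⟩ := HP q hq
  exact ⟨a, b, θ, C, h1, h2, h3, h4, h5, fun n hn hn8 Y hY => h6 n hn hn8 o Y hY⟩

end TameMap

section FailSet

variable {X : Type*} (f : X → X) (D t : X → ℝ) (κ K r : ℝ)

/-- The points without good times. -/
def FailSet : Set X := {x | (∀ n, 0 < orbitProd f D n x) ∧ ∀ n, 1 ≤ n → ¬ GoodTime f D t κ K r n x}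

/-- The points of the fail set with `t` of order `exp (-δ)`. -/
def failShell (δ : ℕ) : Set X :=
  {x | x ∈ FailSet f D t κ K r ∧ Real.exp (-(δ : ℝ) - 1) < t x ∧ t x ≤ Real.exp (-(δ : ℝ))}

/-- The points for which `exp (-κ l) * E_l / t (x_l)` stays below its initial value before
time `k`. -/
def RecordFree (k : ℕ) : Set X :=
  {x | ∀ l < k, orbitProd f D l x * Real.exp (-κ * l) * t x ≤ t (f^[l] x)}

variable {f D t κ K r}

lemma iterate_mem_failSet {x : X} {m : ℕ} (hE : ∀ n, 0 < orbitProd f D n x)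
    (ht0 : ∀ y, 0 ≤ t y) (ht : 0 < t (f^[m] x))
    (hmax : ∀ l < m, orbitProd f D l x * Real.exp (-κ * l) * t (f^[m] x) ≤
      orbitProd f D m x * Real.exp (-κ * m) * t (f^[l] x))
    (hK : 0 ≤ K * r)
    (hbad : ∀ n, 1 ≤ n → ¬ GoodTime f D t κ K r (m + n) x) : f^[m] x ∈ FailSet f D t κ K r := by
  refine ⟨fun n => ?_, fun n hn hg => hbad n hn fun l hl => ?_⟩
  · have := hE (m + n)
    rw [orbitProd_add] at this
    exact pos_of_mul_pos_right this (hE m).le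
  have e2 : Real.exp (-κ * ((m + n : ℕ) : ℝ)) = Real.exp (-κ * m) * Real.exp (-κ * n) := by
    rw [← Real.exp_add]; congr 1; push_cast; ring
  have hm0 : 0 < orbitProd f D m x * Real.exp (-κ * m) := mul_pos (hE m) (Real.exp_pos _)
  rcases lt_or_ge l m with hlm | hlm
  · have h1 := hg 0 (by omega)
    simp only [orbitProd_zero, Nat.cast_zero, mul_zero, Real.exp_zero, mul_one,
      Function.iterate_zero, id] at h1
    have h2 := hmax l hlm
    refine le_of_mul_le_mul_right ?_ ht
    calc K * r * orbitProd f D l x * Real.exp (-κ * l) * t (f^[m] x)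
        = K * r * (orbitProd f D l x * Real.exp (-κ * l) * t (f^[m] x)) := by ring
      _ ≤ K * r * (orbitProd f D m x * Real.exp (-κ * m) * t (f^[l] x)) := by gcongr
      _ = orbitProd f D m x * Real.exp (-κ * m) * t (f^[l] x) * (K * r) := by ring
      _ ≤ orbitProd f D m x * Real.exp (-κ * m) * t (f^[l] x) *
          (orbitProd f D n (f^[m] x) * Real.exp (-κ * n) * t (f^[m] x)) :=
          mul_le_mul_of_nonneg_left h1 (mul_nonneg hm0.le (ht0 _))
      _ = _ := by rw [orbitProd_add, e2]; ring
  · obtain ⟨j, rfl⟩ := Nat.exists_eq_add_of_le hlm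
    have h1 := hg j (by omega)
    have e1 : Real.exp (-κ * ((m + j : ℕ) : ℝ)) = Real.exp (-κ * m) * Real.exp (-κ * j) := by
      rw [← Real.exp_add]; congr 1; push_cast; ring
    rw [orbitProd_add, orbitProd_add, e1, e2, add_comm m j, Function.iterate_add_apply]
    calc _ = orbitProd f D m x * Real.exp (-κ * m) *
          (K * r * orbitProd f D j (f^[m] x) * Real.exp (-κ * j)) := by ring
      _ ≤ orbitProd f D m x * Real.exp (-κ * m) * (orbitProd f D n (f^[m] x) *
          Real.exp (-κ * n) * t (f^[j] (f^[m] x))) := mul_le_mul_of_nonneg_left h1 hm0.le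
      _ = _ := by ring

lemma record_mem_failSet {x : X} {k : ℕ} (hx : x ∈ FailSet f D t κ K r) (ht : ∀ l, 0 < t (f^[l] x))
    (ht0 : ∀ y, 0 ≤ t y) (hK : 0 ≤ K * r)
    (hfree : x ∈ RecordFree f D t κ k)
    (hrec : t (f^[k] x) < orbitProd f D k x * Real.exp (-κ * k) * t x) :
    f^[k] x ∈ FailSet f D t κ K r := by
  refine iterate_mem_failSet hx.1 ht0 (ht k) (fun l hl => ?_) hK fun n hn => hx.2 _ (by omega)
  have h1 := hfree l hl
  refine le_of_mul_le_mul_right ?_ (ht 0)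
  calc orbitProd f D l x * Real.exp (-κ * l) * t (f^[k] x) * t x
      = orbitProd f D l x * Real.exp (-κ * l) * t x * t (f^[k] x) := by ring
    _ ≤ t (f^[l] x) * (orbitProd f D k x * Real.exp (-κ * k) * t x) :=
        mul_le_mul h1 hrec.le (ht k).le (ht l).le
    _ = _ := by simp; ring

lemma record_lt {x : X} {k : ℕ} (hx : x ∈ FailSet f D t κ K r) (ht : ∀ l, 0 < t (f^[l] x))
    (hK : 0 ≤ K * r) (hk : 1 ≤ k) (hfree : x ∈ RecordFree f D t κ k)
    (hrec : t (f^[k] x) < orbitProd f D k x * Real.exp (-κ * k) * t x) :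
    t (f^[k] x) < K * r := by
  have := hx.2 k hk
  simp only [GoodTime, not_forall, not_le] at this
  obtain ⟨l, hl, hlt⟩ := this
  have h1 := hfree l hl
  refine lt_of_mul_lt_mul_right ?_ (ht l).le
  calc t (f^[k] x) * t (f^[l] x)
      < orbitProd f D k x * Real.exp (-κ * k) * t x * t (f^[l] x) :=
        mul_lt_mul_of_pos_right hrec (ht l)
    _ = orbitProd f D k x * Real.exp (-κ * k) * t (f^[l] x) * t x := by ring
    _ ≤ K * r * orbitProd f D l x * Real.exp (-κ * l) * t x :=
        mul_le_mul_of_nonneg_right hlt.le (ht 0).le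
    _ = K * r * (orbitProd f D l x * Real.exp (-κ * l) * t x) := by ring
    _ ≤ K * r * t (f^[l] x) := mul_le_mul_of_nonneg_left h1 hK

end FailSet

/-- The weighted `s`-diameter used to cover the fail set. -/
noncomputable def weightedGauge {X : Type*} [MetricSpace X] (f : X → X) (D t : X → ℝ) (s θ : ℝ)
    (n : ℕ) (U : Set X) : ℝ≥0∞ :=
  ⨆ x ∈ U, ⨆ y ∈ U, ENNReal.ofReal
    ((dist x y * orbitProd f D n x) ^ s * orbitProd f t n x ^ θ)

/-- The outer measure generated by the weighted `s`-diameters. -/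
noncomputable def weightedMeasure {X : Type*} [MetricSpace X] (f : X → X) (D t : X → ℝ) (s θ : ℝ)
    (n : ℕ) : OuterMeasure X :=
  OuterMeasure.ofFunction (weightedGauge f D t s θ n) (by simp [weightedGauge])

namespace TameMap

variable {X : Type*} [MetricSpace X] {f : X → X} {D t : X → ℝ} {L : ℝ} {κ K r s θ : ℝ}

lemma t_pos (h : TameMap f D t L) {x : X} (hE : ∀ n, 0 < orbitProd f D n x) (l : ℕ) :
    0 < t (f^[l] x) := by
  have h1 := hE (l + 1)
  rw [orbitProd_succ] at h1
  have h2 : 0 < D (f^[l] x) := pos_of_mul_pos_right h1 (hE l).le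
  exact pos_of_mul_pos_right (h2.trans_le (h.D_le _)) h.L_pos.le

/-- Expansion along a record-free block. -/
lemma recordFree_dist (h : TameMap f D t L) (hκ : 0 < κ) {k : ℕ} {x y : X}
    (hx : x ∈ RecordFree f D t κ k)
    (hd : dist y x ≤ κ / (4 * L) * t x * Real.exp (-κ * k)) :
    orbitProd f D k x * dist y x ≤ 2 * dist (f^[k] y) (f^[k] x) := by
  have hL := h.L_pos
  set τ : ℕ → ℝ := fun l => 2 * (κ / (4 * L)) * Real.exp (-κ * ((k : ℝ) - l)) with hτ
  have hτ0 : ∀ l, 0 ≤ τ l := fun l => by positivity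
  have hsum : ∀ m ≤ k, ∑ l ∈ Finset.range m, L * τ l ≤ 1 / 2 := fun m hm => by
    have h1 : ∑ l ∈ Finset.range m, L * τ l ≤ ∑ l ∈ Finset.range k, L * τ l :=
      Finset.sum_le_sum_of_subset_of_nonneg (by intro i; simp; omega)
        fun i _ _ => mul_nonneg hL.le (hτ0 i)
    refine h1.trans ?_
    have h2 := sum_exp_neg_le hκ k
    have h3 : ∑ l ∈ Finset.range k, L * τ l =
        κ / 2 * ∑ l ∈ Finset.range k, Real.exp (-κ * ((k : ℝ) - l)) := by
      rw [Finset.mul_sum]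
      refine Finset.sum_congr rfl fun l _ => ?_
      simp only [hτ]; field_simp; ring
    rw [h3]
    calc _ ≤ κ / 2 * (1 / κ) := by gcongr
      _ = 1 / 2 := by field_simp
  have hx0 : ∀ m, ∀ l < m, dist (f^[l] x) (f^[l] x) ≤ τ l * t (f^[l] x) := fun m l _ => by
    rw [dist_self]; exact mul_nonneg (hτ0 l) (h.t_nonneg _)
  have key : ∀ m ≤ k, ∀ l < m, dist (f^[l] y) (f^[l] x) ≤ τ l * t (f^[l] x) := by
    intro m
    induction m with
    | zero => intro _ l hl; omega
    | succ m ih =>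
      intro hm l hl
      rcases (Nat.lt_succ_iff_lt_or_eq.mp hl) with hl' | rfl
      · exact ih (by omega) l hl'
      have h1 := (h.shadow_dist l x y x τ (fun i _ => hτ0 i) (hsum l (by omega))
        (ih (by omega)) (hx0 l)).2
      have h2 := hx l (by omega)
      have h3 := h.orbitProd_nonneg l x
      have e : Real.exp (-κ * k) = Real.exp (-κ * l) * Real.exp (-κ * ((k : ℝ) - l)) := by
        rw [← Real.exp_add]; congr 1; ring
      calc _ ≤ _ := h1
        _ ≤ 2 * (orbitProd f D l x * (κ / (4 * L) * t x * Real.exp (-κ * k))) := by gcongr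
        _ = 2 * (κ / (4 * L)) * Real.exp (-κ * ((k : ℝ) - l)) *
            (orbitProd f D l x * Real.exp (-κ * l) * t x) := by rw [e]; ring
        _ ≤ _ := by simp only [hτ]; gcongr
  have := (h.shadow_dist k x y x τ (fun i _ => hτ0 i) (hsum k le_rfl) (key k le_rfl) (hx0 k)).1
  linarith

lemma orbitProd_t_le (h : TameMap f D t L) {k : ℕ} (hk : 1 ≤ k) (x : X) : orbitProd f t k x ≤ t x := by
  obtain ⟨j, rfl⟩ := Nat.exists_eq_add_of_le' hk
  rw [orbitProd_succ']
  refine mul_le_of_le_one_right (h.t_nonneg x) ?_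
  exact Finset.prod_le_one (fun _ _ => h.t_nonneg _) fun _ _ => h.t_le_one _

lemma orbitProd_t_nonneg (h : TameMap f D t L) (n : ℕ) (x : X) : 0 ≤ orbitProd f t n x :=
  Finset.prod_nonneg fun _ _ => h.t_nonneg _

/-- The gauge of a set that is expanded by `f^[k]`. -/
lemma weightedGauge_le (h : TameMap f D t L) (hs : 0 < s) (hθ : 0 < θ) {k m : ℕ} (hk : 1 ≤ k)
    {V U : Set X} {R : ℝ} (hVR : ∀ x ∈ V, t x ≤ R)
    (hV : ∀ x ∈ V, ∀ y ∈ V, orbitProd f D k x * dist x y ≤ 2 * dist (f^[k] x) (f^[k] y)) :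
    weightedGauge f D t s θ (k + m) (V ∩ f^[k] ⁻¹' U) ≤
      ENNReal.ofReal (2 ^ s * R ^ θ) * weightedGauge f D t s θ m U := by
  refine iSup₂_le fun x hx => iSup₂_le fun y hy => ?_
  have h1 : ENNReal.ofReal ((dist (f^[k] x) (f^[k] y) * orbitProd f D m (f^[k] x)) ^ s *
      orbitProd f t m (f^[k] x) ^ θ) ≤ weightedGauge f D t s θ m U :=
    le_iSup₂_of_le (f^[k] x) hx.2 (le_iSup₂_of_le (f^[k] y) hy.2 le_rfl)
  refine le_trans ?_ (mul_le_mul_right h1 _)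
  have hR : 0 ≤ R := (h.t_nonneg x).trans (hVR x hx.1)
  rw [← ENNReal.ofReal_mul (by positivity)]
  refine ENNReal.ofReal_le_ofReal ?_
  have hE1 := h.orbitProd_nonneg k x
  have hE2 := h.orbitProd_nonneg m (f^[k] x)
  have hT1 := h.orbitProd_t_nonneg k x
  have hT2 := h.orbitProd_t_nonneg m (f^[k] x)
  rw [orbitProd_add, orbitProd_add]
  have h2 : dist x y * (orbitProd f D k x * orbitProd f D m (f^[k] x)) ≤
      2 * (dist (f^[k] x) (f^[k] y) * orbitProd f D m (f^[k] x)) := by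
    have := mul_le_mul_of_nonneg_right (hV x hx.1 y hy.1) hE2
    linarith
  have h3 : orbitProd f t k x * orbitProd f t m (f^[k] x) ≤ R * orbitProd f t m (f^[k] x) :=
    mul_le_mul_of_nonneg_right ((h.orbitProd_t_le hk x).trans (hVR x hx.1)) hT2
  calc _ ≤ (2 * (dist (f^[k] x) (f^[k] y) * orbitProd f D m (f^[k] x))) ^ s *
        (R * orbitProd f t m (f^[k] x)) ^ θ := by gcongr
    _ = _ := by
      rw [Real.mul_rpow (by norm_num) (by positivity), Real.mul_rpow hR hT2]; ring

lemma weightedMeasure_le (h : TameMap f D t L) (hs : 0 < s) (hθ : 0 < θ) {k m : ℕ} (hk : 1 ≤ k)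
    {V : Set X} {R : ℝ} (hR : 0 < R) (hVR : ∀ x ∈ V, t x ≤ R)
    (hV : ∀ x ∈ V, ∀ y ∈ V, orbitProd f D k x * dist x y ≤ 2 * dist (f^[k] x) (f^[k] y))
    (Z : Set X) :
    weightedMeasure f D t s θ (k + m) (V ∩ f^[k] ⁻¹' Z) ≤
      ENNReal.ofReal (2 ^ s * R ^ θ) * weightedMeasure f D t s θ m Z := by
  have hc : ENNReal.ofReal (2 ^ s * R ^ θ) ≠ 0 := by
    rw [Ne, ENNReal.ofReal_eq_zero, not_le]; positivity
  conv_rhs => rw [weightedMeasure, OuterMeasure.ofFunction_apply]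
  rw [ENNReal.mul_iInf_of_ne hc ENNReal.ofReal_ne_top]
  refine le_iInf fun U => ?_
  rw [ENNReal.mul_iInf_of_ne hc ENNReal.ofReal_ne_top]
  refine le_iInf fun hU => ?_
  have h1 : V ∩ f^[k] ⁻¹' Z ⊆ ⋃ i, V ∩ f^[k] ⁻¹' (U i) := by
    rintro x ⟨hx, hxZ⟩
    obtain ⟨i, hi⟩ := mem_iUnion.mp (hU hxZ)
    exact mem_iUnion.mpr ⟨i, hx, hi⟩
  refine (measure_mono h1).trans ((measure_iUnion_le _).trans ?_)
  rw [← ENNReal.tsum_mul_left]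
  refine ENNReal.tsum_le_tsum fun i => ?_
  exact (OuterMeasure.ofFunction_le _).trans (h.weightedGauge_le hs hθ hk hVR hV)

lemma shell_block_le (h : TameMap f D t L) (hκ : 0 < κ) (hκ4 : κ ≤ 4) (hs : 0 < s) (hθ : 0 < θ)
    {k : ℕ} (m : ℕ) (hk : 1 ≤ k) {δ : ℕ} {V : Set X}
    (hV : V ⊆ failShell f D t κ K r δ ∩ RecordFree f D t κ k) (Z : Set X) :
    weightedMeasure f D t s θ (k + m) (V ∩ f^[k] ⁻¹' Z) ≤
      ENNReal.ofReal (L * (8 * L * Real.exp 1 / κ) ^ 3 * 2 ^ s * Real.exp (3 * κ * k) *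
        Real.exp (-θ * δ)) * weightedMeasure f D t s θ m Z := by
  have hL := h.L_pos
  set ρ := κ / (4 * L) * Real.exp (-(δ : ℝ) - 1) * Real.exp (-κ * k) / 2 with hρdef
  have hρ : 0 < ρ := by positivity
  have hη1 : κ / (4 * L) ≤ 1 := by
    rw [div_le_one (by positivity)]; nlinarith [h.one_le]
  have hρR : ρ ≤ Real.exp (-(δ : ℝ)) := by
    have h1 : Real.exp (-(δ : ℝ) - 1) ≤ Real.exp (-(δ : ℝ)) := Real.exp_le_exp.mpr (by linarith)
    have h2 : Real.exp (-κ * k) ≤ 1 := Real.exp_le_one_iff.mpr (by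
      have : 0 ≤ κ * k := by positivity
      linarith)
    have h3 : κ / (4 * L) * Real.exp (-(δ : ℝ) - 1) * Real.exp (-κ * k) ≤
        1 * Real.exp (-(δ : ℝ)) * 1 := by gcongr
    have h4 := Real.exp_pos (-(δ : ℝ))
    rw [hρdef]; linarith
  have hVR : ∀ x ∈ V, t x ≤ Real.exp (-(δ : ℝ)) := fun x hx => (hV hx).1.2.2
  obtain ⟨E, -, -, hcard, hcov⟩ := h.exists_maximal_separated V hρ hρR hVR
  have hsub : V ∩ f^[k] ⁻¹' Z ⊆ ⋃ y ∈ E, (V ∩ closedBall y ρ) ∩ f^[k] ⁻¹' Z := by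
    rintro x ⟨hx, hxZ⟩
    obtain ⟨y, hy, hxy⟩ := mem_iUnion₂.mp (hcov hx)
    exact mem_iUnion₂.mpr ⟨y, hy, ⟨hx, hxy⟩, hxZ⟩
  have hblock : ∀ y ∈ E, weightedMeasure f D t s θ (k + m) ((V ∩ closedBall y ρ) ∩ f^[k] ⁻¹' Z) ≤
      ENNReal.ofReal (2 ^ s * Real.exp (-(δ : ℝ)) ^ θ) * weightedMeasure f D t s θ m Z := by
    intro y _
    refine h.weightedMeasure_le hs hθ hk (Real.exp_pos _) (fun x hx => hVR x hx.1)
      (fun x hx z hz => ?_) Z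
    rw [dist_comm x z, dist_comm (f^[k] x)]
    refine h.recordFree_dist hκ (hV hx.1).2 ?_
    have h1 : dist z x ≤ 2 * ρ := by
      have := dist_triangle_right z x y
      have h2 := mem_closedBall.mp hx.2
      have h3 := mem_closedBall.mp hz.2
      linarith
    refine h1.trans ?_
    rw [hρdef, mul_div_cancel₀ _ (two_ne_zero)]
    have := (hV hx.1).1.2.1.le
    gcongr
  refine (measure_mono hsub).trans ((measure_biUnion_finset_le _ _).trans
    ((Finset.sum_le_sum hblock).trans ?_))
  rw [Finset.sum_const, nsmul_eq_mul, ← mul_assoc]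
  gcongr
  rw [← ENNReal.ofReal_natCast, ← ENNReal.ofReal_mul (by positivity)]
  refine ENNReal.ofReal_le_ofReal ?_
  have hRρ : Real.exp (-(δ : ℝ)) / ρ = 8 * L * Real.exp 1 / κ * Real.exp (κ * k) := by
    rw [div_eq_iff hρ.ne', hρdef]
    have e1 : Real.exp (-(δ : ℝ) - 1) = Real.exp (-(δ : ℝ)) * (Real.exp 1)⁻¹ := by
      rw [← Real.exp_neg, ← Real.exp_add]; rfl
    have e2 : Real.exp (-κ * k) = (Real.exp (κ * k))⁻¹ := by
      rw [← Real.exp_neg]; congr 1; ring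
    rw [e1, e2]
    field_simp
    norm_num
  have e3 : Real.exp (3 * κ * k) = Real.exp (κ * k) ^ 3 := by
    rw [← Real.exp_nat_mul]; congr 1; push_cast; ring
  have e4 : Real.exp (-(δ : ℝ)) ^ θ = Real.exp (-θ * δ) := by
    rw [← Real.exp_mul]; congr 1; ring
  rw [hRρ] at hcard
  rw [e3, e4]
  calc (E.card : ℝ) * (2 ^ s * Real.exp (-θ * δ)) ≤
      L * (8 * L * Real.exp 1 / κ * Real.exp (κ * k)) ^ 3 * (2 ^ s * Real.exp (-θ * δ)) := by
        gcongr
    _ = _ := by ring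

lemma failSet_subset_iUnion (h : TameMap f D t L) :
    FailSet f D t κ K r ⊆ ⋃ δ, failShell f D t κ K r δ := by
  intro x hx
  have ht : 0 < t x := h.t_pos hx.1 0
  have h0 : 0 ≤ -Real.log (t x) := by
    have := Real.log_nonpos ht.le (h.t_le_one x); linarith
  refine mem_iUnion.mpr ⟨⌊-Real.log (t x)⌋₊, hx, ?_, ?_⟩
  · rw [← Real.lt_log_iff_exp_lt ht]
    have := Nat.lt_floor_add_one (-Real.log (t x)); linarith
  · rw [← Real.log_le_iff_le_exp ht]
    have := Nat.floor_le h0; linarith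

lemma hasSum_exp (hθ : 0 < θ) :
    HasSum (fun δ : ℕ => Real.exp (-θ * δ)) (1 - Real.exp (-θ))⁻¹ := by
  have h1 := hasSum_geometric_of_lt_one (Real.exp_pos (-θ)).le (by
    rw [Real.exp_lt_one_iff]; linarith)
  simpa only [← Real.exp_nat_mul, mul_comm] using h1

lemma lowFail_le (h : TameMap f D t L) (hθ : 0 < θ) {m : ℕ} {b R : ℝ} (hb : 0 ≤ b) (hR : 0 < R)
    (hm : ∀ δ, weightedMeasure f D t s θ m (failShell f D t κ K r δ) ≤
      ENNReal.ofReal (b * Real.exp (-θ * δ))) :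
    weightedMeasure f D t s θ m (FailSet f D t κ K r ∩ {x | t x < R}) ≤
      ENNReal.ofReal (b * (Real.exp 1 * R) ^ (θ / 2) * (1 - Real.exp (-(θ / 2)))⁻¹) := by
  have hsub : FailSet f D t κ K r ∩ {x | t x < R} ⊆
      ⋃ δ, (failShell f D t κ K r δ ∩ {x | t x < R}) := by
    rw [← iUnion_inter]
    exact inter_subset_inter_left _ h.failSet_subset_iUnion
  have hsum := (hasSum_exp (half_pos hθ)).mul_left (b * (Real.exp 1 * R) ^ (θ / 2))
  rw [← hsum.tsum_eq, ENNReal.ofReal_tsum_of_nonneg (fun δ => by positivity) hsum.summable]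
  refine (measure_mono hsub).trans ((measure_iUnion_le _).trans (ENNReal.tsum_le_tsum fun δ => ?_))
  rcases (failShell f D t κ K r δ ∩ {x | t x < R}).eq_empty_or_nonempty with he | ⟨x, hx, hxR⟩
  · rw [he]; simp
  refine (measure_mono inter_subset_left).trans ((hm δ).trans (ENNReal.ofReal_le_ofReal ?_))
  have h1 : Real.exp (-(δ : ℝ)) ≤ Real.exp 1 * R := by
    have h2 : Real.exp (-(δ : ℝ) - 1) < R := hx.2.1.trans hxR
    calc Real.exp (-(δ : ℝ)) = Real.exp 1 * Real.exp (-(δ : ℝ) - 1) := by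
          rw [← Real.exp_add]; congr 1; ring
      _ ≤ _ := by gcongr
  have h3 : Real.exp (-(θ / 2) * δ) ≤ (Real.exp 1 * R) ^ (θ / 2) := by
    calc Real.exp (-(θ / 2) * δ) = Real.exp (-(δ : ℝ)) ^ (θ / 2) := by
          rw [← Real.exp_mul]; congr 1; ring
      _ ≤ _ := by gcongr
  have h4 : Real.exp (-θ * δ) = Real.exp (-(θ / 2) * δ) * Real.exp (-(θ / 2) * δ) := by
    rw [← Real.exp_add]; congr 1; ring
  rw [h4, mul_assoc]
  gcongr

/-- The weighted measures of the shells of the fail set grow slowly. -/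
lemma failShell_le (h : TameMap f D t L) (hκ : 0 < κ) (hκ4 : κ ≤ 4) (hs : 0 < s) (hθ : 0 < θ)
    (hκθ : 6 * κ ≤ θ) (hKr : 0 < K * r) {Δ A S : ℝ} (hΔ : ∀ x y : X, dist x y ≤ Δ) (hΔ0 : 0 ≤ Δ)
    (hA : A = L * (8 * L * Real.exp 1 / κ) ^ 3 * 2 ^ s) (hS : S = (1 - Real.exp (-(θ / 2)))⁻¹)
    (hr : A * S ^ 2 * (Real.exp 1 * (K * r)) ^ (θ / 2) ≤ 1 / 2) {n : ℕ} (hn : 1 ≤ n) (δ : ℕ) :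
    weightedMeasure f D t s θ n (failShell f D t κ K r δ) ≤
      ENNReal.ofReal (2 * A * Δ ^ s * Real.exp (θ * n) * Real.exp (-θ * δ)) := by
  have hL := h.L_pos
  have hA0 : 0 ≤ A := by rw [hA]; positivity
  have hS0 : 0 < S := by
    rw [hS, inv_pos, sub_pos, Real.exp_lt_one_iff]; linarith
  set B := 2 * A * Δ ^ s with hB
  have hB0 : 0 ≤ B := by positivity
  induction n using Nat.strong_induction_on generalizing δ with
  | _ n ih =>
  set V : ℕ → Set X := fun k => failShell f D t κ K r δ ∩ RecordFree f D t κ k with hVdef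
  set Z := FailSet f D t κ K r ∩ {x | t x < K * r} with hZ
  have hsub : failShell f D t κ K r δ ⊆
      (V n ∩ f^[n] ⁻¹' univ) ∪ ⋃ k ∈ Finset.Ico 1 n, V k ∩ f^[k] ⁻¹' Z := by
    intro x hx
    have ht : ∀ l, 0 < t (f^[l] x) := h.t_pos hx.1.1
    by_cases hfree : x ∈ RecordFree f D t κ n
    · exact Or.inl ⟨⟨hx, hfree⟩, mem_univ _⟩
    classical
    have hex : ∃ k, k < n ∧ t (f^[k] x) < orbitProd f D k x * Real.exp (-κ * k) * t x := by
      simpa [RecordFree] using hfree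
    obtain ⟨hkn, hrec⟩ := Nat.find_spec hex
    set k := Nat.find hex
    have hfreek : x ∈ RecordFree f D t κ k := fun l hl => by
      by_contra hcon
      exact Nat.find_min hex hl ⟨hl.trans hkn, not_le.mp hcon⟩
    have hk : 1 ≤ k := by
      rcases Nat.eq_zero_or_pos k with h0 | h0
      · rw [h0] at hrec; simp at hrec
      · exact h0
    exact Or.inr (mem_iUnion₂.mpr ⟨k, Finset.mem_Ico.mpr ⟨hk, hkn⟩, ⟨hx, hfreek⟩,
      record_mem_failSet hx.1 ht h.t_nonneg hKr.le hfreek hrec,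
      record_lt hx.1 ht hKr.le hk hfreek hrec⟩)
  have h0 : weightedMeasure f D t s θ 0 univ ≤ ENNReal.ofReal (Δ ^ s) := by
    refine (OuterMeasure.ofFunction_le _).trans (iSup₂_le fun x _ => iSup₂_le fun y _ => ?_)
    refine ENNReal.ofReal_le_ofReal ?_
    rw [orbitProd_zero, orbitProd_zero, mul_one, Real.one_rpow, mul_one]
    have := hΔ x y
    gcongr
  have hfirst : weightedMeasure f D t s θ n (V n ∩ f^[n] ⁻¹' univ) ≤
      ENNReal.ofReal (B / 2 * Real.exp (θ * n) * Real.exp (-θ * δ)) := by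
    refine (h.shell_block_le hκ hκ4 hs hθ 0 hn (V := V n) (K := K) (r := r) (δ := δ) le_rfl
      univ).trans ((mul_le_mul_right h0 _).trans ?_)
    rw [← ENNReal.ofReal_mul (by positivity)]
    refine ENNReal.ofReal_le_ofReal ?_
    rw [← hA]
    have h1 : Real.exp (3 * κ * n) ≤ Real.exp (θ * n) := by
      refine Real.exp_le_exp.mpr (mul_le_mul_of_nonneg_right (by linarith) (Nat.cast_nonneg n))
    calc A * Real.exp (3 * κ * n) * Real.exp (-θ * δ) * Δ ^ s
        ≤ A * Real.exp (θ * n) * Real.exp (-θ * δ) * Δ ^ s := by gcongr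
      _ = _ := by rw [hB]; ring
  have hblock : ∀ k ∈ Finset.Ico 1 n, weightedMeasure f D t s θ n (V k ∩ f^[k] ⁻¹' Z) ≤
      ENNReal.ofReal (A * B * S * (Real.exp 1 * (K * r)) ^ (θ / 2) * Real.exp (θ * n) *
        Real.exp (-θ * δ) * Real.exp (-(θ / 2) * k)) := by
    intro k hk
    obtain ⟨hk1, hkn⟩ := Finset.mem_Ico.mp hk
    obtain ⟨m, rfl⟩ := Nat.exists_eq_add_of_le hkn.le
    have h1 := h.shell_block_le hκ hκ4 hs hθ m hk1 (V := V k) (K := K) (r := r) (δ := δ) le_rfl Z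
    have h2 := h.lowFail_le (s := s) (κ := κ) (K := K) (r := r) hθ (m := m)
      (b := B * Real.exp (θ * m)) (by positivity) hKr fun δ' => ih m (by omega) (by omega) δ'
    refine h1.trans ((mul_le_mul_right h2 _).trans ?_)
    rw [← ENNReal.ofReal_mul (by positivity), ← hA, ← hS]
    refine ENNReal.ofReal_le_ofReal ?_
    have h3 : Real.exp (3 * κ * k) ≤ Real.exp (θ * k) * Real.exp (-(θ / 2) * k) := by
      rw [← Real.exp_add]
      refine Real.exp_le_exp.mpr ?_
      have : 0 ≤ (θ - 6 * κ) * k := mul_nonneg (by linarith) (Nat.cast_nonneg k)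
      linarith
    have h4 : Real.exp (θ * ((k + m : ℕ) : ℝ)) = Real.exp (θ * k) * Real.exp (θ * m) := by
      rw [← Real.exp_add]; congr 1; push_cast; ring
    rw [h4]
    calc _ ≤ A * (Real.exp (θ * k) * Real.exp (-(θ / 2) * k)) * Real.exp (-θ * δ) *
          (B * Real.exp (θ * m) * (Real.exp 1 * (K * r)) ^ (θ / 2) * S) := by gcongr
      _ = _ := by ring
  refine (measure_mono hsub).trans ((measure_union_le _ _).trans ((add_le_add hfirst
    ((measure_biUnion_finset_le _ _).trans (Finset.sum_le_sum hblock))).trans ?_))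
  rw [← ENNReal.ofReal_sum_of_nonneg (fun _ _ => by positivity),
    ← ENNReal.ofReal_add (by positivity) (Finset.sum_nonneg fun _ _ => by positivity)]
  refine ENNReal.ofReal_le_ofReal ?_
  rw [← Finset.mul_sum]
  have hSle : ∑ k ∈ Finset.Ico 1 n, Real.exp (-(θ / 2) * (k : ℕ)) ≤ S := by
    rw [hS]
    exact sum_le_hasSum _ (fun _ _ => (Real.exp_pos _).le) (hasSum_exp (half_pos hθ))
  calc _ ≤ B / 2 * Real.exp (θ * n) * Real.exp (-θ * δ) +
        A * B * S * (Real.exp 1 * (K * r)) ^ (θ / 2) * Real.exp (θ * n) *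
        Real.exp (-θ * δ) * S := by gcongr
    _ = (B / 2 + B * (A * S ^ 2 * (Real.exp 1 * (K * r)) ^ (θ / 2))) *
        (Real.exp (θ * n) * Real.exp (-θ * δ)) := by ring
    _ ≤ (B / 2 + B * (1 / 2)) * (Real.exp (θ * n) * Real.exp (-θ * δ)) := by gcongr
    _ = _ := by ring

lemma orbitProd_le_t (h : TameMap f D t L) (n : ℕ) (x : X) :
    orbitProd f D n x ≤ L ^ n * orbitProd f t n x := by
  calc orbitProd f D n x ≤ ∏ l ∈ Finset.range n, L * t (f^[l] x) :=
        Finset.prod_le_prod (fun _ _ => h.D_nonneg _) fun _ _ => h.D_le _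
    _ = _ := by rw [Finset.prod_mul_distrib]; simp [orbitProd]

/-- Weighted diameters control diameters on the points with exponential growth. -/
lemma ediam_rpow_le (h : TameMap f D t L) (hs : 0 < s) (hθ : 0 < θ) {σ : ℝ} (hσ : 0 < σ) (n : ℕ)
    {U W : Set X} (hWU : W ⊆ U) (hW : ∀ x ∈ W, Real.exp (σ * n) ≤ orbitProd f D n x) :
    ediam W ^ s ≤ ENNReal.ofReal (Real.exp ((θ * Real.log L - σ * s) * n)) *
      weightedGauge f D t s θ n U := by
  have hL := h.L_pos
  suffices hd : ediam W ≤ (ENNReal.ofReal (Real.exp ((θ * Real.log L - σ * s) * n)) *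
      weightedGauge f D t s θ n U) ^ s⁻¹ by
    calc ediam W ^ s ≤ _ := ENNReal.rpow_le_rpow hd hs.le
      _ = _ := by rw [← ENNReal.rpow_mul, inv_mul_cancel₀ hs.ne', ENNReal.rpow_one]
  refine Metric.ediam_le fun x hx y hy => ?_
  rw [ENNReal.le_rpow_inv_iff hs, edist_dist,
    ENNReal.ofReal_rpow_of_nonneg dist_nonneg hs.le]
  have h1 : ENNReal.ofReal ((dist x y * orbitProd f D n x) ^ s * orbitProd f t n x ^ θ) ≤
      weightedGauge f D t s θ n U :=
    le_iSup₂_of_le x (hWU hx) (le_iSup₂_of_le y (hWU hy) le_rfl)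
  refine le_trans ?_ (mul_le_mul_right h1 _)
  rw [← ENNReal.ofReal_mul (Real.exp_pos _).le]
  refine ENNReal.ofReal_le_ofReal ?_
  have hE := hW x hx
  have hE1 : 1 ≤ orbitProd f D n x := le_trans (Real.one_le_exp (by positivity)) hE
  have hT : Real.exp (-Real.log L * n) ≤ orbitProd f t n x := by
    have h2 : L ^ n = Real.exp (Real.log L * n) := by
      rw [mul_comm, Real.exp_nat_mul, Real.exp_log hL]
    have h3 := hE1.trans (h.orbitProd_le_t n x)
    rw [h2] at h3
    calc Real.exp (-Real.log L * n) = Real.exp (-Real.log L * n) * 1 := (mul_one _).symm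
      _ ≤ Real.exp (-Real.log L * n) * (Real.exp (Real.log L * n) * orbitProd f t n x) := by gcongr
      _ = orbitProd f t n x := by rw [← mul_assoc, ← Real.exp_add]; simp
  have hT2 : Real.exp (-Real.log L * n) ^ θ ≤ orbitProd f t n x ^ θ := by gcongr
  have hE2 : (dist x y * Real.exp (σ * n)) ^ s ≤ (dist x y * orbitProd f D n x) ^ s := by gcongr
  calc dist x y ^ s = Real.exp ((θ * Real.log L - σ * s) * n) *
        ((dist x y * Real.exp (σ * n)) ^ s * Real.exp (-Real.log L * n) ^ θ) := by
        rw [Real.mul_rpow dist_nonneg (Real.exp_pos _).le, ← Real.exp_mul, ← Real.exp_mul, mul_assoc,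
          ← Real.exp_add, mul_comm, mul_assoc, ← Real.exp_add]
        ring_nf
        simp
    _ ≤ _ := by gcongr

lemma dimH_failTail_le (h : TameMap f D t L) (hs : 0 < s) (hθ : 0 < θ) {M σ : ℝ} (hM0 : 0 ≤ M)
    (hM : ∀ n, 1 ≤ n → weightedMeasure f D t s θ n (FailSet f D t κ K r) ≤
      ENNReal.ofReal (M * Real.exp (θ * n)))
    (hσ : 0 < σ) (hγ : θ * (1 + Real.log L) < σ * s) (N : ℕ) :
    dimH {x | x ∈ FailSet f D t κ K r ∧ ∀ n, N ≤ n → Real.exp (σ * n) ≤ orbitProd f D n x} ≤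
      ENNReal.ofReal s := by
  set S := {x | x ∈ FailSet f D t κ K r ∧ ∀ n, N ≤ n → Real.exp (σ * n) ≤ orbitProd f D n x}
  have hcov : ∀ n, ∃ U : ℕ → Set X, 1 ≤ n → FailSet f D t κ K r ⊆ ⋃ i, U i ∧
      ∑' i, weightedGauge f D t s θ n (U i) ≤ ENNReal.ofReal ((M + 1) * Real.exp (θ * n)) := by
    intro n
    by_cases hn : 1 ≤ n
    · have h1 : weightedMeasure f D t s θ n (FailSet f D t κ K r) <
          ENNReal.ofReal ((M + 1) * Real.exp (θ * n)) := (hM n hn).trans_lt (by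
        refine (ENNReal.ofReal_lt_ofReal_iff (by positivity)).mpr ?_
        have := Real.exp_pos (θ * n); linarith)
      rw [weightedMeasure, OuterMeasure.ofFunction_apply] at h1
      simp only [iInf_lt_iff] at h1
      obtain ⟨U, hU, hlt⟩ := h1
      exact ⟨U, fun _ => ⟨hU, hlt.le⟩⟩
    · exact ⟨fun _ => ∅, fun h => absurd h hn⟩
  choose U hU using hcov
  set γ := σ * s - θ * (1 + Real.log L) with hγdef
  have hγ0 : 0 < γ := by rw [hγdef]; linarith
  have hsum : ∀ n, 1 ≤ n → N ≤ n → ∑' i, ediam (U n i ∩ S) ^ s ≤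
      ENNReal.ofReal ((M + 1) * Real.exp (-γ * n)) := by
    intro n hn hNn
    have h1 : ∀ i, ediam (U n i ∩ S) ^ s ≤
        ENNReal.ofReal (Real.exp ((θ * Real.log L - σ * s) * n)) *
        weightedGauge f D t s θ n (U n i) := fun i =>
      h.ediam_rpow_le hs hθ hσ n inter_subset_left fun x hx => hx.2.2 n hNn
    refine (ENNReal.tsum_le_tsum h1).trans ?_
    rw [ENNReal.tsum_mul_left]
    refine (mul_le_mul_right (hU n hn).2 _).trans ?_
    rw [← ENNReal.ofReal_mul (Real.exp_pos _).le]
    refine ENNReal.ofReal_le_ofReal (le_of_eq ?_)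
    rw [mul_left_comm, ← Real.exp_add]
    congr 2
    rw [hγdef]; ring
  have hlim : Tendsto (fun n : ℕ => (M + 1) * Real.exp (-γ * n)) atTop (𝓝 0) := by
    have h1 : Tendsto (fun n : ℕ => γ * (n : ℝ)) atTop atTop :=
      tendsto_natCast_atTop_atTop.const_mul_atTop hγ0
    have h2 := (Real.tendsto_exp_neg_atTop_nhds_zero.comp h1).const_mul (M + 1)
    simpa [Function.comp_def] using h2
  have hr : Tendsto (fun n : ℕ => ENNReal.ofReal ((M + 1) * Real.exp (-γ * n)) ^ s⁻¹) atTop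
      (𝓝 0) := by
    have h1 : Tendsto (fun n : ℕ => ENNReal.ofReal ((M + 1) * Real.exp (-γ * n))) atTop (𝓝 0) := by
      simpa using ENNReal.tendsto_ofReal hlim
    have h2 := h1.ennrpow_const s⁻¹
    rwa [ENNReal.zero_rpow_of_pos (by positivity)] at h2
  refine dimH_le_of_covers hs (C := ENNReal.ofReal (M + 1)) ENNReal.ofReal_ne_top hr
    (ι := fun _ => ℕ) (fun n i => U n i ∩ S) ?_ ?_ ?_
  · filter_upwards [eventually_ge_atTop 1, eventually_ge_atTop N] with n hn hNn i
    rw [ENNReal.le_rpow_inv_iff hs]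
    exact (ENNReal.le_tsum i).trans (hsum n hn hNn)
  · filter_upwards [eventually_ge_atTop 1] with n hn x hx
    obtain ⟨i, hi⟩ := mem_iUnion.mp ((hU n hn).1 hx.1)
    exact mem_iUnion.mpr ⟨i, hi, hx⟩
  · filter_upwards [eventually_ge_atTop 1, eventually_ge_atTop N] with n hn hNn
    refine (hsum n hn hNn).trans (ENNReal.ofReal_le_ofReal ?_)
    have h1 : Real.exp (-γ * n) ≤ 1 := Real.exp_le_one_iff.mpr (by
      have : 0 ≤ γ * n := by positivity
      linarith)
    nlinarith

/-- For suitable constants, the points with only finitely many good times have small dimension. -/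
theorem dimH_fail_le [CompactSpace X] (h : TameMap f D t L) {α : ℝ} (β : ℝ) (hs : 0 < s)
    (hα : 0 < α) : ∃ κ K r : ℝ, 0 < κ ∧ 0 < K ∧ 0 < r ∧ r ≤ 1 ∧ 8 * L ≤ κ * K ∧ 2 * L ≤ K ∧
      dimH {x | HasExponents f D α β x ∧ ∀ᶠ n in atTop, ¬ GoodTime f D t κ K r n x} ≤
        ENNReal.ofReal s := by
  have hL := h.L_pos
  have hlog : 0 ≤ Real.log L := Real.log_nonneg h.one_le
  set σ := α / 2 with hσdef
  have hσ : 0 < σ := half_pos hα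
  set θ := σ * s / (2 * (1 + Real.log L)) with hθdef
  have hθ : 0 < θ := by positivity
  have hγ : θ * (1 + Real.log L) < σ * s := by
    rw [hθdef, div_mul_eq_mul_div, div_lt_iff₀ (by positivity)]
    have : 0 < σ * s * (1 + Real.log L) := by positivity
    linarith
  set κ := min (θ / 6) (min (σ / 2) 4) with hκdef
  have hκ : 0 < κ := by positivity
  have hκθ : 6 * κ ≤ θ := by
    have := min_le_left (θ / 6) (min (σ / 2) 4)
    linarith
  have hκ4 : κ ≤ 4 := (min_le_right _ _).trans (min_le_right _ _)
  have hκσ : κ < σ := by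
    have : κ ≤ σ / 2 := (min_le_right _ _).trans (min_le_left _ _)
    linarith
  set K := max (8 * L / κ) (2 * L) with hKdef
  have hK : 0 < K := lt_max_of_lt_right (by positivity)
  have hK8 : 8 * L ≤ κ * K := by
    have := le_max_left (8 * L / κ) (2 * L)
    rw [div_le_iff₀ hκ] at this
    linarith
  obtain ⟨Δ, hΔ0, hΔ⟩ : ∃ Δ : ℝ, 0 ≤ Δ ∧ ∀ x y : X, dist x y ≤ Δ :=
    ⟨diam (univ : Set X), diam_nonneg, fun x y =>
      dist_le_diam_of_mem isCompact_univ.isBounded (mem_univ x) (mem_univ y)⟩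
  set A := L * (8 * L * Real.exp 1 / κ) ^ 3 * 2 ^ s with hA
  set S := (1 - Real.exp (-(θ / 2)))⁻¹ with hS
  have hA0 : 0 ≤ A := by positivity
  have hS0 : 0 < S := by
    rw [hS, inv_pos, sub_pos, Real.exp_lt_one_iff]; linarith
  set c := (2 * (A * S ^ 2 + 1))⁻¹ with hc
  have hc0 : 0 < c := by positivity
  set r := min 1 (c ^ (2 / θ) / (Real.exp 1 * K)) with hrdef
  have hr : 0 < r := by positivity
  have hrsmall : A * S ^ 2 * (Real.exp 1 * (K * r)) ^ (θ / 2) ≤ 1 / 2 := by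
    have h1 : Real.exp 1 * (K * r) ≤ c ^ (2 / θ) := by
      have := min_le_right 1 (c ^ (2 / θ) / (Real.exp 1 * K))
      rw [le_div_iff₀ (by positivity)] at this
      linarith
    have h2 : (Real.exp 1 * (K * r)) ^ (θ / 2) ≤ c := by
      calc _ ≤ (c ^ (2 / θ)) ^ (θ / 2) := by gcongr
        _ = c := by
          rw [← Real.rpow_mul hc0.le, div_mul_div_cancel₀ hθ.ne', div_self two_ne_zero,
            Real.rpow_one]
    calc _ ≤ A * S ^ 2 * c := by gcongr
      _ ≤ 1 / 2 := by
        rw [hc, mul_inv_le_iff₀ (by positivity)]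
        have : 0 ≤ A * S ^ 2 := by positivity
        linarith
  have hKr : 0 < K * r := mul_pos hK hr
  have hM : ∀ n, 1 ≤ n → weightedMeasure f D t s θ n (FailSet f D t κ K r) ≤
      ENNReal.ofReal (2 * A * Δ ^ s * (Real.exp 1 * 2) ^ (θ / 2) * S * Real.exp (θ * n)) := by
    intro n hn
    have h1 := h.lowFail_le (s := s) (κ := κ) (K := K) (r := r) (m := n) hθ
      (b := 2 * A * Δ ^ s * Real.exp (θ * n)) (R := 2) (by positivity) two_pos
      fun δ => h.failShell_le hκ hκ4 hs hθ hκθ hKr hΔ hΔ0 hA hS hrsmall hn δ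
    have h2 : FailSet f D t κ K r ∩ {x | t x < 2} = FailSet f D t κ K r :=
      inter_eq_left.mpr fun x _ => lt_of_le_of_lt (h.t_le_one x) one_lt_two
    rw [h2] at h1
    refine h1.trans (ENNReal.ofReal_le_ofReal (le_of_eq ?_))
    ring
  have htail := h.dimH_failTail_le hs hθ (by positivity) hM hσ hγ
  refine ⟨κ, K, r, hκ, hK, hr, min_le_left _ _, hK8, le_max_right _ _, ?_⟩
  have hsub : {x | HasExponents f D α β x ∧ ∀ᶠ n in atTop, ¬ GoodTime f D t κ K r n x} ⊆
      ⋃ m : ℕ, ⋃ N : ℕ, {x | 0 < orbitProd f D m x ∧ f^[m] x ∈ {x | x ∈ FailSet f D t κ K r ∧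
        ∀ n : ℕ, N ≤ n → Real.exp (σ * n) ≤ orbitProd f D n x}} := by
    rintro x ⟨hx, hbad⟩
    have hσα : α - σ = σ := by rw [hσdef]; ring
    have ht : ∀ l, 0 < t (f^[l] x) := h.t_pos hx.1
    have hG : Tendsto (fun l : ℕ => orbitProd f D l x * Real.exp (-κ * l) / t (f^[l] x))
        atTop atTop := by
      have h1 : Tendsto (fun l : ℕ => (σ - κ) * (l : ℝ)) atTop atTop :=
        tendsto_natCast_atTop_atTop.const_mul_atTop (by linarith)
      refine tendsto_atTop_mono' _ ?_ (Real.tendsto_exp_atTop.comp h1)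
      filter_upwards [hx.2 σ hσ] with l hl
      rw [hσα] at hl
      rw [le_div_iff₀ (ht l)]
      calc _ ≤ Real.exp ((σ - κ) * l) * 1 :=
            mul_le_mul_of_nonneg_left (h.t_le_one _) (Real.exp_pos _).le
        _ = Real.exp (σ * l) * Real.exp (-κ * l) := by
            rw [mul_one, ← Real.exp_add]; congr 1; ring
        _ ≤ _ := by gcongr; exact hl.1
    obtain ⟨n₀, hn₀⟩ := eventually_atTop.mp hbad
    obtain ⟨m, hm, hmax⟩ := high_scores hG n₀
    have hfail : f^[m] x ∈ FailSet f D t κ K r := by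
      refine iterate_mem_failSet hx.1 h.t_nonneg (ht m) (fun l hl => ?_) hKr.le
        fun n _ => hn₀ _ (by omega)
      have := hmax l hl
      rw [div_lt_div_iff₀ (ht l) (ht m)] at this
      exact this.le
    obtain ⟨N, hN⟩ := eventually_atTop.mp ((hx.iterate m).2 σ hσ)
    refine mem_iUnion₂.mpr ⟨m, N, hx.1 m, hfail, fun n hn => ?_⟩
    have := (hN n hn).1
    rwa [hσα] at this
  refine (dimH_mono hsub).trans ?_
  rw [dimH_iUnion]
  refine iSup_le fun m => ?_
  rw [dimH_iUnion]
  exact iSup_le fun N => (h.dimH_preimage_le _ m).trans (htail N)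

end TameMap

namespace RSphere

lemma isometry_embed : Isometry embed := Isometry.of_dist_eq fun _ _ => rfl

lemma dist_sq_eq (x y : RSphere) : dist x y ^ 2 =
    ‖(embed x).fst - (embed y).fst‖ ^ 2 + ((embed x).snd - (embed y).snd) ^ 2 := by
  rw [← isometry_embed.dist_eq, dist_eq_norm, WithLp.prod_norm_sq_eq_of_L2]
  simp

lemma embed_ofC_fst (z : ℂ) : (embed (ofC z)).fst = ((2 / (‖z‖ ^ 2 + 1) : ℝ)) • z := rfl
lemma embed_ofC_snd (z : ℂ) : (embed (ofC z)).snd = (‖z‖ ^ 2 - 1) / (‖z‖ ^ 2 + 1) := rfl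
lemma embed_infty_fst : (embed infty).fst = 0 := rfl
lemma embed_infty_snd : (embed infty).snd = 1 := rfl

lemma cases_ofC (x : RSphere) : x = infty ∨ ∃ z, x = ofC z := by
  rcases x with ⟨_ | z⟩
  · exact Or.inl rfl
  · exact Or.inr ⟨z, rfl⟩

/-- The conformal factor of the chordal metric. -/
noncomputable def cfac (z : ℂ) : ℝ := √(1 + ‖z‖ ^ 2)

lemma cfac_sq (z : ℂ) : cfac z ^ 2 = 1 + ‖z‖ ^ 2 := Real.sq_sqrt (by positivity)

lemma one_le_cfac (z : ℂ) : 1 ≤ cfac z := Real.one_le_sqrt.mpr (by nlinarith [sq_nonneg ‖z‖])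

lemma cfac_pos (z : ℂ) : 0 < cfac z := one_pos.trans_le (one_le_cfac z)

lemma dist_ofC (z w : ℂ) : dist (ofC z) (ofC w) = 2 * ‖z - w‖ / (cfac z * cfac w) := by
  have hz := cfac_pos z
  have hw := cfac_pos w
  rw [← sq_eq_sq₀ dist_nonneg (by positivity), dist_sq_eq, embed_ofC_fst, embed_ofC_fst,
    embed_ofC_snd, embed_ofC_snd, div_pow, mul_pow, mul_pow, cfac_sq, cfac_sq]
  rw [← Complex.normSq_eq_norm_sq, ← Complex.normSq_eq_norm_sq, ← Complex.normSq_eq_norm_sq,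
    ← Complex.normSq_eq_norm_sq]
  simp only [Complex.normSq_apply, Complex.sub_re, Complex.sub_im, Complex.real_smul,
    Complex.mul_re, Complex.mul_im, Complex.ofReal_re, Complex.ofReal_im]
  have h1 : z.re * z.re + z.im * z.im + 1 ≠ 0 := by
    exact ne_of_gt (by nlinarith [mul_self_nonneg z.re, mul_self_nonneg z.im])
  have h2 : w.re * w.re + w.im * w.im + 1 ≠ 0 := by
    exact ne_of_gt (by nlinarith [mul_self_nonneg w.re, mul_self_nonneg w.im])
  have h3 : 1 + (z.re * z.re + z.im * z.im) ≠ 0 := by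
    exact ne_of_gt (by nlinarith [mul_self_nonneg z.re, mul_self_nonneg z.im])
  have h4 : 1 + (w.re * w.re + w.im * w.im) ≠ 0 := by
    exact ne_of_gt (by nlinarith [mul_self_nonneg w.re, mul_self_nonneg w.im])
  field_simp
  ring

lemma dist_ofC_infty (z : ℂ) : dist (ofC z) infty = 2 / cfac z := by
  have hz := cfac_pos z
  rw [← sq_eq_sq₀ dist_nonneg (by positivity), dist_sq_eq, embed_ofC_fst, embed_infty_fst,
    embed_ofC_snd, embed_infty_snd, div_pow, cfac_sq, sub_zero, norm_smul, mul_pow,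
    Real.norm_eq_abs, sq_abs]
  have h1 : ‖z‖ ^ 2 + 1 ≠ 0 := by positivity
  have h2 : 1 + ‖z‖ ^ 2 ≠ 0 := by positivity
  field_simp
  ring

lemma range_embed : range embed = sphere 0 1 := by
  ext v
  rw [mem_sphere_zero_iff_norm]
  have hv : ‖v‖ ^ 2 = ‖v.fst‖ ^ 2 + v.snd ^ 2 := by
    rw [WithLp.prod_norm_sq_eq_of_L2]; simp
  constructor
  · rintro ⟨x, rfl⟩
    rw [← sq_eq_sq₀ (norm_nonneg _) zero_le_one, hv]
    rcases cases_ofC x with rfl | ⟨z, rfl⟩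
    · rw [embed_infty_fst, embed_infty_snd]; simp
    · rw [embed_ofC_fst, embed_ofC_snd, norm_smul, mul_pow, Real.norm_eq_abs, sq_abs]
      have h1 : ‖z‖ ^ 2 + 1 ≠ 0 := by positivity
      field_simp
      ring
  · intro h1
    rw [h1, one_pow] at hv
    by_cases h : v.snd = 1
    · refine ⟨infty, ?_⟩
      have h2 : v.fst = 0 := by
        rw [h] at hv
        have : ‖v.fst‖ ^ 2 = 0 := by linarith
        simpa using this
      apply WithLp.ofLp_injective
      exact Prod.ext (by rw [embed_infty_fst.symm] at h2; exact h2.symm) h.symm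
    · have hlt : v.snd < 1 := lt_of_le_of_ne (by nlinarith [sq_nonneg ‖v.fst‖]) h
      have h0 : 0 < 1 - v.snd := by linarith
      set z : ℂ := ((1 - v.snd)⁻¹ : ℝ) • v.fst with hz
      have hz2 : ‖z‖ ^ 2 = (1 + v.snd) / (1 - v.snd) := by
        rw [hz, norm_smul, mul_pow, Real.norm_eq_abs, sq_abs]
        have : ‖v.fst‖ ^ 2 = (1 - v.snd) * (1 + v.snd) := by linarith
        rw [this]; field_simp
      refine ⟨ofC z, WithLp.ofLp_injective _ (Prod.ext ?_ ?_)⟩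
      · change ((2 / (‖z‖ ^ 2 + 1) : ℝ)) • z = v.fst
        rw [hz2, hz, smul_smul]
        have : 2 / ((1 + v.snd) / (1 - v.snd) + 1) * (1 - v.snd)⁻¹ = 1 := by
          have h3 : (1 + v.snd) / (1 - v.snd) + 1 = 2 / (1 - v.snd) := by field_simp; ring
          rw [h3]; field_simp
        rw [this, one_smul]
      · change (‖z‖ ^ 2 - 1) / (‖z‖ ^ 2 + 1) = v.snd
        rw [hz2]
        field_simp
        ring

lemma finrank_ambient : Module.finrank ℝ (WithLp 2 (ℂ × ℝ)) = 3 := by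
  rw [(WithLp.linearEquiv 2 ℝ (ℂ × ℝ)).finrank_eq, Module.finrank_prod, Complex.finrank_real_complex,
    Module.finrank_self]

instance : CompactSpace RSphere := by
  refine ⟨?_⟩
  rw [isometry_embed.isUniformInducing.isInducing.isCompact_iff, image_univ, range_embed]
  have := FiniteDimensional.proper ℝ (WithLp 2 (ℂ × ℝ))
  exact isCompact_sphere _ _

instance : PreconnectedSpace RSphere := by
  refine ⟨?_⟩
  rw [← isometry_embed.isUniformInducing.isInducing.isPreconnected_image, image_univ, range_embed]
  refine isPreconnected_sphere ?_ _ _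
  rw [← Module.finrank_eq_rank, finrank_ambient]
  norm_num

lemma exists_dist_eq_two (x : RSphere) : ∃ y, dist y x = 2 := by
  have hx : embed x ∈ sphere (0 : WithLp 2 (ℂ × ℝ)) 1 := range_embed ▸ mem_range_self x
  have h1 : -embed x ∈ range embed := by
    rw [range_embed, mem_sphere_zero_iff_norm, norm_neg]; simpa using hx
  obtain ⟨y, hy⟩ := h1
  refine ⟨y, ?_⟩
  rw [← isometry_embed.dist_eq, hy, dist_eq_norm, ← neg_add', norm_neg, ← two_smul ℝ, norm_smul]
  simp [mem_sphere_zero_iff_norm.mp hx]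

lemma dist_le_two (x y : RSphere) : dist x y ≤ 2 := by
  have h : ∀ x, ‖embed x‖ = 1 := fun x =>
    mem_sphere_zero_iff_norm.mp (range_embed ▸ mem_range_self x)
  rw [← isometry_embed.dist_eq, dist_eq_norm]
  refine (norm_sub_le _ _).trans ?_
  rw [h, h]; norm_num

lemma exists_dist_eq (o : RSphere) {s : ℝ} (hs0 : 0 ≤ s) (hs : s ≤ 2) : ∃ z, dist z o = s := by
  obtain ⟨y, hy⟩ := exists_dist_eq_two o
  have := mem_range_of_exists_le_of_exists_ge (f := fun z => dist z o) (c := s)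
    (continuous_id.dist continuous_const) ⟨o, by simpa using hs0⟩ ⟨y, by simpa [hy] using hs⟩
  exact this

instance (x : RSphere) : (𝓝[≠] x).NeBot := by
  rw [← mem_closure_iff_nhdsWithin_neBot, Metric.mem_closure_iff]
  intro ε hε
  obtain ⟨z, hz⟩ := exists_dist_eq x (s := min (ε / 2) 2) (by positivity) (min_le_right _ _)
  refine ⟨z, fun hzx => ?_, ?_⟩
  · rw [mem_singleton_iff] at hzx
    rw [hzx, dist_self] at hz
    have : 0 < min (ε / 2) 2 := by positivity
    linarith
  · rw [dist_comm, hz]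
    exact (min_le_left _ _).trans_lt (by linarith)

lemma embed_inv (x : RSphere) : (embed (inv x)).fst = star (embed x).fst ∧
    (embed (inv x)).snd = -(embed x).snd := by
  rcases cases_ofC x with rfl | ⟨z, rfl⟩
  · change (embed (ofC 0)).fst = _ ∧ (embed (ofC 0)).snd = _
    rw [embed_ofC_fst, embed_ofC_snd, embed_infty_fst, embed_infty_snd]; simp
  by_cases hz : z = 0
  · have : inv (ofC z) = infty := by simp [inv, elim, ofC, hz]
    rw [this, embed_ofC_fst, embed_ofC_snd, embed_infty_fst, embed_infty_snd]; simp [hz]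
  have : inv (ofC z) = ofC z⁻¹ := by simp [inv, elim, ofC, hz]
  have hn : ‖z‖ ≠ 0 := norm_ne_zero_iff.mpr hz
  rw [this, embed_ofC_fst, embed_ofC_snd, embed_ofC_fst, embed_ofC_snd, norm_inv]
  constructor
  · rw [star_smul, Complex.inv_def, Complex.normSq_eq_norm_sq, star_trivial]
    rw [Complex.real_smul, Complex.real_smul, Complex.star_def]
    push_cast
    have h1 : (‖z‖ : ℂ) ≠ 0 := by exact_mod_cast hn
    have h2 : (‖z‖ : ℂ) ^ 2 + 1 ≠ 0 := by
      have : (‖z‖ : ℝ) ^ 2 + 1 ≠ 0 := by positivity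
      exact_mod_cast this
    have h3 : 1 + (‖z‖ : ℂ) ^ 2 ≠ 0 := by rwa [add_comm]
    field_simp
    ring
  · have h1 : ‖z‖ ^ 2 + 1 ≠ 0 := by positivity
    have h2 : 1 + ‖z‖ ^ 2 ≠ 0 := by positivity
    field_simp
    ring

lemma isometry_inv : Isometry inv := Isometry.of_dist_eq fun x y => by
  rw [← sq_eq_sq₀ dist_nonneg dist_nonneg, dist_sq_eq, dist_sq_eq, (embed_inv x).1, (embed_inv y).1,
    (embed_inv x).2, (embed_inv y).2, ← star_sub, norm_star]
  ring

lemma inv_inv (x : RSphere) : inv (inv x) = x := by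
  rcases cases_ofC x with rfl | ⟨z, rfl⟩
  · simp [inv, elim, ofC, infty]
  · by_cases hz : z = 0 <;> simp [inv, elim, ofC, infty, hz]

end RSphere

/-- The number of separated points in a ball of a normed space. -/
lemma card_le_of_separated_closedBall {E : Type*} [NormedAddCommGroup E] [NormedSpace ℝ E]
    [FiniteDimensional ℝ E] (s : Finset E) (c : E) {R ρ : ℝ} (hρ : 0 < ρ) (hρR : ρ ≤ R)
    (hs : ∀ x ∈ s, dist x c ≤ R) (hsep : ∀ x ∈ s, ∀ y ∈ s, x ≠ y → ρ < dist x y) :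
    (s.card : ℝ) ≤ (3 * (R / ρ)) ^ Module.finrank ℝ E := by
  borelize E
  let μ : Measure E := Measure.addHaar
  have hR : 0 < R := hρ.trans_le hρR
  have hdisj : (s : Set E).PairwiseDisjoint fun x => ball x (ρ / 2) := fun x hx y hy hxy =>
    ball_disjoint_ball (by have := hsep x hx y hy hxy; linarith)
  have hsub : ⋃ x ∈ s, ball x (ρ / 2) ⊆ ball c (3 / 2 * R) := iUnion₂_subset fun x hx => by
    rcases hρR.lt_or_eq with h | h
    · exact ball_subset_ball' (by have := hs x hx; linarith)
    · exact ball_subset_ball' (by have := hs x hx; linarith)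
  have h1 : (s.card : ℝ≥0∞) * ENNReal.ofReal ((ρ / 2) ^ Module.finrank ℝ E) * μ (ball 0 1) ≤
      ENNReal.ofReal ((3 / 2 * R) ^ Module.finrank ℝ E) * μ (ball 0 1) := by
    calc _ = μ (⋃ x ∈ s, ball x (ρ / 2)) := by
          rw [measure_biUnion_finset hdisj fun _ _ => measurableSet_ball]
          simp only [μ.addHaar_ball_of_pos _ (half_pos hρ), Finset.sum_const, nsmul_eq_mul, mul_assoc]
      _ ≤ μ (ball c (3 / 2 * R)) := measure_mono hsub
      _ = _ := by rw [μ.addHaar_ball_of_pos _ (by positivity)]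
  have h2 : (s.card : ℝ≥0∞) * ENNReal.ofReal ((ρ / 2) ^ Module.finrank ℝ E) ≤
      ENNReal.ofReal ((3 / 2 * R) ^ Module.finrank ℝ E) :=
    (ENNReal.mul_le_mul_iff_left (measure_ball_pos _ _ zero_lt_one).ne' measure_ball_lt_top.ne).1 h1
  have h3 := ENNReal.toReal_le_of_le_ofReal (by positivity) h2
  rw [ENNReal.toReal_mul, ENNReal.toReal_natCast, ENNReal.toReal_ofReal (by positivity),
    ← le_div_iff₀ (by positivity), ← div_pow] at h3
  refine h3.trans (le_of_eq ?_)
  congr 1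
  field_simp

namespace RSphere

lemma card_le_of_separated (s : Finset RSphere) (c : RSphere) {R ρ : ℝ} (hρ : 0 < ρ) (hρR : ρ ≤ R)
    (hs : ∀ x ∈ s, dist x c ≤ R) (hsep : ∀ x ∈ s, ∀ y ∈ s, x ≠ y → ρ < dist x y) :
    (s.card : ℝ) ≤ 27 * (R / ρ) ^ 3 := by
  have h1 := card_le_of_separated_closedBall (s.map ⟨embed, embed_injective⟩) (embed c) hρ hρR
    (by simpa [isometry_embed.dist_eq] using hs)
    (by simpa [isometry_embed.dist_eq, embed_injective.eq_iff] using hsep)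
  rw [finrank_ambient, Finset.card_map, mul_pow] at h1
  norm_num at h1 ⊢
  exact h1

/-- The number of separated points near a finite set, or anywhere at large scale. -/
lemma card_le_near_finite (C : Finset RSphere) (s : Finset RSphere) {R ρ : ℝ} (hρ : 0 < ρ)
    (hρR : ρ ≤ R) (hs : R < 1 → ∀ x ∈ s, ∃ c ∈ C, dist x c ≤ R)
    (hsep : ∀ x ∈ s, ∀ y ∈ s, x ≠ y → ρ < dist x y) :
    (s.card : ℝ) ≤ (216 + 27 * C.card) * (R / ρ) ^ 3 := by
  classical
  have hRρ : 0 ≤ (R / ρ) ^ 3 := by have := hρ.trans_le hρR; positivity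
  rcases lt_or_ge R 1 with hR | hR
  · have hsub : s ⊆ C.biUnion fun c => s.filter fun x => dist x c ≤ R := fun x hx => by
      obtain ⟨c, hc, hxc⟩ := hs hR x hx
      exact Finset.mem_biUnion.mpr ⟨c, hc, Finset.mem_filter.mpr ⟨hx, hxc⟩⟩
    have h1 : ∀ c ∈ C, ((s.filter fun x => dist x c ≤ R).card : ℝ) ≤ 27 * (R / ρ) ^ 3 :=
      fun c _ => card_le_of_separated _ c hρ hρR (fun x hx => (Finset.mem_filter.mp hx).2)
        fun x hx y hy => hsep x (Finset.mem_filter.mp hx).1 y (Finset.mem_filter.mp hy).1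
    calc (s.card : ℝ) ≤ ∑ c ∈ C, ((s.filter fun x => dist x c ≤ R).card : ℝ) := by
          exact_mod_cast (Finset.card_le_card hsub).trans Finset.card_biUnion_le
      _ ≤ ∑ c ∈ C, 27 * (R / ρ) ^ 3 := Finset.sum_le_sum h1
      _ = C.card * (27 * (R / ρ) ^ 3) := by rw [Finset.sum_const, nsmul_eq_mul]
      _ ≤ _ := by linarith
  · have h1 := card_le_of_separated s infty (R := 2 * R) hρ (by linarith)
      (fun x _ => (dist_le_two _ _).trans (by linarith)) hsep
    have h2 : 27 * (2 * R / ρ) ^ 3 = 216 * (R / ρ) ^ 3 := by ring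
    rw [h2] at h1
    have h3 : 0 ≤ (C.card : ℝ) * (R / ρ) ^ 3 := by positivity
    linarith

end RSphere

lemma norm_pow_sub_pow_le_of_norm_sub_le {a b : ℂ} {τ : ℝ} (hτ : τ ≤ 1)
    (h : ‖b - a‖ ≤ τ * ‖a‖) (k : ℕ) : ‖b ^ k - a ^ k‖ ≤ (2 ^ k - 1) * τ * ‖a ^ k‖ := by
  induction k with
  | zero => simp
  | succ k ih =>
    have h1 : ‖b‖ ≤ 2 * ‖a‖ := by
      calc ‖b‖ = ‖a + (b - a)‖ := by congr 1; ring
        _ ≤ ‖a‖ + τ * ‖a‖ := (norm_add_le _ _).trans (by linarith)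
        _ ≤ _ := by nlinarith [norm_nonneg a]
    have h2 : ‖b ^ (k + 1) - a ^ (k + 1)‖ ≤ ‖b ^ k - a ^ k‖ * ‖b‖ + ‖a ^ k‖ * ‖b - a‖ := by
      rw [← norm_mul, ← norm_mul]
      refine le_trans (le_of_eq ?_) (norm_add_le _ _)
      congr 1; ring
    calc ‖b ^ (k + 1) - a ^ (k + 1)‖ ≤ ‖b ^ k - a ^ k‖ * ‖b‖ + ‖a ^ k‖ * ‖b - a‖ := h2
      _ ≤ (2 ^ k - 1) * τ * ‖a ^ k‖ * (2 * ‖a‖) + ‖a ^ k‖ * (τ * ‖a‖) := by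
        gcongr
        exact (norm_nonneg _).trans ih
      _ = _ := by rw [pow_succ a, norm_mul]; ring

/-- Quantitative local control of a nonconstant analytic function. -/
structure LocalBounds (φ : ℂ → ℂ) (z₀ : ℂ) (R M : ℝ) : Prop where
  pos : 0 < R
  one_le : 1 ≤ M
  differentiableAt : ∀ z ∈ ball z₀ R, DifferentiableAt ℂ φ z
  norm_le : ∀ z ∈ ball z₀ R, ‖z‖ ≤ M
  norm_map_le : ∀ z ∈ ball z₀ R, ‖φ z‖ ≤ M
  norm_deriv_le : ∀ z ∈ ball z₀ R, ‖deriv φ z‖ ≤ M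
  deriv_ne_zero : ∀ z ∈ ball z₀ R, z ≠ z₀ → deriv φ z ≠ 0
  lip : ∀ z ∈ ball z₀ R, ∀ w ∈ ball z₀ R, ‖φ w - φ z‖ ≤ M * ‖w - z‖
  deriv_lip : ∀ z ∈ ball z₀ R, ∀ w ∈ ball z₀ R, ‖deriv φ w - deriv φ z‖ ≤ M * ‖w - z‖
  deriv_distort : ∀ z ∈ ball z₀ R, ∀ w ∈ ball z₀ R, ∀ τ, 0 ≤ τ → τ ≤ 1 →
    ‖w - z‖ ≤ τ * (if deriv φ z₀ = 0 then ‖z - z₀‖ else 1) →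
    ‖deriv φ w - deriv φ z‖ ≤ M * τ * ‖deriv φ z‖

lemma LocalBounds.mono {φ : ℂ → ℂ} {z₀ : ℂ} {R R' M : ℝ} (h : LocalBounds φ z₀ R M)
    (hR' : 0 < R') (hR : R' ≤ R) : LocalBounds φ z₀ R' M := by
  have hs : ball z₀ R' ⊆ ball z₀ R := ball_subset_ball hR
  exact ⟨hR', h.one_le, fun z hz => h.differentiableAt z (hs hz), fun z hz => h.norm_le z (hs hz),
    fun z hz => h.norm_map_le z (hs hz), fun z hz => h.norm_deriv_le z (hs hz),
    fun z hz => h.deriv_ne_zero z (hs hz), fun z hz w hw => h.lip z (hs hz) w (hs hw),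
    fun z hz w hw => h.deriv_lip z (hs hz) w (hs hw),
    fun z hz w hw => h.deriv_distort z (hs hz) w (hs hw)⟩

lemma AnalyticAt.exists_localBounds {φ : ℂ → ℂ} {z₀ : ℂ} (hφ : AnalyticAt ℂ φ z₀)
    (hnc : ¬∀ᶠ z in 𝓝 z₀, deriv φ z = 0) : ∃ R M : ℝ, LocalBounds φ z₀ R M := by
  obtain ⟨k, g, hg, hg0, hgeq⟩ := hφ.deriv.exists_eventuallyEq_pow_smul_nonzero_iff.mpr hnc
  obtain ⟨K₁, s₁, hs₁, hK₁⟩ := (hφ.contDiffAt (n := 1)).exists_lipschitzOnWith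
  obtain ⟨K₂, s₂, hs₂, hK₂⟩ := (hφ.deriv.contDiffAt (n := 1)).exists_lipschitzOnWith
  obtain ⟨K₃, s₃, hs₃, hK₃⟩ := (hg.contDiffAt (n := 1)).exists_lipschitzOnWith
  have hd : ∀ᶠ z in 𝓝 z₀, DifferentiableAt ℂ φ z :=
    hφ.eventually_analyticAt.mono fun z hz => hz.differentiableAt
  have hb₁ : ∀ᶠ z in 𝓝 z₀, ‖φ z‖ < ‖φ z₀‖ + 1 :=
    (hφ.continuousAt.norm).eventually_lt_const (lt_add_one _)
  have hb₂ : ∀ᶠ z in 𝓝 z₀, ‖deriv φ z‖ < ‖deriv φ z₀‖ + 1 :=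
    (hφ.deriv.continuousAt.norm).eventually_lt_const (lt_add_one _)
  have hb₃ : ∀ᶠ z in 𝓝 z₀, ‖g z₀‖ / 2 < ‖g z‖ :=
    (hg.continuousAt.norm).eventually_const_lt (half_lt_self (norm_pos_iff.mpr hg0))
  have hb₄ : ∀ᶠ z in 𝓝 z₀, ‖z‖ < ‖z₀‖ + 1 :=
    (continuousAt_id.norm).eventually_lt_const (lt_add_one _)
  obtain ⟨R, hR, H⟩ := Metric.eventually_nhds_iff_ball.mp
    (hgeq.and (hd.and (hb₁.and (hb₂.and (hb₃.and (hb₄.and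
      ((eventually_mem_set.mpr hs₁).and ((eventually_mem_set.mpr hs₂).and
        (eventually_mem_set.mpr hs₃)))))))))
  have hgp : 0 < ‖g z₀‖ := norm_pos_iff.mpr hg0
  set A : ℝ := K₃ / (‖g z₀‖ / 2) with hA
  have hA0 : 0 ≤ A := by positivity
  set M : ℝ := 1 + (‖φ z₀‖ + 1) + (‖deriv φ z₀‖ + 1) + (‖z₀‖ + 1) + K₁ + K₂ + 2 ^ k +
    (2 ^ k + 1) * (A * (R + 1)) with hM
  have hp1 := norm_nonneg (φ z₀)
  have hp2 := norm_nonneg (deriv φ z₀)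
  have hp3 := norm_nonneg z₀
  have hp4 := K₁.coe_nonneg
  have hp5 := K₂.coe_nonneg
  have hp6 : (0 : ℝ) < 2 ^ k := by positivity
  have hp7 : 0 ≤ (2 ^ k + 1) * (A * (R + 1)) := by positivity
  refine ⟨R, M, hR, by linarith, fun z hz => (H z hz).2.1,
    fun z hz => by have := (H z hz).2.2.2.2.2.1; linarith,
    fun z hz => by have := (H z hz).2.2.1; linarith,
    fun z hz => by have := (H z hz).2.2.2.1; linarith, fun z hz hne => ?_,
    fun z hz w hw => ?_, fun z hz w hw => ?_, fun z hz w hw τ hτ0 hτ1 hwz => ?_⟩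
  · rw [(H z hz).1]
    exact smul_ne_zero (pow_ne_zero _ (sub_ne_zero.mpr hne))
      (norm_pos_iff.mp ((half_pos hgp).trans (H z hz).2.2.2.2.1))
  · refine (hK₁.norm_sub_le (H w hw).2.2.2.2.2.2.1 (H z hz).2.2.2.2.2.2.1).trans ?_
    gcongr; linarith
  · refine (hK₂.norm_sub_le (H w hw).2.2.2.2.2.2.2.1 (H z hz).2.2.2.2.2.2.2.1).trans ?_
    gcongr; linarith
  · obtain ⟨h1, -, -, -, h5, -, -, -, h9⟩ := H z hz
    obtain ⟨e1, -, -, -, -, -, -, -, e9⟩ := H w hw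
    have hk : k = 0 ↔ deriv φ z₀ ≠ 0 := by
      have := hgeq.self_of_nhds
      rw [sub_self, smul_eq_mul] at this
      rw [this]
      rcases Nat.eq_zero_or_pos k with h | h
      · simp [h, hg0]
      · simp [h.ne']
    have hs : (if deriv φ z₀ = 0 then ‖z - z₀‖ else 1) ≤ R + 1 := by
      split_ifs
      · rw [mem_ball_iff_norm] at hz; linarith
      · linarith
    have hgg : ‖g w - g z‖ ≤ A * (R + 1) * τ * ‖g z‖ := by
      calc ‖g w - g z‖ ≤ K₃ * ‖w - z‖ := hK₃.norm_sub_le e9 h9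
        _ ≤ K₃ * (τ * (R + 1)) := by
          gcongr; exact hwz.trans (by gcongr)
        _ = A * (R + 1) * τ * (‖g z₀‖ / 2) := by rw [hA]; field_simp
        _ ≤ _ := by gcongr
    have hpow : ‖(w - z₀) ^ k - (z - z₀) ^ k‖ ≤ 2 ^ k * τ * ‖(z - z₀) ^ k‖ := by
      by_cases h0 : k = 0
      · subst h0; simp; exact hτ0
      · refine (norm_pow_sub_pow_le_of_norm_sub_le hτ1 ?_ k).trans (by gcongr; linarith)
        rw [if_pos (by_contra fun h => h0 (hk.mpr h))] at hwz
        simpa using hwz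
    have hgw : ‖(w - z₀) ^ k‖ ≤ (2 ^ k + 1) * ‖(z - z₀) ^ k‖ := by
      calc ‖(w - z₀) ^ k‖ = ‖(z - z₀) ^ k + ((w - z₀) ^ k - (z - z₀) ^ k)‖ := by congr 1; ring
        _ ≤ ‖(z - z₀) ^ k‖ + 2 ^ k * τ * ‖(z - z₀) ^ k‖ := (norm_add_le _ _).trans (by gcongr)
        _ ≤ ‖(z - z₀) ^ k‖ + 2 ^ k * 1 * ‖(z - z₀) ^ k‖ := by gcongr
        _ = _ := by ring
    rw [e1, h1, smul_eq_mul, smul_eq_mul, norm_mul]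
    calc ‖(w - z₀) ^ k * g w - (z - z₀) ^ k * g z‖
        = ‖((w - z₀) ^ k - (z - z₀) ^ k) * g z + (w - z₀) ^ k * (g w - g z)‖ := by congr 1; ring
      _ ≤ ‖(w - z₀) ^ k - (z - z₀) ^ k‖ * ‖g z‖ + ‖(w - z₀) ^ k‖ * ‖g w - g z‖ := by
        rw [← norm_mul, ← norm_mul]; exact norm_add_le _ _
      _ ≤ 2 ^ k * τ * ‖(z - z₀) ^ k‖ * ‖g z‖ +
          (2 ^ k + 1) * ‖(z - z₀) ^ k‖ * (A * (R + 1) * τ * ‖g z‖) := by gcongr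
      _ = (2 ^ k + (2 ^ k + 1) * (A * (R + 1))) * τ * (‖(z - z₀) ^ k‖ * ‖g z‖) := by ring
      _ ≤ _ := by gcongr; linarith

lemma LocalBounds.norm_image_sub_sub_le {φ : ℂ → ℂ} {z₀ : ℂ} {R M : ℝ} (h : LocalBounds φ z₀ R M)
    {z : ℂ} {σ δ : ℝ} (hδ : ∀ w ∈ ball z₀ R, ‖w - z‖ ≤ σ → ‖deriv φ w - deriv φ z‖ ≤ δ)
    {v w : ℂ} (hv : v ∈ ball z₀ R) (hw : w ∈ ball z₀ R) (hvz : ‖v - z‖ ≤ σ) (hwz : ‖w - z‖ ≤ σ) :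
    ‖φ w - φ v - deriv φ z * (w - v)‖ ≤ δ * ‖w - v‖ := by
  have hconv : Convex ℝ (ball z₀ R ∩ closedBall z σ) := (convex_ball _ _).inter (convex_closedBall _ _)
  have := hconv.norm_image_sub_le_of_norm_hasDerivWithin_le (𝕜 := ℂ) (C := δ)
    (f := fun ξ => φ ξ - deriv φ z * ξ) (f' := fun ξ => deriv φ ξ - deriv φ z * 1)
    (fun ξ hξ => ((h.differentiableAt ξ hξ.1).hasDerivAt.sub
      ((hasDerivAt_id ξ).const_mul _)).hasDerivWithinAt)
    (fun ξ hξ => by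
      rw [mul_one]; exact hδ ξ hξ.1 (by simpa [dist_eq_norm] using hξ.2))
    (x := v) (y := w) ⟨hv, by simpa [dist_eq_norm] using hvz⟩
    ⟨hw, by simpa [dist_eq_norm] using hwz⟩
  refine le_trans (le_of_eq ?_) this
  congr 1; ring

/-- The scale at which a map with derivative `D` has bounded distortion at `x` near `x₀`. -/
noncomputable def critScale {X : Type*} [MetricSpace X] (D : X → ℝ) (x₀ x : X) : ℝ :=
  if D x₀ = 0 then dist x x₀ else 1

/-- The local version of `TameMap` near `x₀`. -/
structure TameNear {X : Type*} [MetricSpace X] (f : X → X) (D : X → ℝ) (x₀ : X) (r L : ℝ) :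
    Prop where
  pos : 0 < r
  one_le : 1 ≤ L
  D_nonneg : ∀ x ∈ ball x₀ r, 0 ≤ D x
  D_pos : ∀ x ∈ ball x₀ r, x ≠ x₀ → 0 < D x
  D_le : ∀ x ∈ ball x₀ r, D x ≤ L
  approx : ∀ x ∈ ball x₀ r, ∀ u ∈ ball x₀ r, ∀ v ∈ ball x₀ r, ∀ ρ, dist u x ≤ ρ → dist v x ≤ ρ →
    |dist (f u) (f v) - D x * dist u v| ≤ L * ρ * dist u v
  D_lip : ∀ x ∈ ball x₀ r, ∀ u ∈ ball x₀ r, |D u - D x| ≤ L * dist u x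
  distort : ∀ x ∈ ball x₀ r, ∀ u ∈ ball x₀ r, ∀ v ∈ ball x₀ r, ∀ τ, 0 ≤ τ → L * τ ≤ 1 →
    dist u x ≤ τ * critScale D x₀ x → dist v x ≤ τ * critScale D x₀ x →
    |dist (f u) (f v) - D x * dist u v| ≤ L * τ * D x * dist u v
  D_distort : ∀ x ∈ ball x₀ r, ∀ u ∈ ball x₀ r, ∀ τ, 0 ≤ τ → L * τ ≤ 1 →
    dist u x ≤ τ * critScale D x₀ x → |D u - D x| ≤ L * τ * D x
  onto : ∀ x ∈ ball x₀ (r / 2), ∀ y, 0 < D x → L * dist y (f x) ≤ D x * critScale D x₀ x →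
    ∃ u ∈ ball x₀ r, f u = y ∧ D x * dist u x ≤ L * dist y (f x)

namespace RSphere

lemma cfac_le (z : ℂ) : cfac z ≤ 1 + ‖z‖ := by
  rw [← sq_le_sq₀ (cfac_pos z).le (by positivity), cfac_sq]
  nlinarith [norm_nonneg z]

lemma abs_cfac_sub_le (z w : ℂ) : |cfac w - cfac z| ≤ ‖w - z‖ := by
  have h1 := cfac_sq z
  have h2 := cfac_sq w
  have h3 := one_le_cfac z
  have h4 := one_le_cfac w
  have h5 : |‖w‖ - ‖z‖| ≤ ‖w - z‖ := abs_norm_sub_norm_le w z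
  refine le_trans ?_ h5
  have h6 : (cfac w - cfac z) * (cfac w + cfac z) = (‖w‖ - ‖z‖) * (‖w‖ + ‖z‖) := by nlinarith
  have h7 : ‖w‖ ≤ cfac w := by
    rw [← sq_le_sq₀ (norm_nonneg _) (by linarith), h2]; linarith
  have h8 : ‖z‖ ≤ cfac z := by
    rw [← sq_le_sq₀ (norm_nonneg _) (by linarith), h1]; linarith
  have h9 : |cfac w - cfac z| * (cfac w + cfac z) = |‖w‖ - ‖z‖| * (‖w‖ + ‖z‖) := by
    have := congrArg abs h6
    rwa [abs_mul, abs_mul, abs_of_nonneg (show 0 ≤ cfac w + cfac z by linarith),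
      abs_of_nonneg (show 0 ≤ ‖w‖ + ‖z‖ by positivity)] at this
  have h10 : |‖w‖ - ‖z‖| * (‖w‖ + ‖z‖) ≤ |‖w‖ - ‖z‖| * (cfac w + cfac z) := by gcongr
  rw [← h9] at h10
  exact le_of_mul_le_mul_right h10 (by linarith)

lemma exists_ofC_of_dist_le {z : ℂ} {N : ℝ} (hN : 0 < N) (hz : cfac z ≤ N) {y : RSphere}
    (hy : dist y (ofC z) ≤ 1 / N) :
    ∃ w, y = ofC w ∧ cfac w ≤ 2 * N ∧ ‖w - z‖ ≤ N ^ 2 * dist y (ofC z) := by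
  have h1 : 2 / N ≤ dist (ofC z) infty := by rw [dist_ofC_infty]; have := cfac_pos z; gcongr
  have h2 : 1 / N ≤ dist y infty := by
    have := dist_triangle (ofC z) y infty
    rw [dist_comm (ofC z) y] at this
    have e : 2 / N = 1 / N + 1 / N := by ring
    linarith
  rcases cases_ofC y with rfl | ⟨w, rfl⟩
  · rw [dist_self] at h2
    have : 0 < 1 / N := by positivity
    linarith
  · rw [dist_ofC_infty] at h2
    have hw := cfac_pos w
    have hzp := cfac_pos z
    have h3 : cfac w ≤ 2 * N := by rwa [div_le_div_iff₀ hN hw, one_mul] at h2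
    refine ⟨w, rfl, h3, ?_⟩
    have h4 : ‖w - z‖ = cfac w * cfac z / 2 * dist (ofC w) (ofC z) := by
      rw [dist_ofC]; field_simp
    rw [h4]
    gcongr
    nlinarith

lemma dist_ofC_le (z w : ℂ) : dist (ofC z) (ofC w) ≤ 2 * ‖z - w‖ := by
  rw [dist_ofC]
  exact div_le_self (by positivity) (one_le_mul_of_one_le_of_one_le (one_le_cfac z) (one_le_cfac w))

/-- The spherical derivative of a planar map. -/
noncomputable def planarSphDeriv (φ : ℂ → ℂ) (x : RSphere) : ℝ :=
  x.elim 0 fun z => ‖deriv φ z‖ * (cfac z / cfac (φ z)) ^ 2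

lemma planarSphDeriv_ofC (φ : ℂ → ℂ) (z : ℂ) :
    planarSphDeriv φ (ofC z) = ‖deriv φ z‖ * (cfac z / cfac (φ z)) ^ 2 := rfl

lemma planarSphDeriv_eq_zero_iff (φ : ℂ → ℂ) (z : ℂ) :
    planarSphDeriv φ (ofC z) = 0 ↔ deriv φ z = 0 := by
  have h1 := cfac_pos z
  have h2 := cfac_pos (φ z)
  rw [planarSphDeriv_ofC, mul_eq_zero, norm_eq_zero, or_iff_left (by positivity)]

end RSphere

namespace LocalBounds
open RSphere
variable {φ : ℂ → ℂ} {z₀ : ℂ} {R M : ℝ}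

lemma cfac_le (h : LocalBounds φ z₀ R M) {z : ℂ} (hz : z ∈ ball z₀ R) : cfac z ≤ M + 1 :=
  (RSphere.cfac_le z).trans (by linarith [h.norm_le z hz])

lemma cfac_map_le (h : LocalBounds φ z₀ R M) {z : ℂ} (hz : z ∈ ball z₀ R) : cfac (φ z) ≤ M + 1 :=
  (RSphere.cfac_le _).trans (by linarith [h.norm_map_le z hz])

lemma cfac_div_le (h : LocalBounds φ z₀ R M) {z : ℂ} (hz : z ∈ ball z₀ R) :
    cfac z / cfac (φ z) ≤ M + 1 :=
  (div_le_self (cfac_pos z).le (one_le_cfac _)).trans (h.cfac_le hz)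

lemma abs_cfac_div_sub_le (h : LocalBounds φ z₀ R M) {z w : ℂ} (hz : z ∈ ball z₀ R)
    (hw : w ∈ ball z₀ R) :
    |cfac w / cfac (φ w) - cfac z / cfac (φ z)| ≤ (M + 1) ^ 2 * ‖w - z‖ := by
  have p1 := cfac_pos (φ z)
  have p2 := cfac_pos (φ w)
  have p3 := cfac_pos z
  have hM := h.one_le
  have h1 : |cfac (φ w) - cfac (φ z)| ≤ M * ‖w - z‖ :=
    (abs_cfac_sub_le _ _).trans (h.lip z hz w hw)
  have e : cfac w / cfac (φ w) - cfac z / cfac (φ z) =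
      ((cfac w - cfac z) * cfac (φ z) - cfac z * (cfac (φ w) - cfac (φ z))) /
        (cfac (φ w) * cfac (φ z)) := by field_simp; ring
  rw [e, abs_div, abs_of_pos (mul_pos p2 p1)]
  refine (div_le_self (abs_nonneg _)
    (one_le_mul_of_one_le_of_one_le (one_le_cfac _) (one_le_cfac _))).trans ?_
  refine (abs_sub _ _).trans ?_
  rw [abs_mul, abs_mul, abs_of_pos p1, abs_of_pos p3]
  calc _ ≤ ‖w - z‖ * (M + 1) + (M + 1) * (M * ‖w - z‖) := by
        gcongr
        · exact abs_cfac_sub_le _ _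
        · exact h.cfac_map_le hz
        · exact h.cfac_le hz
    _ = _ := by ring

lemma abs_cfac_div_mul_sub_le (h : LocalBounds φ z₀ R M) {z v w : ℂ} {σ : ℝ} (hz : z ∈ ball z₀ R)
    (hv : v ∈ ball z₀ R) (hw : w ∈ ball z₀ R) (hvz : ‖v - z‖ ≤ σ) (hwz : ‖w - z‖ ≤ σ) :
    |cfac w / cfac (φ w) * (cfac v / cfac (φ v)) - (cfac z / cfac (φ z)) ^ 2| ≤
      2 * (M + 1) ^ 3 * σ := by
  have hM := h.one_le
  have h1 := h.abs_cfac_div_sub_le hz hv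
  have h2 := h.abs_cfac_div_sub_le hz hw
  have h3 := h.cfac_div_le hz
  have h4 := h.cfac_div_le hv
  have p1 : 0 < cfac z / cfac (φ z) := div_pos (cfac_pos _) (cfac_pos _)
  have p2 : 0 < cfac v / cfac (φ v) := div_pos (cfac_pos _) (cfac_pos _)
  set a := cfac w / cfac (φ w)
  set b := cfac v / cfac (φ v)
  set c := cfac z / cfac (φ z)
  have e : a * b - c ^ 2 = (a - c) * b + c * (b - c) := by ring
  rw [e]
  refine (abs_add_le _ _).trans ?_
  rw [abs_mul, abs_mul, abs_of_pos p1, abs_of_pos p2]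
  have hσ := (norm_nonneg _).trans hvz
  calc _ ≤ (M + 1) ^ 2 * ‖w - z‖ * (M + 1) + (M + 1) * ((M + 1) ^ 2 * ‖v - z‖) := by gcongr
    _ ≤ (M + 1) ^ 2 * σ * (M + 1) + (M + 1) * ((M + 1) ^ 2 * σ) := by gcongr
    _ = _ := by ring

lemma abs_dist_sub_le (h : LocalBounds φ z₀ R M) {z v w : ℂ} {σ δ : ℝ} (hz : z ∈ ball z₀ R)
    (hv : v ∈ ball z₀ R) (hw : w ∈ ball z₀ R) (hvz : ‖v - z‖ ≤ σ) (hwz : ‖w - z‖ ≤ σ)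
    (hδ : ∀ ξ ∈ ball z₀ R, ‖ξ - z‖ ≤ σ → ‖deriv φ ξ - deriv φ z‖ ≤ δ) :
    |dist (ofC (φ w)) (ofC (φ v)) - planarSphDeriv φ (ofC z) * dist (ofC w) (ofC v)| ≤
      (δ * (M + 1) ^ 2 + ‖deriv φ z‖ * (2 * (M + 1) ^ 3 * σ)) * dist (ofC w) (ofC v) := by
  have h1 := h.norm_image_sub_sub_le hδ hv hw hvz hwz
  have h2 := h.abs_cfac_div_mul_sub_le hz hv hw hvz hwz
  have p1 := cfac_pos (φ w)
  have p2 := cfac_pos (φ v)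
  have p3 := cfac_pos w
  have p4 := cfac_pos v
  have h3 : |‖φ w - φ v‖ - ‖deriv φ z‖ * ‖w - v‖| ≤ δ * ‖w - v‖ := by
    rw [← norm_mul]; exact (abs_norm_sub_norm_le _ _).trans h1
  have h4 : cfac w / cfac (φ w) * (cfac v / cfac (φ v)) ≤ (M + 1) ^ 2 := by
    rw [sq]
    have := h.cfac_div_le hv
    have := h.cfac_div_le hw
    have := h.one_le
    gcongr
  have h5 : 0 < cfac w / cfac (φ w) * (cfac v / cfac (φ v)) := by positivity
  have e1 : dist (ofC (φ w)) (ofC (φ v)) =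
      ‖φ w - φ v‖ * (cfac w / cfac (φ w) * (cfac v / cfac (φ v))) * (2 / (cfac w * cfac v)) := by
    rw [dist_ofC]; field_simp
  have e2 : dist (ofC w) (ofC v) = ‖w - v‖ * (2 / (cfac w * cfac v)) := by
    rw [dist_ofC]; field_simp
  have h6 : 0 < 2 / (cfac w * cfac v) := by positivity
  rw [e1, e2, planarSphDeriv_ofC]
  set H := cfac w / cfac (φ w) * (cfac v / cfac (φ v))
  set G := (cfac z / cfac (φ z)) ^ 2
  set q := 2 / (cfac w * cfac v)
  clear_value H G q
  have e3 : ‖φ w - φ v‖ * H * q - ‖deriv φ z‖ * G * (‖w - v‖ * q) =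
      ((‖φ w - φ v‖ - ‖deriv φ z‖ * ‖w - v‖) * H + ‖deriv φ z‖ * ‖w - v‖ * (H - G)) * q := by ring
  rw [e3, abs_mul, abs_of_pos h6, ← mul_assoc _ ‖w - v‖]
  refine mul_le_mul_of_nonneg_right ?_ h6.le
  refine (abs_add_le _ _).trans ?_
  rw [abs_mul, abs_mul, abs_of_pos h5, abs_of_nonneg (show 0 ≤ ‖deriv φ z‖ * ‖w - v‖ by positivity)]
  calc _ ≤ δ * ‖w - v‖ * (M + 1) ^ 2 + ‖deriv φ z‖ * ‖w - v‖ * (2 * (M + 1) ^ 3 * σ) := by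
        gcongr
        exact (abs_nonneg _).trans h3
    _ = _ := by ring

lemma abs_planarSphDeriv_sub_le (h : LocalBounds φ z₀ R M) {z w : ℂ} {σ δ : ℝ}
    (hz : z ∈ ball z₀ R) (hw : w ∈ ball z₀ R) (hwz : ‖w - z‖ ≤ σ)
    (hδ : ‖deriv φ w - deriv φ z‖ ≤ δ) :
    |planarSphDeriv φ (ofC w) - planarSphDeriv φ (ofC z)| ≤
      δ * (M + 1) ^ 2 + ‖deriv φ z‖ * (2 * (M + 1) ^ 3 * σ) := by
  have h2 := h.abs_cfac_div_mul_sub_le hz hw hw hwz hwz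
  rw [← sq] at h2
  have h3 : |‖deriv φ w‖ - ‖deriv φ z‖| ≤ δ := (abs_norm_sub_norm_le _ _).trans hδ
  have h4 : (cfac w / cfac (φ w)) ^ 2 ≤ (M + 1) ^ 2 := by
    have := h.cfac_div_le hw
    have := cfac_pos w
    have := cfac_pos (φ w)
    gcongr
  rw [planarSphDeriv_ofC, planarSphDeriv_ofC]
  set H := (cfac w / cfac (φ w)) ^ 2
  set G := (cfac z / cfac (φ z)) ^ 2
  have h5 : 0 ≤ H := sq_nonneg _
  have e3 : ‖deriv φ w‖ * H - ‖deriv φ z‖ * G =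
      (‖deriv φ w‖ - ‖deriv φ z‖) * H + ‖deriv φ z‖ * (H - G) := by ring
  rw [e3]
  refine (abs_add_le _ _).trans ?_
  rw [abs_mul, abs_mul, abs_of_nonneg h5, abs_of_nonneg (norm_nonneg (deriv φ z))]
  gcongr
  exact (abs_nonneg _).trans h3

lemma norm_deriv_le_planarSphDeriv (h : LocalBounds φ z₀ R M) {z : ℂ} (hz : z ∈ ball z₀ R) :
    ‖deriv φ z‖ ≤ (M + 1) ^ 2 * planarSphDeriv φ (ofC z) := by
  rw [planarSphDeriv_ofC]
  have p1 := cfac_pos (φ z)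
  have h1 : 1 ≤ (M + 1) * (cfac z / cfac (φ z)) := by
    rw [mul_div_assoc', one_le_div p1]
    have := h.cfac_map_le hz
    have := one_le_cfac z
    nlinarith
  have h2 : 1 ≤ ((M + 1) * (cfac z / cfac (φ z))) ^ 2 := one_le_pow₀ h1
  calc ‖deriv φ z‖ ≤ ‖deriv φ z‖ * ((M + 1) * (cfac z / cfac (φ z))) ^ 2 :=
        le_mul_of_one_le_right (norm_nonneg _) h2
    _ = _ := by ring

lemma planarSphDeriv_le (h : LocalBounds φ z₀ R M) {z : ℂ} (hz : z ∈ ball z₀ R) :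
    planarSphDeriv φ (ofC z) ≤ (M + 1) ^ 2 * ‖deriv φ z‖ := by
  rw [planarSphDeriv_ofC, mul_comm]
  have := h.cfac_div_le hz
  have := cfac_pos z
  have := cfac_pos (φ z)
  gcongr

lemma exists_of_dist_le (h : LocalBounds φ z₀ R M) {z : ℂ} {ρ : ℝ} (hρ : 0 ≤ ρ)
    (hsub : closedBall z ρ ⊆ ball z₀ R) (hz : deriv φ z ≠ 0)
    (hδ : ∀ w ∈ closedBall z ρ, ‖deriv φ w - deriv φ z‖ ≤ ‖deriv φ z‖ / 4) {η : ℂ}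
    (hη : 2 * ‖η - φ z‖ ≤ ‖deriv φ z‖ * ρ) : ∃ w ∈ closedBall z ρ, φ w = η := by
  have hp : 0 < ‖deriv φ z‖ := norm_pos_iff.mpr hz
  let A : ℂ →L[ℂ] ℂ := ContinuousLinearMap.toSpanSingleton ℂ (deriv φ z)
  have hA : ∀ w, A w = w * deriv φ z := fun w => by
    simp [A, ContinuousLinearMap.toSpanSingleton_apply]
  let S : A.NonlinearRightInverse :=
    { toFun := fun w => w / deriv φ z
      nnnorm := ‖deriv φ z‖₊⁻¹
      bound' := fun w => by
        rw [norm_div]; simp [div_eq_inv_mul]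
      right_inv' := fun w => by rw [hA]; field_simp }
  have happ : ApproximatesLinearOn φ A (closedBall z ρ) (‖deriv φ z‖₊ / 4) := by
    intro x hx y hy
    rw [hA, mul_comm]
    have := h.norm_image_sub_sub_le (z := z) (σ := ρ) (δ := ‖deriv φ z‖ / 4)
      (fun w _ hwz => hδ w (by rwa [mem_closedBall, dist_eq_norm])) (hsub hy) (hsub hx)
      (by rwa [mem_closedBall, dist_eq_norm] at hy) (by rwa [mem_closedBall, dist_eq_norm] at hx)
    simpa using this
  have key := happ.surjOn_closedBall_of_nonlinearRightInverse S hρ subset_rfl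
  obtain ⟨w, hw, hwη⟩ := key (a := η) (by
    rw [mem_closedBall, dist_eq_norm]
    have : (((S.nnnorm : ℝ≥0) : ℝ)⁻¹ - ((‖deriv φ z‖₊ / 4 : ℝ≥0) : ℝ)) = 3 / 4 * ‖deriv φ z‖ := by
      simp [S]; ring
    rw [this]
    have : 0 ≤ ‖deriv φ z‖ * ρ := by positivity
    nlinarith)
  exact ⟨w, hw, hwη⟩

lemma tameNear (h : LocalBounds φ z₀ R M) {g : RSphere → RSphere}
    (hg : ∀ z ∈ ball z₀ R, g (ofC z) = ofC (φ z)) :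
    ∃ r L, TameNear g (planarSphDeriv φ) (ofC z₀) r L := by
  set N := M + 1 with hN
  have hM := h.one_le
  have hN1 : 1 ≤ N := by linarith
  have hN2 : 2 ≤ N := by linarith
  have hN0 : 0 < N := by linarith
  have hMN : M ≤ N := by linarith
  have hR := h.pos
  set r := min (1 / N) (R / (2 * N ^ 2)) with hr
  have hr0 : 0 < r := by positivity
  have hr1 : r ≤ 1 := (min_le_left _ _).trans (by rw [div_le_one hN0]; exact hN1)
  have hNpow : ∀ {a b : ℕ}, a ≤ b → N ^ a ≤ N ^ b := fun hab => pow_le_pow_right₀ hN1 hab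
  have hz₀ : z₀ ∈ ball z₀ R := mem_ball_self hR
  have chart : ∀ x ∈ ball (ofC z₀) r, ∃ z ∈ ball z₀ (R / 2), x = ofC z := by
    intro x hx
    rw [mem_ball] at hx
    obtain ⟨z, rfl, -, hz⟩ := exists_ofC_of_dist_le hN0 (h.cfac_le hz₀)
      (hx.le.trans (min_le_left _ _))
    refine ⟨z, ?_, rfl⟩
    rw [mem_ball_iff_norm]
    refine hz.trans_lt ?_
    have := hx.trans_le (min_le_right _ _)
    rw [lt_div_iff₀ (by positivity)] at this
    linarith
  have hhalf : ball z₀ (R / 2) ⊆ ball z₀ R := ball_subset_ball (by linarith)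
  have hnorm : ∀ z ∈ ball z₀ R, ∀ w ∈ ball z₀ R, ‖w - z‖ ≤ N ^ 2 * dist (ofC w) (ofC z) := by
    intro z hz w hw
    have h1 := h.cfac_le hz
    have h2 := h.cfac_le hw
    have p1 := cfac_pos z
    have p2 := cfac_pos w
    have e : ‖w - z‖ = cfac w * cfac z / 2 * dist (ofC w) (ofC z) := by
      rw [dist_ofC]; field_simp
    rw [e]
    gcongr
    have : cfac w * cfac z ≤ N * N := by gcongr
    nlinarith [mul_pos p1 p2]
  have hDnn : ∀ z, 0 ≤ planarSphDeriv φ (ofC z) := fun z => by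
    rw [planarSphDeriv_ofC]; positivity
  set s' : ℂ → ℝ := fun z => if deriv φ z₀ = 0 then ‖z - z₀‖ else 1 with hs'
  have hs : ∀ z, critScale (planarSphDeriv φ) (ofC z₀) (ofC z) ≤ 2 * s' z := by
    intro z
    simp only [critScale, planarSphDeriv_eq_zero_iff, hs']
    split_ifs
    · exact dist_ofC_le z z₀
    · norm_num
  have hs2 : ∀ z, critScale (planarSphDeriv φ) (ofC z₀) (ofC z) ≤ 2 := by
    intro z
    simp only [critScale]
    split_ifs
    · exact dist_le_two _ _
    · norm_num
  have hs'0 : ∀ z, 0 ≤ s' z := fun z => by simp only [hs']; split_ifs <;> positivity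
  have hs'N : ∀ z ∈ ball z₀ R, s' z ≤ 2 * N := fun z hz => by
    simp only [hs']
    split_ifs
    · have h1 := h.norm_le z hz
      have h2 := h.norm_le z₀ hz₀
      exact (norm_sub_le _ _).trans (by linarith)
    · linarith
  -- the error term in the distortion estimates
  have herr : ∀ z ∈ ball z₀ R, ∀ τ, 0 ≤ τ →
      M * (2 * N ^ 2 * τ) * ‖deriv φ z‖ * N ^ 2 +
        ‖deriv φ z‖ * (2 * N ^ 3 * (2 * N ^ 2 * τ * s' z)) ≤
      10 * N ^ 8 * τ * planarSphDeriv φ (ofC z) := by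
    intro z hz τ hτ
    have h1 := hs'N z hz
    have h2 := h.norm_deriv_le_planarSphDeriv hz
    calc _ ≤ N * (2 * N ^ 2 * τ) * ‖deriv φ z‖ * N ^ 2 +
        ‖deriv φ z‖ * (2 * N ^ 3 * (2 * N ^ 2 * τ * (2 * N))) := by gcongr
      _ = (2 * N ^ 5 + 8 * N ^ 6) * τ * ‖deriv φ z‖ := by ring
      _ ≤ (2 * N ^ 6 + 8 * N ^ 6) * τ * (N ^ 2 * planarSphDeriv φ (ofC z)) := by
        have := hNpow (show 5 ≤ 6 by norm_num)
        gcongr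
      _ = _ := by ring
  have hsmall : ∀ z ∈ ball z₀ R, ∀ w ∈ ball z₀ R, ∀ τ, 0 ≤ τ →
      dist (ofC w) (ofC z) ≤ τ * critScale (planarSphDeriv φ) (ofC z₀) (ofC z) →
      ‖w - z‖ ≤ 2 * N ^ 2 * τ * s' z := by
    intro z hz w hw τ hτ hd
    calc ‖w - z‖ ≤ N ^ 2 * dist (ofC w) (ofC z) := hnorm z hz w hw
      _ ≤ N ^ 2 * (τ * (2 * s' z)) := by gcongr; exact hd.trans (by gcongr; exact hs z)
      _ = _ := by ring
  set L := 64 * N ^ 8 / r with hL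
  have hLN : 64 * N ^ 8 ≤ L := le_div_self (by positivity) hr0 hr1
  have hL0 : 0 < L := by positivity
  have hτ1 : ∀ τ, 0 ≤ τ → L * τ ≤ 1 → 2 * N ^ 2 * τ ≤ 1 := fun τ hτ hLτ => by
    refine le_trans ?_ hLτ
    have := hNpow (show 2 ≤ 8 by norm_num)
    gcongr
    linarith [pow_pos hN0 8]
  refine ⟨r, L, hr0, ?_, ?_, ?_, ?_, ?_, ?_, ?_, ?_, ?_⟩
  · have := one_le_pow₀ hN1 (n := 8)
    linarith
  · intro x hx
    obtain ⟨z, hz, rfl⟩ := chart x hx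
    exact hDnn z
  · intro x hx hne
    obtain ⟨z, hz, rfl⟩ := chart x hx
    refine lt_of_le_of_ne (hDnn z) fun h0 => ?_
    rw [eq_comm, planarSphDeriv_eq_zero_iff] at h0
    exact h.deriv_ne_zero z (hhalf hz) (fun e => hne (by rw [e])) h0
  · intro x hx
    obtain ⟨z, hz, rfl⟩ := chart x hx
    have h1 := h.norm_deriv_le z (hhalf hz)
    refine (h.planarSphDeriv_le (hhalf hz)).trans ?_
    calc N ^ 2 * ‖deriv φ z‖ ≤ N ^ 2 * N := by gcongr; linarith
      _ = N ^ 3 := by ring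
      _ ≤ N ^ 8 := hNpow (by norm_num)
      _ ≤ L := by linarith [pow_pos hN0 8]
  · intro x hx u hu v hv ρ hux hvx
    obtain ⟨z, hz, rfl⟩ := chart x hx
    obtain ⟨w, hw, rfl⟩ := chart u hu
    obtain ⟨ξ, hξ, rfl⟩ := chart v hv
    rw [hg w (hhalf hw), hg ξ (hhalf hξ)]
    refine (h.abs_dist_sub_le (σ := N ^ 2 * ρ) (δ := M * (N ^ 2 * ρ)) (hhalf hz) (hhalf hξ)
      (hhalf hw) ((hnorm z (hhalf hz) ξ (hhalf hξ)).trans (by gcongr))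
      ((hnorm z (hhalf hz) w (hhalf hw)).trans (by gcongr))
      (fun ζ hζ hζz => (h.deriv_lip z (hhalf hz) ζ hζ).trans (by gcongr))).trans ?_
    have h1 := h.norm_deriv_le z (hhalf hz)
    have hρ : 0 ≤ ρ := dist_nonneg.trans hux
    have h5 := hNpow (show 5 ≤ 8 by norm_num)
    have h6 := hNpow (show 6 ≤ 8 by norm_num)
    gcongr
    calc _ ≤ N * (N ^ 2 * ρ) * N ^ 2 + N * (2 * N ^ 3 * (N ^ 2 * ρ)) := by
          gcongr; linarith
      _ = (N ^ 5 + 2 * N ^ 6) * ρ := by ring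
      _ ≤ _ := by gcongr; linarith [pow_pos hN0 8]
  · intro x hx u hu
    obtain ⟨z, hz, rfl⟩ := chart x hx
    obtain ⟨w, hw, rfl⟩ := chart u hu
    have h0 := hnorm z (hhalf hz) w (hhalf hw)
    refine (h.abs_planarSphDeriv_sub_le (hhalf hz) (hhalf hw) h0
      ((h.deriv_lip z (hhalf hz) w (hhalf hw)).trans (by gcongr))).trans ?_
    set ρ := dist (ofC w) (ofC z)
    have h1 := h.norm_deriv_le z (hhalf hz)
    have hρ : 0 ≤ ρ := dist_nonneg
    have h5 := hNpow (show 5 ≤ 8 by norm_num)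
    have h6 := hNpow (show 6 ≤ 8 by norm_num)
    calc _ ≤ N * (N ^ 2 * ρ) * N ^ 2 + N * (2 * N ^ 3 * (N ^ 2 * ρ)) := by
          gcongr; linarith
      _ = (N ^ 5 + 2 * N ^ 6) * ρ := by ring
      _ ≤ _ := by gcongr; linarith [pow_pos hN0 8]
  · intro x hx u hu v hv τ hτ hLτ hux hvx
    obtain ⟨z, hz, rfl⟩ := chart x hx
    obtain ⟨w, hw, rfl⟩ := chart u hu
    obtain ⟨ξ, hξ, rfl⟩ := chart v hv
    rw [hg w (hhalf hw), hg ξ (hhalf hξ)]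
    refine (h.abs_dist_sub_le (σ := 2 * N ^ 2 * τ * s' z)
      (δ := M * (2 * N ^ 2 * τ) * ‖deriv φ z‖) (hhalf hz) (hhalf hξ)
      (hhalf hw) (hsmall z (hhalf hz) ξ (hhalf hξ) τ hτ hvx)
      (hsmall z (hhalf hz) w (hhalf hw) τ hτ hux)
      (fun ζ hζ hζz => h.deriv_distort z (hhalf hz) ζ hζ _ (by positivity) (hτ1 τ hτ hLτ)
        hζz)).trans ?_
    refine mul_le_mul_of_nonneg_right ((herr z (hhalf hz) τ hτ).trans ?_) dist_nonneg
    have := hDnn z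
    gcongr
    linarith [pow_pos hN0 8]
  · intro x hx u hu τ hτ hLτ hux
    obtain ⟨z, hz, rfl⟩ := chart x hx
    obtain ⟨w, hw, rfl⟩ := chart u hu
    have h1 := hsmall z (hhalf hz) w (hhalf hw) τ hτ hux
    refine (h.abs_planarSphDeriv_sub_le (hhalf hz) (hhalf hw) h1
      (h.deriv_distort z (hhalf hz) w (hhalf hw) _ (by positivity) (hτ1 τ hτ hLτ) h1)).trans
        ((herr z (hhalf hz) τ hτ).trans ?_)
    have := hDnn z
    gcongr
    linarith [pow_pos hN0 8]
  · intro x hx y hD hy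
    obtain ⟨z, hz, rfl⟩ := chart x (ball_subset_ball (by linarith) hx)
    have hzR := hhalf hz
    rw [hg z hzR] at hy ⊢
    set d := dist y (ofC (φ z)) with hd
    set D := planarSphDeriv φ (ofC z) with hDdef
    set s := critScale (planarSphDeriv φ) (ofC z₀) (ofC z) with hsdef
    have hd0 : 0 ≤ d := dist_nonneg
    have hDN : D ≤ N ^ 3 := by
      have h1 := h.norm_deriv_le z hzR
      refine (h.planarSphDeriv_le hzR).trans ?_
      calc N ^ 2 * ‖deriv φ z‖ ≤ N ^ 2 * N := by gcongr; linarith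
        _ = N ^ 3 := by ring
    have hdz : deriv φ z ≠ 0 := fun e => hD.ne' ((planarSphDeriv_eq_zero_iff φ z).mpr e)
    have hdzp : 0 < ‖deriv φ z‖ := norm_pos_iff.mpr hdz
    have hdN : d ≤ 1 / N := by
      rw [le_div_iff₀ hN0]
      have h1 : L * d ≤ 2 * N ^ 3 := hy.trans (by nlinarith [hs2 z])
      have h2 : 64 * N ^ 8 * d ≤ 2 * N ^ 3 := (by gcongr : 64 * N ^ 8 * d ≤ L * d).trans h1
      have h3 : N ^ 4 ≤ N ^ 8 := hNpow (by norm_num)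
      have h4 : 64 * N ^ 4 * d ≤ 64 * N ^ 8 * d := by gcongr
      have h5 : N ^ 3 * (64 * (d * N)) ≤ N ^ 3 * 2 := by nlinarith
      have := le_of_mul_le_mul_left h5 (by positivity)
      linarith
    obtain ⟨η, rfl, -, hη⟩ := exists_ofC_of_dist_le hN0 (h.cfac_map_le hzR) hdN
    set ρ := 2 * ‖η - φ z‖ / ‖deriv φ z‖ with hρ
    have hρ0 : 0 ≤ ρ := by positivity
    have hρD : D * ρ ≤ 2 * N ^ 4 * d := by
      rw [hρ, mul_div_assoc', div_le_iff₀ hdzp]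
      calc D * (2 * ‖η - φ z‖) ≤ N ^ 2 * ‖deriv φ z‖ * (2 * (N ^ 2 * d)) := by
            gcongr; exact h.planarSphDeriv_le hzR
        _ = _ := by ring
    have hρs : L * ρ ≤ 2 * N ^ 4 * s := by
      refine le_of_mul_le_mul_left ?_ hD
      calc D * (L * ρ) = L * (D * ρ) := by ring
        _ ≤ L * (2 * N ^ 4 * d) := by gcongr
        _ = 2 * N ^ 4 * (L * d) := by ring
        _ ≤ 2 * N ^ 4 * (D * s) := by gcongr
        _ = _ := by ring
    have hρr : ρ ≤ r / 16 := by
      have h1 : 64 * N ^ 8 * ρ ≤ r * (4 * N ^ 4) := by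
        calc 64 * N ^ 8 * ρ = r * (L * ρ) := by rw [hL]; field_simp
          _ ≤ r * (2 * N ^ 4 * 2) :=
            mul_le_mul_of_nonneg_left (hρs.trans (by gcongr; exact hs2 z)) hr0.le
          _ = _ := by ring
      have h3 : N ^ 4 ≤ N ^ 8 := hNpow (by norm_num)
      have h4 : 64 * N ^ 4 * ρ ≤ 64 * N ^ 8 * ρ := by gcongr
      have h5 : N ^ 4 * (64 * ρ) ≤ N ^ 4 * (4 * r) := by nlinarith
      have := le_of_mul_le_mul_left h5 (by positivity)
      linarith
    have hrR : r ≤ R := (min_le_right _ _).trans (div_le_self hR.le (by nlinarith))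
    have hsub : closedBall z ρ ⊆ ball z₀ R := by
      refine (closedBall_subset_ball (show ρ < R / 2 by linarith)).trans (ball_subset_ball' ?_)
      rw [mem_ball] at hz
      linarith
    obtain ⟨w, hw, rfl⟩ := h.exists_of_dist_le hρ0 hsub hdz (fun w hw => by
      have h1 := h.deriv_distort z hzR w (hsub hw) (4 * N ^ 4 / L) (by positivity)
        (by
          rw [div_le_one hL0]
          have : N ^ 4 ≤ N ^ 8 := hNpow (by norm_num)
          linarith [pow_pos hN0 4])
        (by
          rw [mem_closedBall, dist_eq_norm] at hw
          refine hw.trans ?_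
          rw [div_mul_eq_mul_div, le_div_iff₀ hL0, mul_comm]
          refine hρs.trans ?_
          calc 2 * N ^ 4 * s ≤ 2 * N ^ 4 * (2 * s' z) := by gcongr; exact hs z
            _ = _ := by ring)
      refine h1.trans ?_
      have : M * (4 * N ^ 4 / L) ≤ 1 / 4 := by
        rw [mul_div_assoc', div_le_iff₀ hL0]
        have h5 : N ^ 5 ≤ N ^ 8 := hNpow (by norm_num)
        have h6 : M * (4 * N ^ 4) ≤ N * (4 * N ^ 4) := by gcongr
        have h7 : N * (4 * N ^ 4) = 4 * N ^ 5 := by ring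
        linarith
      calc _ ≤ 1 / 4 * ‖deriv φ z‖ := by gcongr
        _ = _ := by ring) (η := η) (by rw [hρ]; field_simp; exact le_rfl)
    have hwz : dist (ofC w) (ofC z) ≤ 2 * ρ := by
      refine (dist_ofC_le w z).trans ?_
      rw [mem_closedBall, dist_eq_norm] at hw
      linarith
    refine ⟨ofC w, ?_, hg w (hsub hw), ?_⟩
    · rw [mem_ball] at hx ⊢
      have := dist_triangle (ofC w) (ofC z) (ofC z₀)
      linarith
    · calc D * dist (ofC w) (ofC z) ≤ D * (2 * ρ) := by gcongr
        _ = 2 * (D * ρ) := by ring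
        _ ≤ 2 * (2 * N ^ 4 * d) := by gcongr
        _ = 4 * N ^ 4 * d := by ring
        _ ≤ L * d := by
          have : N ^ 4 ≤ N ^ 8 := hNpow (by norm_num)
          gcongr
          linarith [pow_pos hN0 8]

end LocalBounds

/-- A linear approximation of distances with quadratic error determines the spherical
derivative. -/
lemma sphDeriv_eq_of_eventually_le {f : RSphere → RSphere} {x : RSphere} {a C : ℝ}
    (h : ∀ᶠ y in 𝓝 x, |dist (f y) (f x) - a * dist y x| ≤ C * dist y x * dist y x) :
    sphDeriv f x = a := by
  refine Tendsto.limsup_eq ?_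
  rw [tendsto_iff_norm_sub_tendsto_zero]
  have hev : ∀ᶠ y in 𝓝[≠] x, ‖dist (f y) (f x) / dist y x - a‖ ≤ C * dist y x := by
    filter_upwards [self_mem_nhdsWithin, nhdsWithin_le_nhds h] with y hne hy
    have hpos : 0 < dist y x := dist_pos.mpr hne
    rwa [Real.norm_eq_abs, div_sub' hpos.ne', abs_div, abs_of_pos hpos, div_le_iff₀ hpos,
      mul_comm _ a]
  refine squeeze_zero' (Eventually.of_forall fun _ => norm_nonneg _) hev ?_
  have : Tendsto (fun y => C * dist y x) (𝓝 x) (𝓝 (C * dist x x)) :=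
    (continuous_const.mul (continuous_id.dist continuous_const)).tendsto x
  rw [dist_self, mul_zero] at this
  exact this.mono_left nhdsWithin_le_nhds

namespace TameNear

lemma congr {X : Type*} [MetricSpace X] {f : X → X} {D D' : X → ℝ} {x₀ : X} {r L : ℝ}
    (h : TameNear f D x₀ r L) (hD : ∀ x ∈ ball x₀ r, D' x = D x) : TameNear f D' x₀ r L := by
  have h0 : D' x₀ = D x₀ := hD _ (mem_ball_self h.pos)
  have hs : ∀ x, critScale D' x₀ x = critScale D x₀ x := fun x => by simp only [critScale, h0]
  refine ⟨h.pos, h.one_le, fun x hx => ?_, fun x hx => ?_, fun x hx => ?_, fun x hx => ?_,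
    fun x hx u hu => ?_, fun x hx => ?_, fun x hx u hu => ?_, fun x hx => ?_⟩
  · rw [hD x hx]; exact h.D_nonneg x hx
  · rw [hD x hx]; exact h.D_pos x hx
  · rw [hD x hx]; exact h.D_le x hx
  · rw [hD x hx]; exact h.approx x hx
  · rw [hD x hx, hD u hu]; exact h.D_lip x hx u hu
  · rw [hD x hx, hs]; exact h.distort x hx
  · rw [hD x hx, hD u hu, hs]; exact h.D_distort x hx u hu
  · rw [hD x (ball_subset_ball (half_le_self h.pos.le) hx), hs]; exact h.onto x hx

lemma conj {X : Type*} [MetricSpace X] {f g a b : X → X} {D : X → ℝ} {x₀ : X} {r L : ℝ}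
    (h : TameNear g D x₀ r L) (ha : Isometry a) (hb : Isometry b) (haa : ∀ x, a (a x) = x)
    (hbb : ∀ x, b (b x) = x) (hf : ∀ x, f x = a (g (b x))) :
    TameNear f (fun x => D (b x)) (b x₀) r L := by
  have hd : ∀ u v, dist (f u) (f v) = dist (g (b u)) (g (b v)) := fun u v => by
    rw [hf, hf, ha.dist_eq]
  have hbd : ∀ x y, dist (b x) y = dist x (b y) := fun x y => by
    rw [← hb.dist_eq x (b y), hbb]
  have hball : ∀ {x s}, x ∈ ball (b x₀) s → b x ∈ ball x₀ s := fun {x s} hx => by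
    rw [mem_ball] at hx ⊢; rwa [hbd]
  have hs : ∀ x, critScale (fun x => D (b x)) (b x₀) x = critScale D x₀ (b x) := fun x => by
    simp only [critScale, hbb, hbd]
  refine ⟨h.pos, h.one_le, fun x hx => h.D_nonneg _ (hball hx),
    fun x hx hne => h.D_pos _ (hball hx) fun e => hne (by rw [← e, hbb]),
    fun x hx => h.D_le _ (hball hx), fun x hx u hu v hv => ?_, fun x hx u hu => ?_,
    fun x hx u hu v hv => ?_, fun x hx u hu => ?_, fun x hx y => ?_⟩
  · rw [hd, ← hb.dist_eq u, ← hb.dist_eq v x, ← hb.dist_eq u v]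
    exact h.approx _ (hball hx) _ (hball hu) _ (hball hv)
  · rw [← hb.dist_eq u]
    exact h.D_lip _ (hball hx) _ (hball hu)
  · rw [hd, hs, ← hb.dist_eq u, ← hb.dist_eq v x, ← hb.dist_eq u v]
    exact h.distort _ (hball hx) _ (hball hu) _ (hball hv)
  · rw [hs, ← hb.dist_eq u]
    exact h.D_distort _ (hball hx) _ (hball hu)
  · intro hD hy
    have hya : dist y (f x) = dist (a y) (g (b x)) := by
      rw [← ha.dist_eq (a y), haa, hf]
    rw [hs, hya] at hy
    obtain ⟨u, hu, hgu, hle⟩ := h.onto _ (hball hx) (a y) hD hy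
    refine ⟨b u, ?_, by rw [hf, hbb, hgu, haa], ?_⟩
    · rw [mem_ball] at hu ⊢; rwa [hb.dist_eq]
    · rw [hbd, hya]; exact hle

lemma sphDeriv_eq {f : RSphere → RSphere} {D : RSphere → ℝ} {x₀ : RSphere} {r L : ℝ}
    (h : TameNear f D x₀ r L) {x : RSphere} (hx : x ∈ ball x₀ r) : sphDeriv f x = D x := by
  refine sphDeriv_eq_of_eventually_le (C := L) ?_
  filter_upwards [isOpen_ball.mem_nhds hx] with y hy
  exact h.approx x hx y hy x hx (dist y x) le_rfl (by simp)

end TameNear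

lemma exists_tameMap_of_tameNear {f : RSphere → RSphere}
    (H : ∀ x₀, ∃ D r L, TameNear f D x₀ r L) : ∃ t L, TameMap f (sphDeriv f) t L := by
  have H' : ∀ x₀, ∃ r L, TameNear f (sphDeriv f) x₀ r L := fun x₀ => by
    obtain ⟨D, r, L, h⟩ := H x₀
    exact ⟨r, L, h.congr fun x hx => h.sphDeriv_eq hx⟩
  choose r L H using H'
  set D := sphDeriv f
  obtain ⟨T, -, hT⟩ := isCompact_univ.elim_nhds_subcover (fun x => ball x (r x / 2))
    fun x _ => ball_mem_nhds x (half_pos (H x).pos)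
  have hcov : ∀ x, ∃ i ∈ T, x ∈ ball i (r i / 2) := fun x => by simpa using hT (mem_univ x)
  set A : ℝ := 1 + ∑ i ∈ T, (L i + 2 / r i) with hA
  have hterm : ∀ i ∈ T, L i + 2 / r i ≤ ∑ i ∈ T, (L i + 2 / r i) := fun i hi =>
    Finset.single_le_sum (f := fun i => L i + 2 / r i) (fun j _ => by
      have := (H j).pos; have := (H j).one_le; positivity) hi
  have hA1 : 1 ≤ A := by
    have : 0 ≤ ∑ i ∈ T, (L i + 2 / r i) := Finset.sum_nonneg fun j _ => by
      have := (H j).pos; have := (H j).one_le; positivity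
    linarith
  have hA0 : 0 < A := by linarith
  have hLA : ∀ i ∈ T, L i ≤ A := fun i hi => by
    have := hterm i hi
    have : 0 < 2 / r i := div_pos two_pos (H i).pos
    linarith
  have hrA : ∀ i ∈ T, 1 / A ≤ r i / 2 := fun i hi => by
    have h1 := hterm i hi
    have h2 := (H i).one_le
    have h3 : 2 / r i ≤ A := by linarith
    have h4 := (H i).pos
    rw [div_le_iff₀ h4] at h3
    rw [div_le_div_iff₀ hA0 two_pos]
    linarith
  have hloc : ∀ x u, ∀ i ∈ T, x ∈ ball i (r i / 2) → dist u x < 1 / A → u ∈ ball i (r i) := by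
    intro x u i hi hx hu
    rw [mem_ball] at hx ⊢
    have := hrA i hi
    have := dist_triangle u x i
    linarith
  have hself : ∀ x, ∀ i, x ∈ ball i (r i / 2) → x ∈ ball i (r i) := fun x i hx =>
    ball_subset_ball (half_le_self (H i).pos.le) hx
  have hfar : ∀ {d : ℝ}, ¬d < 1 / A → 1 ≤ A * d := fun {d} hd => by
    rw [not_lt, div_le_iff₀ hA0] at hd; linarith
  have hD0 : ∀ x, 0 ≤ D x := fun x => by
    obtain ⟨i, hi, hx⟩ := hcov x
    exact (H i).D_nonneg x (hself x i hx)
  have hDA : ∀ x, D x ≤ A := fun x => by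
    obtain ⟨i, hi, hx⟩ := hcov x
    exact ((H i).D_le x (hself x i hx)).trans (hLA i hi)
  have hAA : A ≤ A ^ 2 := by nlinarith
  have hDlip : ∀ x u, D u ≤ D x + A ^ 2 * dist u x := by
    intro x u
    by_cases hd : dist u x < 1 / A
    · obtain ⟨i, hi, hx⟩ := hcov x
      have h1 := (H i).D_lip x (hself x i hx) u (hloc x u i hi hx hd)
      have h2 : L i * dist u x ≤ A ^ 2 * dist u x := by
        gcongr; exact (hLA i hi).trans hAA
      have := le_of_abs_le h1
      linarith
    · have h1 := hfar hd
      have h2 : A * 1 ≤ A * (A * dist u x) := by gcongr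
      have := hDA u
      have := hD0 x
      nlinarith
  have hlip : ∀ u v, dist (f u) (f v) ≤ 2 * A * dist u v := by
    intro u v
    by_cases hd : dist u v < 1 / A
    · obtain ⟨i, hi, hx⟩ := hcov v
      have h1 := (H i).approx v (hself v i hx) u (hloc v u i hi hx hd) v (hself v i hx) (dist u v)
        le_rfl (by simp)
      have h2 := le_of_abs_le h1
      have h3 : D v * dist u v ≤ A * dist u v := by gcongr; exact hDA v
      have h4 : L i * dist u v * dist u v ≤ A * 1 * dist u v := by
        gcongr
        · exact hLA i hi
        · exact hd.le.trans (by rw [div_le_one hA0]; exact hA1)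
      linarith
    · have h1 := hfar hd
      have := RSphere.dist_le_two (f u) (f v)
      linarith
  set C := T.filter fun i => D i = 0 with hC
  have hCmem : ∀ x, D x = 0 → x ∈ C := fun x hx => by
    obtain ⟨i, hi, hxi⟩ := hcov x
    have : x = i := by
      by_contra hne
      exact ((H i).D_pos x (hself x i hxi) hne).ne' hx
    subst this
    exact Finset.mem_filter.mpr ⟨hi, hx⟩
  set t : RSphere → ℝ := fun x => C.fold min 1 (dist x) with ht
  have ht1 : ∀ x, t x ≤ 1 := fun x => Finset.fold_min_le _ |>.mpr (Or.inl le_rfl)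
  have ht0 : ∀ x, 0 ≤ t x := fun x =>
    (Finset.le_fold_min _).mpr ⟨zero_le_one, fun _ _ => dist_nonneg⟩
  have hts : ∀ i ∈ T, ∀ x, t x ≤ critScale D i x := by
    intro i hi x
    simp only [critScale]
    split_ifs with h0
    · exact (Finset.fold_min_le _).mpr (Or.inr ⟨i, hCmem i h0, le_rfl⟩)
    · exact ht1 x
  set G : ℝ := 2 * A ^ 2 + (216 + 27 * C.card) with hG
  have hC0 : (0 : ℝ) ≤ C.card := Nat.cast_nonneg _
  have hG1 : 2 * A ^ 2 ≤ G := by linarith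
  have hGA : A ≤ G := by nlinarith
  have hG0 : 0 < G := by linarith
  have hclose : ∀ x u τ, 0 ≤ τ → G * τ ≤ 1 → dist u x ≤ τ * t x → dist u x < 1 / A := by
    intro x u τ hτ hGτ hu
    rw [lt_div_iff₀ hA0]
    have h1 : dist u x ≤ τ := hu.trans (mul_le_of_le_one_right hτ (ht1 x))
    have h2 : dist u x * A ≤ τ * A := by gcongr
    have h3 : 2 * A ≤ G := by linarith
    have h4 : 2 * A * τ ≤ G * τ := by gcongr
    linarith
  have hAτ : ∀ τ, 0 ≤ τ → G * τ ≤ 1 → ∀ i ∈ T, L i * τ ≤ 1 := fun τ hτ hGτ i hi =>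
    (mul_le_mul_of_nonneg_right ((hLA i hi).trans hGA) hτ).trans hGτ
  have hscale : ∀ i ∈ T, ∀ x u τ, 0 ≤ τ → dist u x ≤ τ * t x → dist u x ≤ τ * critScale D i x :=
    fun i hi x u τ hτ hu => hu.trans (mul_le_mul_of_nonneg_left (hts i hi x) hτ)
  refine ⟨t, G, ?_, hD0, ht0, ht1, ?_, ?_, ?_, ?_, ?_, ?_, ?_, ?_⟩
  · linarith
  · intro x
    rw [← div_le_iff₀' hG0]
    refine (Finset.le_fold_min _).mpr ⟨?_, fun c hc => ?_⟩
    · rw [div_le_one hG0]; exact (hDA x).trans hGA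
    · rw [div_le_iff₀' hG0]
      have h1 := hDlip c x
      rw [(Finset.mem_filter.mp hc).2, zero_add] at h1
      refine h1.trans ?_
      gcongr
      nlinarith
  · intro u v
    refine (hlip u v).trans ?_
    gcongr
    linarith
  · intro x u v ρ hu hv
    by_cases hρ : ρ < 1 / A
    · obtain ⟨i, hi, hx⟩ := hcov x
      refine ((H i).approx x (hself x i hx) u (hloc x u i hi hx (hu.trans_lt hρ)) v
        (hloc x v i hi hx (hv.trans_lt hρ)) ρ hu hv).trans ?_
      have : 0 ≤ ρ := dist_nonneg.trans hu
      gcongr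
      exact (hLA i hi).trans hGA
    · have h1 := hfar hρ
      have h2 : |dist (f u) (f v) - D x * dist u v| ≤ 2 * A * dist u v := by
        have h3 := hlip u v
        have h4 : D x * dist u v ≤ A * dist u v := by gcongr; exact hDA x
        have h5 : 0 ≤ D x * dist u v := mul_nonneg (hD0 x) dist_nonneg
        have h6 : 0 ≤ A * dist u v := by positivity
        have h7 : 0 ≤ dist (f u) (f v) := dist_nonneg
        rw [abs_le]
        constructor <;> linarith
      refine h2.trans ?_
      have h8 : 2 * A * 1 ≤ 2 * A * (A * ρ) := by gcongr
      have hρ0 : 0 ≤ ρ := dist_nonneg.trans hu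
      have h9 : 2 * A ^ 2 * ρ ≤ G * ρ := by gcongr
      have h10 : 2 * A * (A * ρ) = 2 * A ^ 2 * ρ := by ring
      exact mul_le_mul_of_nonneg_right (by linarith) dist_nonneg
  · intro x u v τ hτ hGτ hu hv
    obtain ⟨i, hi, hx⟩ := hcov x
    refine ((H i).distort x (hself x i hx) u (hloc x u i hi hx (hclose x u τ hτ hGτ hu)) v
      (hloc x v i hi hx (hclose x v τ hτ hGτ hv)) τ hτ (hAτ τ hτ hGτ i hi)
      (hscale i hi x u τ hτ hu) (hscale i hi x v τ hτ hv)).trans ?_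
    have := hD0 x
    gcongr
    exact (hLA i hi).trans hGA
  · intro x u τ hτ hGτ hu
    obtain ⟨i, hi, hx⟩ := hcov x
    refine ((H i).D_distort x (hself x i hx) u (hloc x u i hi hx (hclose x u τ hτ hGτ hu)) τ hτ
      (hAτ τ hτ hGτ i hi) (hscale i hi x u τ hτ hu)).trans ?_
    have := hD0 x
    gcongr
    exact (hLA i hi).trans hGA
  · intro x y hD hy
    obtain ⟨i, hi, hx⟩ := hcov x
    have hd : 0 ≤ dist y (f x) := dist_nonneg
    obtain ⟨u, hu, rfl, hle⟩ := (H i).onto x hx y hD (by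
      refine le_trans ?_ (hy.trans (mul_le_mul_of_nonneg_left (hts i hi x) hD.le))
      gcongr
      exact (hLA i hi).trans hGA)
    refine ⟨u, rfl, ?_⟩
    have h1 : D x * dist u x ≤ A * dist (f u) (f x) :=
      hle.trans (by gcongr; exact hLA i hi)
    have h2 : dist u x ≤ A / G * t x := by
      refine le_of_mul_le_mul_left ?_ hD
      calc D x * dist u x ≤ A * dist (f u) (f x) := h1
        _ = A / G * (G * dist (f u) (f x)) := by field_simp
        _ ≤ A / G * (D x * t x) := by gcongr
        _ = _ := by ring
    have h3 : L i * (A / G) ≤ 1 / 2 := by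
      calc L i * (A / G) ≤ A * (A / G) := by gcongr; exact hLA i hi
        _ ≤ 1 / 2 := by
          rw [mul_div_assoc', div_le_div_iff₀ hG0 two_pos]; linarith
    have h4 := (H i).distort x (hself x i hx) u hu x (hself x i hx) (A / G) (by positivity)
      (by linarith) (hscale i hi x u _ (by positivity) h2)
      (by rw [dist_self]; exact mul_nonneg (by positivity) ((ht0 x).trans (hts i hi x)))
    have h5 : L i * (A / G) * (D x * dist u x) ≤ 1 / 2 * (D x * dist u x) := by
      have := mul_nonneg hD.le (dist_nonneg (x := u) (y := x))
      gcongr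
    have h6 := neg_le_of_abs_le h4
    nlinarith
  · intro R ρ E hρ hρR hE hsep
    refine (RSphere.card_le_near_finite C E hρ hρR (fun hR x hx => ?_) hsep).trans ?_
    · exact ((Finset.fold_min_le _).mp (hE x hx)).resolve_left (not_le.mpr hR)
    · have : 0 < R := hρ.trans_le hρR
      gcongr
      nlinarith
  · intro o s hs hs1
    exact RSphere.exists_dist_eq o hs.le (by linarith)

namespace RSphere

lemma continuous_ofC : Continuous ofC := by
  refine continuous_iff_continuousAt.mpr fun z => tendsto_iff_dist_tendsto_zero.mpr ?_
  refine squeeze_zero (fun _ => dist_nonneg) (fun w => dist_ofC_le w z) ?_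
  have : Tendsto (fun w => 2 * ‖w - z‖) (𝓝 z) (𝓝 (2 * ‖z - z‖)) := by
    apply Continuous.tendsto; fun_prop
  simpa using this

lemma inv_ofC {w : ℂ} (hw : w ≠ 0) : inv (ofC w) = ofC w⁻¹ := by simp [inv, elim, ofC, hw]

lemma inv_ofC_zero : inv (ofC 0) = infty := by simp [inv, elim, ofC]

end RSphere

section RationalMap

open RSphere Polynomial

lemma Polynomial.eventually_eval_ne_zero {P : ℂ[X]} (hP : P ≠ 0) (z₀ : ℂ) :
    ∀ᶠ z in 𝓝[≠] z₀, P.eval z ≠ 0 := by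
  have h1 : ({z | P.eval z = 0} \ {z₀} : Set ℂ).Finite :=
    (P.roots.toFinset.finite_toSet.subset fun z hz => by simpa [hP] using hz).sdiff
  have h2 := h1.isClosed.isOpen_compl.mem_nhds (x := z₀) (by simp)
  filter_upwards [self_mem_nhdsWithin, mem_nhdsWithin_of_mem_nhds h2] with z hz hz' h0
  exact hz' ⟨h0, hz⟩

lemma exists_tameNear_of_eval_of_ne_zero {g : RSphere → RSphere} (hg : Continuous g) {P Q : ℂ[X]}
    (hne : ∀ a b : ℂ, C a * P = C b * Q → a = 0 ∧ b = 0) {z₀ : ℂ} (h0 : Q.eval z₀ ≠ 0)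
    (hgP : ∀ᶠ z in 𝓝[≠] z₀, g (ofC z) = ofC (P.eval z / Q.eval z)) :
    ∃ D r L, TameNear g D (ofC z₀) r L := by
  set φ : ℂ → ℂ := fun z => P.eval z / Q.eval z with hφ
  have hQ : ∀ᶠ z in 𝓝 z₀, Q.eval z ≠ 0 := Q.continuous.continuousAt.eventually_ne h0
  have hφa : AnalyticAt ℂ φ z₀ :=
    (P.differentiable.analyticAt z₀).div (Q.differentiable.analyticAt z₀) h0
  have hz₀ : g (ofC z₀) = ofC (φ z₀) := by
    have h1 : Tendsto (fun z => g (ofC z)) (𝓝[≠] z₀) (𝓝 (g (ofC z₀))) :=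
      ((hg.comp continuous_ofC).tendsto z₀).mono_left nhdsWithin_le_nhds
    have h2 : Tendsto (fun z => ofC (φ z)) (𝓝[≠] z₀) (𝓝 (ofC (φ z₀))) :=
      ((continuous_ofC.tendsto _).comp hφa.continuousAt).mono_left nhdsWithin_le_nhds
    exact tendsto_nhds_unique (h1.congr' hgP) h2
  have hgφ : ∀ᶠ z in 𝓝 z₀, g (ofC z) = ofC (φ z) := by
    rw [eventually_nhdsWithin_iff] at hgP
    filter_upwards [hgP] with z hz
    by_cases h : z = z₀
    · rw [h, hz₀]
    · exact hz h
  have hnc : ¬∀ᶠ z in 𝓝 z₀, deriv φ z = 0 := fun hd => by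
    obtain ⟨ε, hε, hball⟩ := Metric.eventually_nhds_iff_ball.mp (hd.and (hQ.and hφa.eventually_analyticAt))
    obtain ⟨c, hc⟩ := isOpen_ball.exists_is_const_of_deriv_eq_zero
      (convex_ball z₀ ε).isPreconnected
      (fun z hz => (hball z hz).2.2.differentiableAt.differentiableWithinAt)
      (fun z hz => (hball z hz).1)
    have hPQ : P = C c * Q := by
      refine eq_of_infinite_eval_eq _ _ (Set.Infinite.mono (s := ball z₀ ε) (fun z hz => ?_)
        (infinite_of_mem_nhds z₀ (ball_mem_nhds z₀ hε)))
      have := hc z hz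
      simp only [hφ] at this
      rw [div_eq_iff (hball z hz).2.1] at this
      simpa using this
    exact one_ne_zero (hne 1 c (by simpa using hPQ)).1
  obtain ⟨R, M, hLB⟩ := hφa.exists_localBounds hnc
  obtain ⟨ε, hε, hball⟩ := Metric.eventually_nhds_iff_ball.mp hgφ
  obtain ⟨r, L, h⟩ := (hLB.mono (lt_min hε hLB.pos) (min_le_right ε R)).tameNear (g := g)
    fun z hz => hball z (ball_subset_ball (min_le_left _ _) hz)
  exact ⟨_, r, L, h⟩

lemma exists_tameNear_of_eval {g : RSphere → RSphere} (hg : Continuous g) {P Q : ℂ[X]}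
    (hne : ∀ a b : ℂ, C a * P = C b * Q → a = 0 ∧ b = 0) {z₀ : ℂ}
    (h0 : P.eval z₀ ≠ 0 ∨ Q.eval z₀ ≠ 0)
    (hgP : ∀ᶠ z in 𝓝[≠] z₀, g (ofC z) = ofC (P.eval z / Q.eval z)) :
    ∃ D r L, TameNear g D (ofC z₀) r L := by
  by_cases hQ : Q.eval z₀ = 0
  · have hP : P.eval z₀ ≠ 0 := h0.resolve_right (not_not.mpr hQ)
    have hQ0 : Q ≠ 0 := by
      rintro rfl
      exact one_ne_zero (hne 0 1 (by simp)).2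
    obtain ⟨D, r, L, h⟩ := exists_tameNear_of_eval_of_ne_zero (g := fun x => inv (g x)) (P := Q)
      (Q := P) (isometry_inv.continuous.comp hg) (fun a b hab => (hne b a hab.symm).symm) hP (by
        filter_upwards [hgP, Polynomial.eventually_eval_ne_zero hQ0 z₀,
          nhdsWithin_le_nhds (P.continuous.continuousAt.eventually_ne hP)] with z h1 h2 h3
        rw [h1, inv_ofC (div_ne_zero h3 h2), inv_div])
    exact ⟨_, r, L, h.conj (b := id) isometry_inv isometry_id RSphere.inv_inv (fun _ => rfl)
      fun x => (RSphere.inv_inv _).symm⟩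
  · exact exists_tameNear_of_eval_of_ne_zero hg hne hQ hgP

lemma Polynomial.eval_inv_eq_reflect {P : ℂ[X]} {d : ℕ} (hd : P.natDegree ≤ d) {z : ℂ} (hz : z ≠ 0) :
    P.eval z⁻¹ = (P.reflect d).eval z * z⁻¹ ^ d := by
  let _ := invertibleOfNonzero (inv_ne_zero hz)
  have := eval₂_reflect_mul_pow (RingHom.id ℂ) z⁻¹ d P hd
  rw [invOf_eq_inv, _root_.inv_inv] at this
  exact this.symm

lemma Polynomial.natDegree_eq_zero_of_C_mul_eq {P Q : ℂ[X]} (h : IsCoprime P Q) {a b : ℂ} (ha : a ≠ 0)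
    (hab : C a * P = C b * Q) : P.natDegree = 0 ∧ Q.natDegree = 0 := by
  have hP : P = C (a⁻¹ * b) * Q := by
    rw [C_mul, mul_assoc, ← hab, ← mul_assoc, ← C_mul, inv_mul_cancel₀ ha, C_1, one_mul]
  have hQ : Q.natDegree = 0 :=
    natDegree_eq_zero_of_isUnit (h.isUnit_of_dvd' (hP ▸ dvd_mul_left Q _) dvd_rfl)
  refine ⟨?_, hQ⟩
  rw [hP]
  exact Nat.le_zero.mp ((natDegree_C_mul_le _ _).trans hQ.le)

/-- A nonconstant rational map is conformal up to controlled errors. -/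
lemma IsRationalMap.exists_tameMap {f : RSphere → RSphere} {p q : ℂ[X]} (hf : IsRationalMap f p q)
    (hdeg : 2 ≤ ratDeg p q) : ∃ t L, TameMap f (sphDeriv f) t L := by
  have hne : ∀ a b : ℂ, C a * p = C b * q → a = 0 ∧ b = 0 := fun a b hab => by
    by_contra hcon
    rw [not_and_or] at hcon
    have hz : p.natDegree = 0 ∧ q.natDegree = 0 := hcon.elim
      (fun ha => natDegree_eq_zero_of_C_mul_eq hf.coprime ha hab)
      fun hb => (natDegree_eq_zero_of_C_mul_eq hf.coprime.symm hb hab.symm).symm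
    simp [ratDeg, hz] at hdeg
  have hq0 : q ≠ 0 := by
    rintro rfl
    exact one_ne_zero (hne 0 1 (by simp)).2
  refine exists_tameMap_of_tameNear fun x₀ => ?_
  rcases cases_ofC x₀ with rfl | ⟨z₀, rfl⟩
  · set d := ratDeg p q with hd
    have hpd : p.natDegree ≤ d := le_max_left _ _
    have hqd : q.natDegree ≤ d := le_max_right _ _
    obtain ⟨D, r, L, h⟩ := exists_tameNear_of_eval (g := fun x => f (inv x)) (P := p.reflect d)
      (Q := q.reflect d) (z₀ := 0) (hf.continuous.comp isometry_inv.continuous)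
      (fun a b hab => hne a b (by
        rw [← reflect_C_mul, ← reflect_C_mul] at hab
        simpa using congrArg (reflect d) hab))
      (by
        rw [← coeff_zero_eq_eval_zero, ← coeff_zero_eq_eval_zero, coeff_reflect, coeff_reflect,
          revAt_le (Nat.zero_le d), Nat.sub_zero]
        rcases max_choice p.natDegree q.natDegree with h | h
        · left
          rw [hd, ratDeg, h]
          exact leadingCoeff_ne_zero.mpr fun h0 => one_ne_zero (hne 1 0 (by simp [h0])).1
        · right
          rw [hd, ratDeg, h]
          exact leadingCoeff_ne_zero.mpr hq0)
      (by
        filter_upwards [self_mem_nhdsWithin,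
          Polynomial.eventually_eval_ne_zero (reflect_eq_zero_iff.not.mpr hq0 : q.reflect d ≠ 0) 0]
          with z hz hqz
        have hz : z ≠ 0 := hz
        have hzd : z⁻¹ ^ d ≠ 0 := pow_ne_zero _ (inv_ne_zero hz)
        rw [inv_ofC hz, hf.eval, Polynomial.eval_inv_eq_reflect hpd hz,
          Polynomial.eval_inv_eq_reflect hqd hz, mul_div_mul_right _ _ hzd]
        rw [Polynomial.eval_inv_eq_reflect hqd hz]
        exact mul_ne_zero hqz hzd)
    have h' := h.conj (f := f) (a := id) isometry_id isometry_inv (fun _ => rfl) RSphere.inv_inv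
      fun x => by simp [RSphere.inv_inv]
    rw [inv_ofC_zero] at h'
    exact ⟨_, r, L, h'⟩
  · refine exists_tameNear_of_eval hf.continuous hne ?_
      ((Polynomial.eventually_eval_ne_zero hq0 z₀).mono fun z hz => hf.eval z hz)
    by_contra! hcon
    obtain ⟨u, v, huv⟩ := hf.coprime
    have := congrArg (Polynomial.eval z₀) huv
    simp [hcon.1, hcon.2] at this

end RationalMap

namespace TameMap
variable {f : RSphere → RSphere} {t : RSphere → ℝ} {L : ℝ}

/-- The chain rule for the spherical derivative. -/
lemma sphDeriv_iterate (h : TameMap f (sphDeriv f) t L) (n : ℕ) (x : RSphere) :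
    sphDeriv (f^[n]) x = orbitProd f (sphDeriv f) n x := by
  have key : ∀ n : ℕ, ∃ C : ℝ, ∀ u, |dist (f^[n] u) (f^[n] x) -
      orbitProd f (sphDeriv f) n x * dist u x| ≤ C * dist u x * dist u x := fun n => by
    induction n with
    | zero => exact ⟨0, fun u => by simp⟩
    | succ n ih =>
      obtain ⟨C, hC⟩ := ih
      refine ⟨L * L ^ n * L ^ n + sphDeriv f (f^[n] x) * C, fun u => ?_⟩
      have hL := h.L_pos
      have h1 := h.approx (f^[n] x) (f^[n] u) (f^[n] x) _ le_rfl (by simp)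
      have h2 := h.dist_iterate_le n u x
      have h3 := mul_le_mul_of_nonneg_left (hC u) (h.D_nonneg (f^[n] x))
      rw [← abs_of_nonneg (h.D_nonneg (f^[n] x)), ← abs_mul, abs_of_nonneg (h.D_nonneg (f^[n] x))]
        at h3
      rw [Function.iterate_succ_apply', Function.iterate_succ_apply', orbitProd_succ]
      have h4 : L * dist (f^[n] u) (f^[n] x) * dist (f^[n] u) (f^[n] x) ≤
          L * (L ^ n * dist u x) * (L ^ n * dist u x) := by gcongr
      have h5 := abs_add_le (dist (f (f^[n] u)) (f (f^[n] x)) -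
        sphDeriv f (f^[n] x) * dist (f^[n] u) (f^[n] x)) (sphDeriv f (f^[n] x) *
          (dist (f^[n] u) (f^[n] x) - orbitProd f (sphDeriv f) n x * dist u x))
      rw [show dist (f (f^[n] u)) (f (f^[n] x)) -
        sphDeriv f (f^[n] x) * dist (f^[n] u) (f^[n] x) + sphDeriv f (f^[n] x) *
          (dist (f^[n] u) (f^[n] x) - orbitProd f (sphDeriv f) n x * dist u x) =
        dist (f (f^[n] u)) (f (f^[n] x)) -
          orbitProd f (sphDeriv f) n x * sphDeriv f (f^[n] x) * dist u x by ring] at h5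
      refine h5.trans ((add_le_add (h1.trans h4) h3).trans (le_of_eq (by ring)))
  obtain ⟨C, hC⟩ := key n
  exact sphDeriv_eq_of_eventually_le (.of_forall hC)

lemma expandingOn (h : TameMap f (sphDeriv f) t L) {Λ : Set RSphere} {c l : ℝ} (hc : 0 < c)
    (hl : 1 < l) (hcl : ∀ z ∈ Λ, ∀ m : ℕ, c * l ^ m ≤ orbitProd f (sphDeriv f) m z) :
    ExpandingOn f Λ :=
  ⟨c, hc, l, hl, fun x hx m _ => by rw [h.sphDeriv_iterate]; exact hcl x hx m⟩

/-- On an expanding set the orbit products are bounded below by a positive constant. -/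
lemma exists_le_orbitProd (h : TameMap f (sphDeriv f) t L) {Λ : Set RSphere}
    (hΛ : ExpandingOn f Λ) :
    ∃ c : ℝ, 0 < c ∧ c ≤ 1 ∧ ∀ x ∈ Λ, ∀ m : ℕ, c ≤ orbitProd f (sphDeriv f) m x := by
  obtain ⟨c, hc, l, hl, H⟩ := hΛ
  refine ⟨min c 1, lt_min hc one_pos, min_le_right _ _, fun x hx m => ?_⟩
  rcases Nat.eq_zero_or_pos m with rfl | hm
  · simp
  · have h1 := H x hx m hm
    rw [h.sphDeriv_iterate] at h1
    have h2 : 1 ≤ l ^ m := one_le_pow₀ hl.le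
    nlinarith [min_le_left c 1]

/-- The Lyapunov level sets with positive exponents. -/
lemma levelSet_subset (h : TameMap f (sphDeriv f) t L) {α β : ℝ} (hα : 0 < α) :
    levelSet f (α : EReal) (β : EReal) ⊆ {x | HasExponents f (sphDeriv f) α β x} := by
  rintro x ⟨-, hlow, hup⟩
  simp only [lyapLower, lyapUpper, h.sphDeriv_iterate] at hlow hup
  have hpos : ∀ n, 0 < orbitProd f (sphDeriv f) n x := fun n => by
    refine (h.orbitProd_nonneg n x).lt_of_ne' fun h0 => ?_
    have h1 : ∀ᶠ m : ℕ in atTop,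
        ((Real.log (orbitProd f (sphDeriv f) m x) / m : ℝ) : EReal) = 0 := by
      filter_upwards [eventually_ge_atTop n] with m hm
      obtain ⟨k, rfl⟩ := Nat.exists_eq_add_of_le hm
      rw [orbitProd_add, h0]
      simp
    rw [liminf_congr h1, liminf_const] at hlow
    exact hα.ne (by exact_mod_cast hlow)
  refine ⟨hpos, fun ε hε => ?_⟩
  have h1 : ((α - ε : ℝ) : EReal) < liminf (fun n : ℕ =>
      ((Real.log (orbitProd f (sphDeriv f) n x) / n : ℝ) : EReal)) atTop := by
    rw [hlow]; exact_mod_cast sub_lt_self α hε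
  have h2 : limsup (fun n : ℕ =>
      ((Real.log (orbitProd f (sphDeriv f) n x) / n : ℝ) : EReal)) atTop < ((β + ε : ℝ) : EReal) := by
    rw [hup]; exact_mod_cast lt_add_of_pos_right β hε
  filter_upwards [eventually_lt_of_lt_liminf h1, eventually_lt_of_limsup_lt h2,
    eventually_gt_atTop 0] with n hn1 hn2 hn
  have hn0 : (0 : ℝ) < n := by exact_mod_cast hn
  rw [EReal.coe_lt_coe_iff] at hn1 hn2
  rw [lt_div_iff₀ hn0] at hn1
  rw [div_lt_iff₀ hn0] at hn2
  exact ⟨(Real.le_log_iff_exp_le (hpos n)).mp hn1.le, (Real.log_le_iff_le_exp (hpos n)).mp hn2.le⟩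

end TameMap

/-- A set on which the iterates are uniformly not equicontinuous lies in the Julia set. -/
lemma subset_juliaSet {f : RSphere → RSphere} {Λ : Set RSphere} {η : ℝ} (hη : 0 < η)
    (H : ∀ z ∈ Λ, ∀ δ > 0, ∃ (N : ℕ) (v : RSphere), dist v z < δ ∧ η ≤ dist (f^[N] v) (f^[N] z)) :
    Λ ⊆ juliaSet f := by
  rintro z hz ⟨U, hU, hzU, heq⟩
  have h1 := heq z hzU _ (Metric.dist_mem_uniformity hη)
  rw [hU.nhdsWithin_eq hzU, Metric.eventually_nhds_iff] at h1
  obtain ⟨δ, hδ, h1⟩ := h1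
  obtain ⟨N, v, hv, hN⟩ := H z hz δ hδ
  have : dist (f^[N] z) (f^[N] v) < η := h1 hv N
  rw [dist_comm] at this
  linarith

/-- The supremum over separated sets in the definition of the pressure. -/
noncomputable def sepPartition (g : RSphere → RSphere) (Λ : Set RSphere) (φ : RSphere → ℝ) (m : ℕ)
    (ε : ℝ) : ℝ :=
  ⨆ E : {E : Finset RSphere // IsSepSet g Λ m ε E}, ∑ x ∈ E.1, Real.exp (birkhoff g φ m x)

/-- The potential `-d log |f'|`. -/
noncomputable def geomPotential (f : RSphere → RSphere) (d : ℝ) (x : RSphere) : ℝ :=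
  -d * Real.log (sphDeriv f x)

lemma birkhoff_geomPotential {f : RSphere → RSphere} {x : RSphere}
    (hx : ∀ k, 0 < orbitProd f (sphDeriv f) k x) (d : ℝ) (m : ℕ) :
    birkhoff f (geomPotential f d) m x = -d * Real.log (orbitProd f (sphDeriv f) m x) := by
  have hD : ∀ k, sphDeriv f (f^[k] x) ≠ 0 := fun k h0 => by
    have := hx (k + 1)
    rw [orbitProd_succ, h0, mul_zero] at this
    exact this.false
  simp only [birkhoff, geomPotential, orbitProd]
  rw [Real.log_prod fun k _ => hD k, Finset.mul_sum]

lemma birkhoff_geomPotential_mul (f : RSphere → RSphere) (τ d : ℝ) (m : ℕ) (x : RSphere) :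
    birkhoff f (geomPotential f (τ * d)) m x = τ * birkhoff f (geomPotential f d) m x := by
  simp only [birkhoff, geomPotential, Finset.mul_sum]
  exact Finset.sum_congr rfl fun _ _ => by ring

/-- The sets over which the supremum in the definition of the pressure is taken. -/
def IsExpandingSet (f : RSphere → RSphere) (Λ : Set RSphere) : Prop :=
  Λ.Nonempty ∧ Λ ⊆ juliaSet f ∧ IsCompact Λ ∧ f '' Λ = Λ ∧ ExpandingOn f Λ

lemma sum_exp_mul_le {ι : Type*} (s : Finset ι) (S : ι → ℝ) {τ : ℝ} (hτ : 1 ≤ τ) :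
    ∑ x ∈ s, Real.exp (τ * S x) ≤ (∑ x ∈ s, Real.exp (S x)) ^ τ := by
  have hterm : ∀ x ∈ s, Real.exp (τ * S x) ≤
      Real.exp (S x) * (∑ x ∈ s, Real.exp (S x)) ^ (τ - 1) := fun x hx => by
    have h1 : Real.exp (τ * S x) = Real.exp (S x) * Real.exp (S x) ^ (τ - 1) := by
      rw [← Real.exp_mul, ← Real.exp_add]; ring_nf
    have h2 := Finset.single_le_sum (f := fun x => Real.exp (S x)) (fun i _ => (Real.exp_pos _).le) hx
    rw [h1]
    gcongr
  refine (Finset.sum_le_sum hterm).trans ?_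
  rw [← Finset.sum_mul]
  rcases s.eq_empty_or_nonempty with rfl | hs
  · simp [Real.zero_rpow (by linarith : τ ≠ 0)]
  · have hpos : 0 < ∑ x ∈ s, Real.exp (S x) := Finset.sum_pos (fun i _ => Real.exp_pos _) hs
    rw [Real.rpow_sub_one hpos.ne', mul_div_cancel₀ _ hpos.ne']

lemma isSepSet_singleton {f : RSphere → RSphere} {Λ : Set RSphere} {x : RSphere} (hx : x ∈ Λ) (m : ℕ) (ε : ℝ) :
    IsSepSet f Λ m ε {x} :=
  ⟨by simpa, by simp⟩

namespace TameMap
variable {f : RSphere → RSphere} {t : RSphere → ℝ} {L : ℝ} {Λ : Set RSphere}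

lemma card_le_of_isSepSet (h : TameMap f (sphDeriv f) t L) {m : ℕ} {ε : ℝ} (hε : 0 < ε)
    {E : Finset RSphere} (hE : IsSepSet f Λ m ε E) :
    (E.card : ℝ) ≤ 27 * (2 * (2 + ε) / ε) ^ 3 * Real.exp (3 * Real.log L * m) := by
  have hL := h.L_pos
  have hLm : 1 ≤ L ^ m := one_le_pow₀ h.one_le
  rcases E.eq_empty_or_nonempty with rfl | ⟨c, -⟩
  · simp; positivity
  have hsep : ∀ x ∈ E, ∀ y ∈ E, x ≠ y → ε / (2 * L ^ m) < dist x y := fun x hx y hy hxy => by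
    obtain ⟨k, hk, hd⟩ := hE.2 x hx y hy hxy
    have h1 := h.dist_iterate_le k x y
    have h2 : L ^ k * dist x y ≤ L ^ m * dist x y := by
      gcongr
      exact h.one_le
    rw [div_lt_iff₀ (by positivity)]
    nlinarith
  have h1 := RSphere.card_le_of_separated E c (R := 2 + ε) (ρ := ε / (2 * L ^ m)) (by positivity)
    ((div_le_self hε.le (by linarith)).trans (by linarith))
    (fun x _ => (RSphere.dist_le_two x c).trans (by linarith)) hsep
  have h2 : Real.exp (3 * Real.log L * m) = (L ^ m) ^ 3 := by
    rw [show 3 * Real.log L * m = Real.log L * ((m * 3 : ℕ) : ℝ) by push_cast; ring, Real.exp_mul,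
      Real.exp_log hL, Real.rpow_natCast, pow_mul]
  rw [h2]
  refine h1.trans (le_of_eq ?_)
  field_simp

/-- The a priori bounds for Birkhoff sums on an expanding set. -/
lemma exists_birkhoff_bound (h : TameMap f (sphDeriv f) t L) (hΛ : ExpandingOn f Λ) (d : ℝ) :
    ∃ K : ℝ, 0 ≤ K ∧ ∀ x ∈ Λ, (∀ k, 0 < orbitProd f (sphDeriv f) k x) ∧ ∀ m : ℕ,
      birkhoff f (geomPotential f d) m x ≤ K + max (-d) 0 * Real.log L * m ∧
      -K - |d| * Real.log L * m ≤ birkhoff f (geomPotential f d) m x := by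
  obtain ⟨c, hc, hc1, H⟩ := h.exists_le_orbitProd hΛ
  have hlc : Real.log c ≤ 0 := Real.log_nonpos hc.le hc1
  have hlL : 0 ≤ Real.log L := Real.log_nonneg h.one_le
  refine ⟨|d| * -Real.log c, by have := abs_nonneg d; nlinarith, fun x hx => ?_⟩
  have hpos : ∀ k, 0 < orbitProd f (sphDeriv f) k x := fun k => hc.trans_le (H x hx k)
  refine ⟨hpos, fun m => ?_⟩
  rw [birkhoff_geomPotential hpos]
  have h1 := Real.log_le_log hc (H x hx m)
  have h2 := Real.log_le_log (hpos m) (h.orbitProd_le_pow m x)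
  rw [Real.log_pow] at h2
  have h3 : 0 ≤ m * Real.log L := by positivity
  set y := Real.log (orbitProd f (sphDeriv f) m x)
  rcases le_total 0 d with hd | hd
  · rw [max_eq_right (by linarith), abs_of_nonneg hd]
    constructor <;> nlinarith
  · rw [max_eq_left (by linarith), abs_of_nonpos hd]
    constructor <;> nlinarith

/-- The exponential growth bound for the pressure at `d`. -/
lemma exists_sepPartition_bound (h : TameMap f (sphDeriv f) t L) (hΛ : ExpandingOn f Λ) (d : ℝ)
    {ε : ℝ} (hε : 0 < ε) : ∃ C : ℝ, 0 < C ∧ ∀ m : ℕ, ∀ E : Finset RSphere, IsSepSet f Λ m ε E →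
      ∑ x ∈ E, Real.exp (birkhoff f (geomPotential f d) m x) ≤
        C * Real.exp ((3 + max (-d) 0) * Real.log L * m) := by
  obtain ⟨K, -, hK⟩ := h.exists_birkhoff_bound hΛ d
  refine ⟨27 * (2 * (2 + ε) / ε) ^ 3 * Real.exp K, by positivity, fun m E hE => ?_⟩
  have h1 : ∑ x ∈ E, Real.exp (birkhoff f (geomPotential f d) m x) ≤
      E.card • Real.exp (K + max (-d) 0 * Real.log L * m) :=
    Finset.sum_le_card_nsmul _ _ _ fun x hx =>
      Real.exp_le_exp.mpr (((hK x (hE.1 hx)).2 m).1)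
  rw [nsmul_eq_mul] at h1
  refine h1.trans ((mul_le_mul_of_nonneg_right (h.card_le_of_isSepSet hε hE)
    (Real.exp_pos _).le).trans (le_of_eq ?_))
  rw [Real.exp_add, add_mul, add_mul, Real.exp_add]
  ring

lemma sum_le_sepPartition (h : TameMap f (sphDeriv f) t L) (hΛ : ExpandingOn f Λ) (d : ℝ)
    {ε : ℝ} (hε : 0 < ε) {m : ℕ} {E : Finset RSphere} (hE : IsSepSet f Λ m ε E) :
    ∑ x ∈ E, Real.exp (birkhoff f (geomPotential f d) m x) ≤
      sepPartition f Λ (geomPotential f d) m ε := by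
  obtain ⟨C, -, hC⟩ := h.exists_sepPartition_bound hΛ d hε
  exact le_ciSup (f := fun E : {E : Finset RSphere // IsSepSet f Λ m ε E} =>
      ∑ x ∈ E.1, Real.exp (birkhoff f (geomPotential f d) m x))
    ⟨_, by rintro _ ⟨E, rfl⟩; exact hC m E.1 E.2⟩ ⟨E, hE⟩

lemma sepPartition_pos (h : TameMap f (sphDeriv f) t L) (hΛ : IsExpandingSet f Λ) (d : ℝ)
    {ε : ℝ} (hε : 0 < ε) (m : ℕ) : 0 < sepPartition f Λ (geomPotential f d) m ε := by
  obtain ⟨x, hx⟩ := hΛ.1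
  refine lt_of_lt_of_le ?_ (h.sum_le_sepPartition hΛ.2.2.2.2 d hε (isSepSet_singleton hx m ε))
  simpa using Real.exp_pos _

lemma eventually_ge (h : TameMap f (sphDeriv f) t L) (hΛ : IsExpandingSet f Λ) (d : ℝ)
    {ε : ℝ} (hε : 0 < ε) {v : ℝ} (hv : v < -(|d| * Real.log L)) : ∀ᶠ m : ℕ in atTop,
      v ≤ Real.log (sepPartition f Λ (geomPotential f d) m ε) / m := by
  obtain ⟨x, hx⟩ := hΛ.1
  obtain ⟨K, -, hK⟩ := h.exists_birkhoff_bound hΛ.2.2.2.2 d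
  have hlim : Tendsto (fun m : ℕ => -K / m - |d| * Real.log L) atTop (𝓝 (0 - |d| * Real.log L)) :=
    (tendsto_const_div_atTop_nhds_zero_nat _).sub_const _
  filter_upwards [hlim.eventually (lt_mem_nhds (by simpa using hv)), eventually_gt_atTop 0]
    with m hm hm0
  have hm0 : (0 : ℝ) < m := by exact_mod_cast hm0
  refine hm.le.trans ?_
  have h1 := h.sum_le_sepPartition hΛ.2.2.2.2 d hε (isSepSet_singleton hx m ε)
  rw [Finset.sum_singleton] at h1
  rw [le_div_iff₀ hm0, Real.le_log_iff_exp_le (h.sepPartition_pos hΛ d hε m)]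
  refine le_trans (Real.exp_le_exp.mpr ?_) h1
  refine le_trans (le_of_eq ?_) ((hK x hx).2 m).2
  field_simp

lemma eventually_le (h : TameMap f (sphDeriv f) t L) (hΛ : IsExpandingSet f Λ) (d : ℝ)
    {ε : ℝ} (hε : 0 < ε) {v : ℝ} (hv : (3 + max (-d) 0) * Real.log L < v) : ∀ᶠ m : ℕ in atTop,
      Real.log (sepPartition f Λ (geomPotential f d) m ε) / m ≤ v := by
  obtain ⟨C, hC, hCm⟩ := h.exists_sepPartition_bound hΛ.2.2.2.2 d hε
  have hlim : Tendsto (fun m : ℕ => Real.log C / m + (3 + max (-d) 0) * Real.log L) atTop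
      (𝓝 (0 + (3 + max (-d) 0) * Real.log L)) :=
    (tendsto_const_div_atTop_nhds_zero_nat _).add_const _
  filter_upwards [hlim.eventually (gt_mem_nhds (by simpa using hv)), eventually_gt_atTop 0]
    with m hm hm0
  have hm0 : (0 : ℝ) < m := by exact_mod_cast hm0
  refine le_trans ?_ hm.le
  have h1 : sepPartition f Λ (geomPotential f d) m ε ≤
      C * Real.exp ((3 + max (-d) 0) * Real.log L * m) := by
    obtain ⟨x, hx⟩ := hΛ.1
    have : Nonempty {E : Finset RSphere // IsSepSet f Λ m ε E} :=
      ⟨⟨{x}, isSepSet_singleton hx m ε⟩⟩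
    exact ciSup_le fun E => hCm m E.1 E.2
  have h2 := Real.log_le_log (h.sepPartition_pos hΛ d hε m) h1
  rw [Real.log_mul hC.ne' (Real.exp_pos _).ne', Real.log_exp] at h2
  rw [div_le_iff₀ hm0, add_mul, div_mul_cancel₀ _ hm0.ne']
  exact h2

end TameMap

lemma pressFamily_eq (f : RSphere → RSphere) (d : ℝ) : pressFamily f d =
    ⨆ Λ : {Λ : Set RSphere // IsExpandingSet f Λ}, ⨆ ε : {ε : ℝ // 0 < ε}, limsup (fun m : ℕ =>
      Real.log (sepPartition f Λ.1 (geomPotential f d) m ε.1) / m) atTop := rfl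

namespace TameMap
variable {f : RSphere → RSphere} {t : RSphere → ℝ} {L : ℝ} {Λ : Set RSphere}

lemma limsup_le (h : TameMap f (sphDeriv f) t L) (hΛ : IsExpandingSet f Λ) {d ε v : ℝ}
    (hε : 0 < ε)
    (hv : ∀ᶠ m : ℕ in atTop, Real.log (sepPartition f Λ (geomPotential f d) m ε) / m ≤ v) :
    limsup (fun m : ℕ => Real.log (sepPartition f Λ (geomPotential f d) m ε) / m) atTop ≤ v :=
  limsup_le_of_le (IsBoundedUnder.isCoboundedUnder_le
    ⟨_, eventually_map.mpr (h.eventually_ge hΛ d hε (sub_one_lt _))⟩) hv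

lemma limsup_le_bound (h : TameMap f (sphDeriv f) t L) (hΛ : IsExpandingSet f Λ) (d : ℝ) {ε : ℝ}
    (hε : 0 < ε) :
    limsup (fun m : ℕ => Real.log (sepPartition f Λ (geomPotential f d) m ε) / m) atTop ≤
      (3 + max (-d) 0) * Real.log L :=
  le_of_forall_gt_imp_ge_of_dense fun _ hv => h.limsup_le hΛ hε (h.eventually_le hΛ d hε hv)

lemma iSup_limsup_le_bound (h : TameMap f (sphDeriv f) t L) (hΛ : IsExpandingSet f Λ) (d : ℝ) :
    ⨆ ε : {ε : ℝ // 0 < ε}, limsup (fun m : ℕ =>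
      Real.log (sepPartition f Λ (geomPotential f d) m ε.1) / m) atTop ≤
      (3 + max (-d) 0) * Real.log L := by
  have : Nonempty {ε : ℝ // 0 < ε} := ⟨⟨1, one_pos⟩⟩
  exact ciSup_le fun ε => h.limsup_le_bound hΛ d ε.2

lemma pressFamily_le (h : TameMap f (sphDeriv f) t L) (d : ℝ) :
    pressFamily f d ≤ (3 + max (-d) 0) * Real.log L := by
  rw [pressFamily_eq]
  have hlL : 0 ≤ Real.log L := Real.log_nonneg h.one_le
  exact Real.iSup_le (fun Λ => h.iSup_limsup_le_bound Λ.2 d) (by positivity)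

lemma limsup_le_pressFamily (h : TameMap f (sphDeriv f) t L) (hΛ : IsExpandingSet f Λ) (d : ℝ)
    {ε : ℝ} (hε : 0 < ε) :
    limsup (fun m : ℕ => Real.log (sepPartition f Λ (geomPotential f d) m ε) / m) atTop ≤
      pressFamily f d := by
  rw [pressFamily_eq]
  refine le_ciSup_of_le ⟨(3 + max (-d) 0) * Real.log L, ?_⟩ ⟨Λ, hΛ⟩
    (le_ciSup_of_le ⟨(3 + max (-d) 0) * Real.log L, ?_⟩ ⟨ε, hε⟩ le_rfl)
  · rintro _ ⟨Λ, rfl⟩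
    exact h.iSup_limsup_le_bound Λ.2 d
  · rintro _ ⟨ε, rfl⟩
    exact h.limsup_le_bound hΛ d ε.2

lemma le_pressFamily (h : TameMap f (sphDeriv f) t L) (hΛ : IsExpandingSet f Λ) {d ε v : ℝ}
    (hε : 0 < ε)
    (hv : ∃ᶠ m : ℕ in atTop, v ≤ Real.log (sepPartition f Λ (geomPotential f d) m ε) / m) :
    v ≤ pressFamily f d :=
  (le_limsup_of_frequently_le hv
    ⟨_, eventually_map.mpr (h.eventually_le hΛ d hε (lt_add_one _))⟩).trans
    (h.limsup_le_pressFamily hΛ d hε)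

lemma neg_le_pressFamily (h : TameMap f (sphDeriv f) t L) (d : ℝ) :
    -(|d| * Real.log L) ≤ pressFamily f d := by
  by_cases hne : ∃ Λ, IsExpandingSet f Λ
  · obtain ⟨Λ, hΛ⟩ := hne
    exact le_of_forall_lt_imp_le_of_dense fun v hv =>
      h.le_pressFamily hΛ one_pos (h.eventually_ge hΛ d one_pos hv).frequently
  · have : IsEmpty {Λ : Set RSphere // IsExpandingSet f Λ} := ⟨fun Λ => hne ⟨Λ.1, Λ.2⟩⟩
    rw [pressFamily_eq, Real.iSup_of_isEmpty, Left.neg_nonpos_iff]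
    exact mul_nonneg (abs_nonneg _) (Real.log_nonneg h.one_le)

lemma log_sepPartition_mul_le (h : TameMap f (sphDeriv f) t L) (hΛ : IsExpandingSet f Λ)
    {τ : ℝ} (hτ : 1 ≤ τ) (d : ℝ) {ε : ℝ} (hε : 0 < ε) (m : ℕ) :
    Real.log (sepPartition f Λ (geomPotential f (τ * d)) m ε) ≤
      τ * Real.log (sepPartition f Λ (geomPotential f d) m ε) := by
  obtain ⟨x, hx⟩ := hΛ.1
  have : Nonempty {E : Finset RSphere // IsSepSet f Λ m ε E} := ⟨⟨{x}, isSepSet_singleton hx m ε⟩⟩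
  rw [← Real.log_rpow (h.sepPartition_pos hΛ d hε m)]
  refine Real.log_le_log (h.sepPartition_pos hΛ _ hε m) (ciSup_le fun E => ?_)
  simp only [birkhoff_geomPotential_mul]
  refine (sum_exp_mul_le _ _ hτ).trans ?_
  refine Real.rpow_le_rpow (Finset.sum_nonneg fun _ _ => (Real.exp_pos _).le) ?_ (by linarith)
  exact h.sum_le_sepPartition hΛ.2.2.2.2 d hε E.2

/-- Subhomogeneity of the pressure function. -/
lemma pressFamily_mul_le (h : TameMap f (sphDeriv f) t L) {τ : ℝ} (hτ : 1 ≤ τ) (d : ℝ) :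
    pressFamily f (τ * d) ≤ τ * pressFamily f d := by
  have hτ0 : 0 < τ := by linarith
  by_cases hne : ∃ Λ, IsExpandingSet f Λ
  · have : Nonempty {Λ : Set RSphere // IsExpandingSet f Λ} := hne.elim fun Λ hΛ => ⟨⟨Λ, hΛ⟩⟩
    have : Nonempty {ε : ℝ // 0 < ε} := ⟨⟨1, one_pos⟩⟩
    rw [pressFamily_eq f (τ * d)]
    refine ciSup_le fun ⟨Λ, hΛ⟩ => ciSup_le fun ⟨ε, hε⟩ => ?_
    refine le_of_forall_gt_imp_ge_of_dense fun v hv => h.limsup_le hΛ hε ?_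
    have h1 : limsup (fun m : ℕ => Real.log (sepPartition f Λ (geomPotential f d) m ε) / m) atTop <
        v / τ := (h.limsup_le_pressFamily hΛ d hε).trans_lt (by rwa [lt_div_iff₀' hτ0])
    filter_upwards [eventually_lt_of_limsup_lt h1
      ⟨_, eventually_map.mpr (h.eventually_le hΛ d hε (lt_add_one _))⟩] with m hm
    rw [lt_div_iff₀' hτ0] at hm
    refine le_trans ?_ hm.le
    rw [← mul_div_assoc]
    exact div_le_div_of_nonneg_right (h.log_sepPartition_mul_le hΛ hτ d hε m) m.cast_nonneg
  · have : IsEmpty {Λ : Set RSphere // IsExpandingSet f Λ} := ⟨fun Λ => hne ⟨Λ.1, Λ.2⟩⟩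
    rw [pressFamily_eq, pressFamily_eq, Real.iSup_of_isEmpty, Real.iSup_of_isEmpty, mul_zero]

lemma bddAbove_slope (h : TameMap f (sphDeriv f) t L) {d : ℝ} (hd : 0 < d) :
    -pressFamily f d / d ≤ Real.log L := by
  rw [div_le_iff₀ hd]
  have := h.neg_le_pressFamily d
  rw [abs_of_pos hd] at this
  linarith

lemma bddBelow_slope (h : TameMap f (sphDeriv f) t L) {d : ℝ} (hd : d < 0) :
    -Real.log L ≤ -pressFamily f d / d := by
  rw [le_div_iff_of_neg hd]
  have := h.neg_le_pressFamily d
  rw [abs_of_neg hd] at this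
  linarith

lemma le_alphaMinus (h : TameMap f (sphDeriv f) t L) {d : ℝ} (hd : 0 < d) :
    -pressFamily f d / d ≤ alphaMinus f := by
  refine le_limsup_of_frequently_le (Eventually.frequently ?_) ⟨Real.log L, eventually_map.mpr ?_⟩
  · filter_upwards [eventually_ge_atTop d] with e he
    have he0 : 0 < e := hd.trans_le he
    have h1 := h.pressFamily_mul_le ((one_le_div hd).mpr he) d
    rw [div_mul_cancel₀ _ hd.ne'] at h1
    rw [div_le_div_iff₀ hd he0]
    have h2 := mul_le_mul_of_nonneg_right h1 hd.le
    rw [show e / d * pressFamily f d * d = e * pressFamily f d by field_simp] at h2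
    linarith
  · filter_upwards [eventually_gt_atTop 0] with e he using h.bddAbove_slope he

lemma alphaPlus_le (h : TameMap f (sphDeriv f) t L) {d : ℝ} (hd : d < 0) :
    alphaPlus f ≤ -pressFamily f d / d := by
  refine limsup_le_of_le (IsBoundedUnder.isCoboundedUnder_le ⟨-Real.log L, eventually_map.mpr ?_⟩) ?_
  · filter_upwards [eventually_lt_atBot 0] with e he using h.bddBelow_slope he
  · filter_upwards [eventually_le_atBot d] with e he
    have he0 : e < 0 := he.trans_lt hd
    have h1 := h.pressFamily_mul_le ((one_le_div_of_neg hd).mpr he) d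
    rw [div_mul_cancel₀ _ hd.ne] at h1
    rw [neg_div, neg_div, ← div_neg, ← div_neg, div_le_div_iff₀ (neg_pos.mpr he0) (neg_pos.mpr hd)]
    have h2 := mul_le_mul_of_nonneg_right h1 (neg_pos.mpr hd).le
    rw [show e / d * pressFamily f d * -d = pressFamily f d * -e by field_simp [hd.ne]] at h2
    exact h2

lemma alphaMinus_nonneg (h : TameMap f (sphDeriv f) t L) : 0 ≤ alphaMinus f := by
  have hlim : Tendsto (fun d : ℝ => -(3 * Real.log L) / d) atTop (𝓝 0) :=
    tendsto_const_nhds.div_atTop tendsto_id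
  refine le_of_tendsto hlim ?_
  filter_upwards [eventually_gt_atTop 0] with d hd
  refine le_trans ?_ (h.le_alphaMinus hd)
  have h1 := h.pressFamily_le d
  rw [max_eq_right (by linarith), add_zero] at h1
  gcongr

lemma pressFamily_add_nonneg (h : TameMap f (sphDeriv f) t L) {α : ℝ} (h1 : alphaMinus f ≤ α)
    (h2 : α ≤ alphaPlus f) (d : ℝ) : 0 ≤ pressFamily f d + d * α := by
  rcases lt_trichotomy d 0 with hd | rfl | hd
  · have := h2.trans (h.alphaPlus_le hd)
    rw [le_div_iff_of_neg hd] at this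
    linarith
  · simpa using h.neg_le_pressFamily 0
  · have := (h.le_alphaMinus hd).trans h1
    rw [div_le_iff₀ hd] at this
    linarith

end TameMap

namespace TameMap
variable {f : RSphere → RSphere} {t : RSphere → ℝ} {L : ℝ}

/-- The number of branches of a horseshoe is bounded by the pressure. -/
lemma log_card_le (h : TameMap f (sphDeriv f) t L) {κ K r : ℝ} (hκ : 0 < κ) (hK : 0 < K)
    (hr : 0 < r) (hr1 : r ≤ 1) (hKL : 8 * L ≤ κ * K) (hKL' : 2 * L ≤ K) {n : ℕ} (hn : 0 < n)
    {a b : ℝ} (hab : a ≤ b) (ha : 8 ≤ Real.exp (a * n)) {o : RSphere} {Y : Finset RSphere}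
    (hY : IsHorseshoeBase f (sphDeriv f) t κ K r n o (Real.exp (a * n)) (Real.exp (b * n)) Y)
    (hYne : Y.Nonempty) (d : ℝ) :
    Real.log Y.card ≤ |d| * Real.log 2 + (pressFamily f d + d * a + |d| * (b - a)) * n := by
  obtain ⟨Λ, hΛne, hΛc, hΛf, ⟨c, hc, l, hl, hcl⟩, ⟨η, hη, hJ⟩, ε, hε, HE⟩ :=
    h.horseshoe hκ hK hr hr1 hKL hKL' hn ha Y hYne hY.near hY.return_near hY.good hY.lower hY.upper
      hY.sep
  have hΛ : IsExpandingSet f Λ := ⟨hΛne, subset_juliaSet hη hJ, hΛc, hΛf, h.expandingOn hc hl hcl⟩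
  have hn0 : (0 : ℝ) < n := by exact_mod_cast hn
  have hcard : (0 : ℝ) < Y.card := by exact_mod_cast hYne.card_pos
  set w : ℝ := |d| * Real.log 2 + (d * a + |d| * (b - a)) * n with hw
  have hm : ∀ m : ℕ, (Real.log Y.card - w) * m ≤
      Real.log (sepPartition f Λ (geomPotential f d) (n * m) ε) := fun m => by
    obtain ⟨E, hEΛ, hEc, hEsep, hEb⟩ := HE m
    have h1 := h.sum_le_sepPartition hΛ.2.2.2.2 d hε (E := E) (m := n * m) ⟨hEΛ, hEsep⟩
    have h2 : ∀ x ∈ E, Real.exp (-w * m) ≤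
        Real.exp (birkhoff f (geomPotential f d) (n * m) x) := fun x hx => by
      have hpos : ∀ k, 0 < orbitProd f (sphDeriv f) k x := fun k =>
        lt_of_lt_of_le (by positivity) (hcl x (hEΛ hx) k)
      rw [birkhoff_geomPotential hpos]
      refine Real.exp_le_exp.mpr ?_
      obtain ⟨h3, h4⟩ := hEb x hx
      have h3 := Real.log_le_log (by positivity) h3
      have h4 := Real.log_le_log (hpos _) h4
      rw [Real.log_pow, Real.log_div (Real.exp_pos _).ne' two_ne_zero, Real.log_exp] at h3
      rw [Real.log_pow, Real.log_mul two_ne_zero (Real.exp_pos _).ne', Real.log_exp] at h4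
      have hm0 : (0 : ℝ) ≤ m := m.cast_nonneg
      rw [hw]
      rcases le_total 0 d with hd | hd
      · rw [abs_of_nonneg hd]
        nlinarith
      · rw [abs_of_nonpos hd]
        nlinarith [mul_nonneg (mul_nonneg (neg_nonneg.mpr hd) (sub_nonneg.mpr hab))
          (mul_nonneg hn0.le hm0)]
    have h5 : E.card • Real.exp (-w * m) ≤ sepPartition f Λ (geomPotential f d) (n * m) ε :=
      (Finset.card_nsmul_le_sum _ _ _ h2).trans h1
    rw [nsmul_eq_mul, hEc] at h5
    push_cast at h5
    have h6 := Real.log_le_log (by positivity) h5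
    rw [Real.log_mul (by positivity) (Real.exp_pos _).ne', Real.log_pow, Real.log_exp] at h6
    linarith
  have hP : (Real.log Y.card - w) / n ≤ pressFamily f d := by
    refine h.le_pressFamily hΛ hε (frequently_atTop.mpr fun N => ⟨n * (N + 1), ?_, ?_⟩)
    · nlinarith
    · rw [le_div_iff₀ (by push_cast; positivity)]
      refine le_trans (le_of_eq ?_) (hm (N + 1))
      push_cast
      field_simp
  rw [div_le_iff₀ hn0] at hP
  linarith

/-- The upper bound for the dimension in terms of the pressure. -/
theorem dimH_levelSet_le (h : TameMap f (sphDeriv f) t L) {α β s : ℝ} (hα : 0 < α) (hαβ : α ≤ β)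
    (hs : 0 < s) (hP : ∀ q ∈ Icc α β, ∃ d, pressFamily f d + d * q < s * q) :
    dimH (levelSet f (α : EReal) (β : EReal)) ≤ ENNReal.ofReal s := by
  obtain ⟨κ, K, r, hκ, hK, hr, hr1, hKL, hKL', hfail⟩ := h.dimH_fail_le β hs hα
  have hgood := h.dimH_good_le (κ := κ) (K := K) (r := r) (s := s) (α := α) (β := β) hr hs hαβ
    fun q hq => by
      obtain ⟨d, hd⟩ := hP q hq
      have hq0 : 0 < q := hα.trans_le hq.1
      set g := s * q - (pressFamily f d + d * q) with hg
      have hg0 : 0 < g := sub_pos.mpr hd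
      have hd0 := abs_nonneg d
      set δ := min (q / 2) (g / (2 * (3 * |d| + s))) with hδ
      have hδ0 : 0 < δ := lt_min (by positivity) (by positivity)
      have hδq : δ ≤ q / 2 := min_le_left _ _
      have hδg : δ * (3 * |d| + s) ≤ g / 2 := by
        have : δ ≤ g / (2 * (3 * |d| + s)) := min_le_right _ _
        rw [le_div_iff₀ (by positivity)] at this
        linarith
      refine ⟨q - δ, q + δ, pressFamily f d + d * (q - δ) + |d| * (q + δ - (q - δ)),
        Real.exp (|d| * Real.log 2), by linarith, by linarith, by linarith, ?_,
        (Real.exp_pos _).le, fun n hn hn8 o Y hY => ?_⟩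
      · nlinarith [neg_abs_le d]
      · rcases Y.eq_empty_or_nonempty with rfl | hYne
        · simp; positivity
        · rw [← Real.exp_add, ← Real.log_le_iff_le_exp (by exact_mod_cast hYne.card_pos)]
          exact h.log_card_le hκ hK hr hr1 hKL hKL' hn (by linarith) hn8 hY hYne d
  refine (dimH_mono fun x hx => ?_).trans
    ((dimH_union _ _).le.trans (max_le hgood hfail))
  have hx := h.levelSet_subset hα hx
  by_cases hfr : ∃ᶠ n in atTop, GoodTime f (sphDeriv f) t κ K r n x
  · exact Or.inl ⟨hx, hfr⟩
  · exact Or.inr ⟨hx, not_frequently.mp hfr⟩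

end TameMap

lemma exists_of_specF_lt {Q : ℝ → ℝ} {q s : ℝ} (hq : 0 < q) (h : specF Q q < s) :
    ∃ d, Q d + d * q < s * q := by
  by_contra! hcon
  refine h.not_ge ?_
  have h1 : ((s * q : ℝ) : EReal) ≤ ⨅ d : ℝ, ((Q d + d * q : ℝ) : EReal) :=
    le_iInf fun d => EReal.coe_le_coe_iff.mpr (hcon d)
  calc (s : EReal) = ((q⁻¹ : ℝ) : EReal) * ((s * q : ℝ) : EReal) := by
        rw [← EReal.coe_mul]; congr 1; field_simp
    _ ≤ specF Q q := mul_le_mul_of_nonneg_left h1 (by exact_mod_cast (inv_pos.mpr hq).le)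

lemma TameMap.dimH_levelSet_le_max {f : RSphere → RSphere} {t : RSphere → ℝ} {L : ℝ}
    (h : TameMap f (sphDeriv f) t L) {α β : ℝ} (hα : 0 < α) (hαβ : α ≤ β) :
    (dimH (levelSet f (α : EReal) (β : EReal)) : EReal) ≤ max 0 (⨆ s ∈ Set.Icc α β, Ffun f s) := by
  refine EReal.le_of_forall_lt_iff_le.mp fun s hs => ?_
  obtain ⟨hs0, hsF⟩ := max_lt_iff.mp hs
  have hs0 : 0 < s := by exact_mod_cast hs0
  have h1 := h.dimH_levelSet_le hα hαβ hs0 fun q hq => by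
    have hq0 : 0 < q := hα.trans_le hq.1
    have h2 : Ffun f q < s := (le_iSup₂ (f := fun q (_ : q ∈ Icc α β) => Ffun f q) q hq).trans_lt hsF
    rw [Ffun, specFext, if_neg hq0.ne'] at h2
    exact exists_of_specF_lt hq0 h2
  have h3 := EReal.coe_ennreal_le_coe_ennreal_iff.mpr h1
  rwa [EReal.coe_ennreal_ofReal, max_eq_left hs0.le] at h3

/-- **Proposition (upper bound, general case).**
For a rational map `f` of degree `≥ 2` and `0 < α ≤ β ≤ α⁺` we have
`dim_H 𝓛(α,β) ≤ max {0, max_{α ≤ q ≤ β} F(q)}`; in particular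
`dim_H 𝓛(α) ≤ F(α)` for `α ∈ [α⁻, α⁺] \ {0}`. -/
theorem upper_bound_general (f : RSphere → RSphere) (p q : Polynomial ℂ)
    (hf : IsRationalMap f p q) (hdeg : 2 ≤ ratDeg p q) :
    (∀ α β : ℝ, 0 < α → α ≤ β → β ≤ alphaPlus f →
      (dimH (levelSet f (α : EReal) (β : EReal)) : EReal) ≤
        max 0 (⨆ s ∈ Set.Icc α β, Ffun f s)) ∧
    (∀ α : ℝ, alphaMinus f ≤ α → α ≤ alphaPlus f → α ≠ 0 →
      (dimH (levelSet f (α : EReal) (α : EReal)) : EReal) ≤ Ffun f α) := by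
  obtain ⟨t, L, h⟩ := hf.exists_tameMap hdeg
  refine ⟨fun α β hα hαβ _ => h.dimH_levelSet_le_max hα hαβ, fun α h1 h2 hα0 => ?_⟩
  have hα : 0 < α := lt_of_le_of_ne (h.alphaMinus_nonneg.trans h1) hα0.symm
  refine (h.dimH_levelSet_le_max hα le_rfl).trans (max_le ?_ (by simp))
  rw [Ffun, specFext, if_neg hα0]
  refine mul_nonneg (by exact_mod_cast (inv_pos.mpr hα).le) (le_iInf fun d => ?_)
  exact_mod_cast h.pressFamily_add_nonneg h1 h2 d
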